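/- For every n ≥ 5 with n ≠ 6, the total number of regular subgroups of Perm(Sₙ) normalized by λ(Sₙ) is given by #E(Sₙ) = 2 · Σ_{0 ≤ k ≤ n/2} n! / ((n−2k)! · 2ᵏ · k!). -/

import Mathlib

/-- A subgroup `H` of `Perm G` is regular if the evaluation map `η ↦ η 1` is bijective. -/
def IsRegularSubgroup {G : Type*} [Group G] (H : Subgroup (Equiv.Perm G)) : Prop :=
  Function.Bijective fun η : H => (η : Equiv.Perm G) 1

/-- A subgroup `H` of `Perm G` is normalized by the image `λ(G)` of the left regular
representation. -/
def IsNormalizedByLeft {G : Type*} [Group G] (H : Subgroup (Equiv.Perm G)) : Prop :=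
  ∀ σ : G, ∀ η ∈ H, Equiv.mulLeft σ * η * (Equiv.mulLeft σ)⁻¹ ∈ H

namespace HG
open Polynomial

theorem aeval_conj_unit {F A : Type*} [Field F] [Ring A] [Algebra F A] (u : Aˣ) (a : A) (q : F[X]) :
    aeval (u * a * (u⁻¹ : Aˣ) : A) q = u * aeval a q * (u⁻¹ : Aˣ) := by
  induction q using Polynomial.induction_on' with
  | add p q hp hq => simp [hp, hq, mul_add, add_mul]
  | monomial n c =>
    rw [aeval_monomial, aeval_monomial, Units.conj_pow, ← mul_assoc, ← mul_assoc, ← mul_assoc,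
      ← Algebra.commutes c (u : A)]

theorem vec_case {r p : ℕ} [Fact r.Prime] [Fact p.Prime] (hrp : r ≠ p) {V : Type*} [AddCommGroup V]
    [Module (ZMod r) V] [Module.Finite (ZMod r) V] (f : Module.End (ZMod r) V) (hf : f ^ p = 1)
    (hf1 : f ≠ 1) (H : ∀ i, ¬ p ∣ i → ∃ u : (Module.End (ZMod r) V)ˣ, u * f * (u⁻¹ : (Module.End (ZMod r) V)ˣ) = f ^ i) :
    p - 1 ≤ Module.finrank (ZMod r) V := by
  have hp : p.Prime := Fact.out
  have hr : r.Prime := Fact.out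
  set μ := minpoly (ZMod r) f with hμ
  let K := AlgebraicClosure (ZMod r)
  have hpr : (p : ZMod r) ≠ 0 := by
    intro h
    rw [ZMod.natCast_eq_zero_iff] at h
    exact hrp ((Nat.prime_dvd_prime_iff_eq hr hp).1 h)
  have hIntg : IsIntegral (ZMod r) f := Algebra.IsIntegral.isIntegral f
  have hmon : μ.Monic := minpoly.monic hIntg
  have hdvd : μ ∣ X ^ p - 1 := minpoly.dvd _ _ (by simp [hf])
  have hsep : μ.Separable := Separable.of_dvd (X_pow_sub_one_separable_iff.2 hpr) hdvd
  have hsplit : (μ.map (algebraMap (ZMod r) K)).Splits := IsAlgClosed.splits _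
  have hroot : ∃ ζ ∈ (μ.map (algebraMap (ZMod r) K)).roots, ζ ≠ 1 := by
    by_contra! hcon
    apply hf1
    have hnd : (μ.map (algebraMap (ZMod r) K)).roots.Nodup := nodup_roots hsep.map
    have hle : (μ.map (algebraMap (ZMod r) K)).roots ≤ {1} := by
      rw [Multiset.le_iff_subset hnd]
      intro z hz
      simp [hcon z hz]
    have h1 : (μ.map (algebraMap (ZMod r) K)) ∣ (X - 1 : (ZMod r)[X]).map (algebraMap (ZMod r) K) := by
      rw [hsplit.eq_prod_roots_of_monic (hmon.map _)]
      have := Multiset.prod_dvd_prod_of_le (Multiset.map_le_map (f := fun a : K => X - C a) hle)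
      simpa using this
    have h2 : μ ∣ X - 1 := (map_dvd_map _ (algebraMap (ZMod r) K).injective hmon).1 h1
    have := (minpoly.dvd_iff (A := ZMod r) (x := f)).1 h2
    simpa [sub_eq_zero] using this
  obtain ⟨ζ, hζ, hζ1⟩ := hroot
  have hζroot : aeval ζ μ = 0 := by
    have := (mem_roots'.1 hζ).2
    simpa [IsRoot, eval_map_algebraMap] using this
  have hζp : ζ ^ p = 1 := by
    obtain ⟨q, hq⟩ := hdvd
    have : aeval ζ (X ^ p - 1 : (ZMod r)[X]) = 0 := by rw [hq, map_mul, hζroot, zero_mul]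
    simpa [sub_eq_zero] using this
  have hprim : IsPrimitiveRoot ζ p := by
    have := IsPrimitiveRoot.iff_orderOf (ζ := ζ) (k := p)
    rw [this]; exact orderOf_eq_prime hζp hζ1
  have hmem : ∀ i, ¬ p ∣ i → aeval (ζ ^ i) μ = 0 := by
    intro i hi
    obtain ⟨u, hu⟩ := H i hi
    have h1 : aeval (f ^ i) μ = 0 := by
      rw [← hu, aeval_conj_unit, minpoly.aeval]; simp
    have h2 : μ ∣ expand (ZMod r) i μ := minpoly.dvd _ _ (by rw [expand_aeval, h1])
    obtain ⟨q, hq⟩ := h2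
    rw [← expand_aeval, hq, map_mul, hζroot, zero_mul]
  have hμ0 : μ.map (algebraMap (ZMod r) K) ≠ 0 := (hmon.map _).ne_zero
  have hcard : p - 1 ≤ (μ.map (algebraMap (ZMod r) K)).natDegree := by
    classical
    have hsub : (Finset.Ico 1 p).image (fun i => ζ ^ i) ⊆ (μ.map (algebraMap (ZMod r) K)).roots.toFinset := by
      intro x hx
      obtain ⟨i, hi, rfl⟩ := Finset.mem_image.1 hx
      rw [Finset.mem_Ico] at hi
      rw [Multiset.mem_toFinset, mem_roots hμ0, IsRoot, eval_map_algebraMap]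
      exact hmem i (Nat.not_dvd_of_pos_of_lt hi.1 hi.2)
    have h1 := Finset.card_le_card hsub
    rw [Finset.card_image_of_injOn] at h1
    · calc p - 1 = (Finset.Ico 1 p).card := by simp
        _ ≤ _ := h1
        _ ≤ _ := Multiset.toFinset_card_le _
        _ ≤ _ := card_roots' _
    · intro i hi j hj hij
      simp only [Finset.coe_Ico, Set.mem_Ico] at hi hj
      exact hprim.pow_inj hi.2 hj.2 hij
  rw [natDegree_map] at hcard
  have h3 : μ.natDegree ≤ Module.finrank (ZMod r) V := by
    have h4 := LinearMap.minpoly_dvd_charpoly f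
    have := natDegree_le_of_dvd h4 (LinearMap.charpoly_monic f).ne_zero
    rwa [LinearMap.charpoly_natDegree] at this
  omega

/-- induced action on a quotient -/
noncomputable def quotAct {Γ R : Type*} [Group Γ] [Group R] (Φ : Γ →* MulAut R) (N : Subgroup R) [N.Normal]
    (h : ∀ γ, ∀ x ∈ N, Φ γ x ∈ N) : Γ →* MulAut (R ⧸ N) where
  toFun γ :=
    { toFun := QuotientGroup.map N N (Φ γ).toMonoidHom (h γ)
      invFun := QuotientGroup.map N N (Φ γ⁻¹).toMonoidHom (h γ⁻¹)
      left_inv := by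
        intro x; induction x using QuotientGroup.induction_on with | H x => simp
      right_inv := by
        intro x; induction x using QuotientGroup.induction_on with | H x => simp
      map_mul' := by intro x y; exact map_mul _ x y }
  map_one' := by
    ext x; induction x using QuotientGroup.induction_on with | H x => simp
  map_mul' a b := by
    ext x; induction x using QuotientGroup.induction_on with | H x => simp

@[simp] theorem quotAct_mk {Γ R : Type*} [Group Γ] [Group R] (Φ : Γ →* MulAut R) (N : Subgroup R) [N.Normal]
    (h : ∀ γ, ∀ x ∈ N, Φ γ x ∈ N) (γ : Γ) (x : R) : quotAct Φ N h γ (x : R ⧸ N) = (Φ γ x : R) := rfl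

/-- linear action on an elementary abelian group -/
noncomputable def linAct {Γ V : Type*} [Group Γ] [AddCommGroup V] (r : ℕ) [Module (ZMod r) V] (Φ : Γ →* AddMonoid.End V) :
    Γ →* Module.End (ZMod r) V where
  toFun γ := (Φ γ).toZModLinearMap r
  map_one' := by ext x; simp; rfl
  map_mul' a b := by ext x; simp; rfl

theorem lemE_vec {Γ : Type*} [Group Γ] {r p : ℕ} [Fact r.Prime] [Fact p.Prime] (hrp : r ≠ p)
    {V : Type*} [AddCommGroup V] [Finite V] (hV : ∀ x : V, r • x = 0)
    (Ψ : Γ →* AddMonoid.End V) (y : Γ) (hy : Ψ y ^ p = 1) (hy1 : Ψ y ≠ 1)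
    (H : ∀ i, ¬ p ∣ i → ∃ h : Γ, Ψ h * Ψ y * Ψ h⁻¹ = Ψ y ^ i) : r ^ (p - 1) ≤ Nat.card V := by
  have hr : r.Prime := Fact.out
  let _ : Module (ZMod r) V := AddCommGroup.zmodModule (n := r) hV
  let F : Γ →* Module.End (ZMod r) V := linAct r Ψ
  have key : ∀ a b : Γ, Ψ a = Ψ b → F a = F b := by
      intro a b hab
      change (Ψ a).toZModLinearMap r = (Ψ b).toZModLinearMap r
      rw [hab]
  have hfin := vec_case hrp (F y) ?_ ?_ ?_
  · have h1 : Nat.card V = r ^ Module.finrank (ZMod r) V := by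
      rw [Module.natCard_eq_pow_finrank (K := ZMod r), Nat.card_zmod]
    calc r ^ (p - 1) ≤ r ^ Module.finrank (ZMod r) V := Nat.pow_le_pow_right hr.pos hfin
      _ = Nat.card V := by rw [h1]
  · rw [← map_pow, ← map_one F]; apply key; rw [map_pow, hy, map_one]
  · intro h
    apply hy1
    apply AddMonoidHom.ext
    intro x
    exact LinearMap.congr_fun h x
  · intro i hi
    obtain ⟨h, hh⟩ := H i hi
    refine ⟨Units.map F (toUnits h), ?_⟩
    rw [← map_inv, ← map_inv]
    change F h * F y * F h⁻¹ = F y ^ i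
    rw [← map_mul, ← map_pow, ← map_mul]; apply key
    rw [map_mul, map_mul, hh, map_pow]

/-- multiplicative to additive endomorphisms -/
def toAddEnd (N : Type*) [CommGroup N] : Monoid.End N →* AddMonoid.End (Additive N) where
  toFun f := MonoidHom.toAdditive f
  map_one' := rfl
  map_mul' _ _ := rfl

theorem lemE_elem {Γ : Type*} [Group Γ] {r p : ℕ} [Fact r.Prime] [Fact p.Prime] (hrp : r ≠ p)
    {N : Type*} [CommGroup N] [Finite N] (hN : ∀ x : N, x ^ r = 1)
    (Ψ : Γ →* Monoid.End N) (y : Γ) (hy : Ψ y ^ p = 1) (hy1 : Ψ y ≠ 1)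
    (H : ∀ i, ¬ p ∣ i → ∃ h : Γ, Ψ h * Ψ y * Ψ h⁻¹ = Ψ y ^ i) : r ^ (p - 1) ≤ Nat.card N := by
  have : Finite (Additive N) := inferInstanceAs (Finite N)
  refine lemE_vec (V := Additive N) hrp (fun x => congrArg Additive.ofMul (hN x.toMul))
    ((toAddEnd N).comp Ψ) y ?_ ?_ ?_
  · simp only [MonoidHom.comp_apply]
    rw [← map_pow, hy, map_one]
  · intro h
    apply hy1
    exact MonoidHom.toAdditive.injective h
  · intro i hi
    obtain ⟨h, hh⟩ := H i hi
    refine ⟨h, ?_⟩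
    simp only [MonoidHom.comp_apply]
    rw [← map_mul, ← map_mul, ← map_pow, hh]

theorem lemE_aux {Γ : Type*} [Group Γ] {r p : ℕ} [Fact r.Prime] [Fact p.Prime] (hrp : r ≠ p) (m : ℕ) :
    ∀ {R : Type*} [Group R] [Finite R]  (_ : Nat.card R = m) (_ : IsPGroup r R)
    (Φ : Γ →* MulAut R) (y : Γ) (_ : Φ y ^ p = 1) (_ : Φ y ≠ 1)
    (_ : ∀ i, ¬ p ∣ i → ∃ h : Γ, Φ h * Φ y * Φ h⁻¹ = Φ y ^ i), r ^ (p - 1) ≤ Nat.card R := by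
  have hp : p.Prime := Fact.out
  have hr : r.Prime := Fact.out
  induction m using Nat.strong_induction_on with
  | _ m ih =>
  intro R _ _ hm hR Φ y hy hy1 H
  have hnt : Nontrivial R := by
    by_contra hcon
    rw [not_nontrivial_iff_subsingleton] at hcon
    apply hy1; ext x; exact Subsingleton.elim _ _
  let N : Subgroup R :=
    { carrier := {z | z ∈ Subgroup.center R ∧ z ^ r = 1}
      mul_mem' := by
        rintro a b ⟨ha, ha'⟩ ⟨hb, hb'⟩
        refine ⟨mul_mem ha hb, ?_⟩
        have hc : Commute a b := ((Subgroup.mem_center_iff.1 ha) b).symm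
        rw [hc.mul_pow, ha', hb', one_mul]
      one_mem' := ⟨one_mem _, one_pow _⟩
      inv_mem' := by
        rintro a ⟨ha, ha'⟩
        exact ⟨inv_mem ha, by rw [inv_pow, ha', inv_one]⟩ }
  have hNmem : ∀ z, z ∈ N ↔ z ∈ Subgroup.center R ∧ z ^ r = 1 := fun z => Iff.rfl
  have hNinv : ∀ γ, ∀ x ∈ N, Φ γ x ∈ N := by
    intro γ x hx
    rw [hNmem] at hx ⊢
    refine ⟨?_, by rw [← map_pow, hx.2, map_one]⟩
    rw [Subgroup.mem_center_iff]
    intro g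
    obtain ⟨g, rfl⟩ := (Φ γ).surjective g
    rw [← map_mul, ← map_mul, (Subgroup.mem_center_iff.1 hx.1) g]
  have hNnormal : N.Normal := ⟨fun x hx g => by
    have := Subgroup.mem_center_iff.1 hx.1 g
    rw [this, mul_inv_cancel_right]; exact hx⟩
  have hNnt : ∃ z ∈ N, z ≠ 1 := by
    have hc := hR.center_nontrivial
    have hd : r ∣ Nat.card (Subgroup.center R) := by
      have := (hR.to_subgroup (Subgroup.center R)).nontrivial_iff_card.1 hc
      obtain ⟨k, hk, hk'⟩ := this
      rw [hk']; exact dvd_pow_self _ (by omega)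
    obtain ⟨z, hz⟩ := exists_prime_orderOf_dvd_card' r hd
    refine ⟨z, ⟨z.2, ?_⟩, ?_⟩
    · have := pow_orderOf_eq_one z
      rw [hz] at this
      exact_mod_cast congrArg Subtype.val this
    · intro h
      have : z = 1 := Subtype.ext h
      rw [this, orderOf_one] at hz
      exact hr.one_lt.ne hz
  by_cases hyN : ∀ x ∈ N, Φ y x = x
  · -- pass to the quotient
    have hlt : Nat.card (R ⧸ N) < m := by
      have h1 := N.card_eq_card_quotient_mul_card_subgroup
      have h2 : 1 < Nat.card N := by
        obtain ⟨z, hz, hz1⟩ := hNnt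
        have : Nontrivial N := ⟨⟨⟨z, hz⟩, 1, fun h => hz1 (congrArg Subtype.val h)⟩⟩
        exact Finite.one_lt_card
      have h3 : 0 < Nat.card (R ⧸ N) := Nat.card_pos
      nlinarith
    have := ih _ hlt rfl (hR.to_quotient N) (quotAct Φ N hNinv) y ?_ ?_ ?_
    · exact this.trans (hlt.le.trans hm.ge)
    · rw [← map_pow] at hy
      rw [← map_pow]
      ext x; induction x using QuotientGroup.induction_on with | H x => rw [quotAct_mk, hy]; rfl
    · intro hcon
      apply hy1
      ext x
      have h1 : ((Φ y x : R) : R ⧸ N) = (x : R ⧸ N) := by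
        rw [← quotAct_mk Φ N hNinv, hcon]; rfl
      have h2 : x⁻¹ * Φ y x ∈ N := QuotientGroup.eq.1 h1.symm
      set z := x⁻¹ * Φ y x with hz
      have h3 : Φ y x = x * z := by simp [hz]
      have h4 : ∀ k : ℕ, (Φ y ^ k) x = x * z ^ k := by
        intro k
        induction k with
        | zero => simp
        | succ k ihk =>
          rw [pow_succ', MulAut.mul_apply, ihk, map_mul, h3, map_pow, hyN z h2, pow_succ', mul_assoc]
      have h5 : z ^ p = 1 := by
        have := h4 p
        rw [hy] at this
        simpa using this.symm
      have h6 : z = 1 := by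
        have hco : Nat.Coprime r p := (Nat.coprime_primes hr hp).2 hrp
        have h7 := orderOf_dvd_of_pow_eq_one h5
        have h8 := orderOf_dvd_of_pow_eq_one h2.2
        have := Nat.dvd_gcd h8 h7
        rw [hco] at this
        exact orderOf_eq_one_iff.1 (Nat.dvd_one.1 this)
      rw [h3, h6]; simp
    · intro i hi
      obtain ⟨h, hh⟩ := H i hi
      refine ⟨h, ?_⟩
      rw [← map_mul, ← map_pow, ← map_mul] at hh ⊢
      ext x; induction x using QuotientGroup.induction_on with | H x =>
        rw [quotAct_mk, quotAct_mk, hh]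
  · push Not at hyN
    obtain ⟨x0, hx0, hx0'⟩ := hyN
    let _ : CommGroup N := { (inferInstance : Group N) with
      mul_comm := fun a b => Subtype.ext (Subgroup.mem_center_iff.1 b.2.1 a) }
    let Ψ : Γ →* Monoid.End N :=
      { toFun := fun γ => ((Φ γ).toMonoidHom.comp N.subtype).codRestrict N (fun x => hNinv γ x x.2)
        map_one' := by ext x; simp; rfl
        map_mul' := by intro a b; ext x; simp; rfl }
    have hΨ : ∀ γ (x : N), ((Ψ γ x : N) : R) = Φ γ x := fun _ _ => rfl
    have key : ∀ a b : Γ, Φ a = Φ b → Ψ a = Ψ b := by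
      intro a b hab
      apply MonoidHom.ext
      intro x
      apply Subtype.ext
      exact (hΨ a x).trans (Eq.trans (by rw [hab]) (hΨ b x).symm)
    have hfin := lemE_elem hrp (fun x : N => Subtype.ext x.2.2) Ψ y ?_ ?_ ?_
    · exact hfin.trans (Subgroup.card_le_card_group N)
    · rw [← map_pow, ← map_one Ψ]; apply key; rw [map_pow, hy, map_one]
    · intro h
      apply hx0'
      rw [← hΨ y ⟨x0, hx0⟩, h]; rfl
    · intro i hi
      obtain ⟨h, hh⟩ := H i hi
      refine ⟨h, ?_⟩
      rw [← map_mul, ← map_pow, ← map_mul]; apply key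
      rw [map_mul, map_mul, hh, map_pow]

/-- Section version of the linear-algebra lemma. -/
theorem lemE_section {E : Type*} [Group E] [Finite E] {r p : ℕ} [Fact r.Prime] [Fact p.Prime] (hrp : r ≠ p)
    (A B Γ : Subgroup E) (hAB : A ≤ B) (hBA : ∀ b ∈ B, ∀ a ∈ A, b * a * b⁻¹ ∈ A)
    (hB : IsPGroup r B)
    (hΓA : ∀ g ∈ Γ, ∀ a ∈ A, g * a * g⁻¹ ∈ A) (hΓB : ∀ g ∈ Γ, ∀ a ∈ B, g * a * g⁻¹ ∈ B)
    (y : E) (hy : y ∈ Γ) (hyp : y ^ p = 1) (H : ∀ i, ¬ p ∣ i → ∃ h ∈ Γ, h * y * h⁻¹ = y ^ i)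
    (hcard : Nat.card B < r ^ (p - 1) * Nat.card A) : ∀ b ∈ B, b⁻¹ * (y * b * y⁻¹) ∈ A := by
  let Ψ : Γ →* MulAut B :=
    { toFun := fun γ =>
        { toFun := fun b => ⟨γ * b * (γ : E)⁻¹, hΓB γ γ.2 b b.2⟩
          invFun := fun b => ⟨(γ⁻¹ : Γ) * b * ((γ⁻¹ : Γ) : E)⁻¹, hΓB _ (γ⁻¹).2 b b.2⟩
          left_inv := fun b => by ext; simp [mul_assoc]
          right_inv := fun b => by ext; simp [mul_assoc]
          map_mul' := fun a b => by ext; simp [mul_assoc] }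
      map_one' := by ext; simp
      map_mul' := fun a b => by ext; simp [mul_assoc] }
  have hΨ : ∀ γ b, ((Ψ γ b : B) : E) = γ * b * (γ : E)⁻¹ := fun _ _ => rfl
  let A' := A.subgroupOf B
  have hA' : A'.Normal := ⟨fun a ha b => by
    rw [Subgroup.mem_subgroupOf] at ha ⊢
    exact hBA b b.2 a ha⟩
  let Φ := quotAct Ψ A' (fun γ x hx => by
    rw [Subgroup.mem_subgroupOf] at hx ⊢
    exact hΓA γ γ.2 x hx)
  by_cases h1 : Φ ⟨y, hy⟩ = 1
  · intro b hb
    have : Φ ⟨y, hy⟩ ((⟨b, hb⟩ : B) : B ⧸ A') = ((⟨b, hb⟩ : B) : B ⧸ A') := by rw [h1]; rfl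
    have h2 := QuotientGroup.eq.1 this.symm
    rw [Subgroup.mem_subgroupOf] at h2
    exact h2
  · exfalso
    have h3 := lemE_aux (Γ := Γ) hrp _ rfl (hB.to_quotient A') Φ ⟨y, hy⟩ ?_ h1 ?_
    · have h4 := A'.card_eq_card_quotient_mul_card_subgroup
      have h5 : Nat.card A' = Nat.card A := Nat.card_congr (Subgroup.subgroupOfEquivOfLe hAB).toEquiv
      rw [h5] at h4
      have h6 : 0 < Nat.card A := Nat.card_pos
      nlinarith
    · rw [← map_pow]
      have : (⟨y, hy⟩ : Γ) ^ p = 1 := Subtype.ext (by simpa using hyp)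
      rw [this, map_one]
    · intro i hi
      obtain ⟨h, hh, hh'⟩ := H i hi
      refine ⟨⟨h, hh⟩, ?_⟩
      rw [← map_mul, ← map_mul, ← map_pow]
      congr 1
      exact Subtype.ext (by simpa using hh')

theorem lemE_sub {E : Type*} [Group E] [Finite E] {r p : ℕ} [Fact r.Prime] [Fact p.Prime] (hrp : r ≠ p)
    (B Γ : Subgroup E) (hB : IsPGroup r B)
    (hΓB : ∀ g ∈ Γ, ∀ a ∈ B, g * a * g⁻¹ ∈ B)
    (y : E) (hy : y ∈ Γ) (hyp : y ^ p = 1) (H : ∀ i, ¬ p ∣ i → ∃ h ∈ Γ, h * y * h⁻¹ = y ^ i)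
    (hcard : Nat.card B < r ^ (p - 1)) : ∀ b ∈ B, Commute y b := by
  intro b hb
  have := lemE_section hrp ⊥ B Γ bot_le (by simp) hB (by simp) hΓB y hy hyp H (by simpa using hcard) b hb
  rw [Subgroup.mem_bot, inv_mul_eq_one] at this
  exact (mul_inv_eq_iff_eq_mul.1 this.symm)

end HG

namespace HG
section tools
variable {E : Type*} [Group E]

/-- normalizer -/
def nz (R : Subgroup E) : Subgroup E := Subgroup.normalizer (R : Set E)
/-- centralizer of a subgroup -/
def cz (R : Subgroup E) : Subgroup E := Subgroup.centralizer (R : Set E)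
/-- centralizer of an element -/
def ce (y : E) : Subgroup E := Subgroup.centralizer {y}
/-- conjugate subgroup -/
def cj (e : E) (R : Subgroup E) : Subgroup E := R.map (MulAut.conj e).toMonoidHom

theorem mem_cj {e x : E} {R : Subgroup E} : x ∈ cj e R ↔ e⁻¹ * x * e ∈ R := by
  rw [cj, Subgroup.mem_map]
  constructor
  · rintro ⟨y, hy, rfl⟩
    simpa [MulAut.conj_apply, mul_assoc] using hy
  · intro h
    exact ⟨_, h, by simp [MulAut.conj_apply, mul_assoc]⟩

theorem conj_mem_cj {e x : E} {R : Subgroup E} (hx : x ∈ R) : e * x * e⁻¹ ∈ cj e R := by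
  rw [mem_cj]; simpa [mul_assoc] using hx

theorem card_cj (e : E) (R : Subgroup E) : Nat.card (cj e R) = Nat.card R :=
  Subgroup.card_map_of_injective (MulAut.conj e).injective

theorem pgroup_cj {p : ℕ} {e : E} {R : Subgroup E} (h : IsPGroup p R) : IsPGroup p (cj e R) :=
  h.map _

theorem mem_ce {e y : E} : e ∈ ce y ↔ e * y * e⁻¹ = y := by
  rw [ce, Subgroup.mem_centralizer_singleton_iff, mul_inv_eq_iff_eq_mul]

theorem mem_cz {e : E} {R : Subgroup E} : e ∈ cz R ↔ ∀ x ∈ R, e * x * e⁻¹ = x := by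
  rw [cz, Subgroup.mem_centralizer_iff]
  exact forall₂_congr fun x _ => by rw [mul_inv_eq_iff_eq_mul, eq_comm]

variable [Finite E]

theorem mem_nz {e : E} {R : Subgroup E} : e ∈ nz R ↔ ∀ x ∈ R, e * x * e⁻¹ ∈ R := by
  rw [nz, Subgroup.mem_normalizer_iff]
  constructor
  · intro h x hx; exact (h x).1 hx
  · intro h
    have hle : cj e R ≤ R := by
      intro x hx
      rw [mem_cj] at hx
      simpa [mul_assoc] using h _ hx
    have heq : cj e R = R := Subgroup.eq_of_le_of_card_ge hle (card_cj e R).ge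
    intro x
    refine ⟨h x, fun hx => ?_⟩
    rw [← heq, mem_cj] at hx
    simpa [mul_assoc] using hx

theorem nz_conj {e x : E} {R : Subgroup E} (h : e ∈ nz R) (hx : x ∈ R) : e * x * e⁻¹ ∈ R := mem_nz.1 h x hx
theorem nz_conj' {e x : E} {R : Subgroup E} (h : e ∈ nz R) (hx : x ∈ R) : e⁻¹ * x * e ∈ R := by
  simpa using mem_nz.1 (inv_mem h) x hx

theorem le_nz (R : Subgroup E) : R ≤ nz R := fun e he => mem_nz.2 fun _ hx =>
  mul_mem (mul_mem he hx) (inv_mem he)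

theorem cz_le_nz (R : Subgroup E) : cz R ≤ nz R := fun e he => mem_nz.2 fun x hx => by
  rw [mem_cz.1 he x hx]; exact hx

/-- `R` is a Sylow `p`-subgroup of `L`. -/
def IsSyl (p : ℕ) (R L : Subgroup E) : Prop := R ≤ L ∧ IsPGroup p R ∧ ¬ p ∣ R.relIndex L

variable {p : ℕ} [Fact p.Prime]

theorem exists_syl (L P : Subgroup E) (hP : P ≤ L) (hp : IsPGroup p P) : ∃ R, IsSyl p R L ∧ P ≤ R := by
  have h1 : IsPGroup p (P.subgroupOf L) := hp.of_injective (Subgroup.subgroupOfEquivOfLe hP).toMonoidHom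
      (Subgroup.subgroupOfEquivOfLe hP).injective
  obtain ⟨Q, hQ⟩ := h1.exists_le_sylow
  refine ⟨(Q : Subgroup L).map L.subtype, ⟨?_, Q.2.map _, ?_⟩, ?_⟩
  · rintro _ ⟨x, _, rfl⟩; exact x.2
  · rw [Subgroup.relIndex, ← Subgroup.comap_subtype,
      Subgroup.comap_map_eq_self_of_injective (Subgroup.subtype_injective _)]
    exact Q.not_dvd_index
  · intro x hx
    exact ⟨⟨x, hP hx⟩, hQ (by rw [Subgroup.mem_subgroupOf]; exact hx), rfl⟩

theorem syl_mono {R M L : Subgroup E} (h : IsSyl p R L) (h1 : R ≤ M) (h2 : M ≤ L) : IsSyl p R M := by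
  refine ⟨h1, h.2.1, fun hd => h.2.2 ?_⟩
  exact hd.trans (Dvd.intro _ (Subgroup.relIndex_mul_relIndex R M L h1 h2))

theorem card_syl {R L : Subgroup E} (h : R ≤ L) : Nat.card R * R.relIndex L = Nat.card L := by
  have := Subgroup.relIndex_mul_relIndex ⊥ R L bot_le h
  rwa [Subgroup.relIndex_bot_left, Subgroup.relIndex_bot_left] at this

theorem syl_of_card {R R' L : Subgroup E} (h : IsSyl p R L) (h1 : R' ≤ L) (hp : IsPGroup p R')
    (hc : Nat.card R' = Nat.card R) : IsSyl p R' L := by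
  refine ⟨h1, hp, ?_⟩
  have h2 := card_syl h.1
  have h3 := card_syl h1
  have h4 : 0 < Nat.card R := Nat.card_pos
  rw [hc, ← h2] at h3
  rw [Nat.eq_of_mul_eq_mul_left h4 h3]
  exact h.2.2

theorem syl_cj {R L : Subgroup E} (h : IsSyl p R L) {e : E} (he : e ∈ nz L) : IsSyl p (cj e R) L := by
  refine syl_of_card h ?_ (pgroup_cj h.2.1) (card_cj e R)
  intro x hx
  rw [mem_cj] at hx
  have := nz_conj he (h.1 hx)
  simpa [mul_assoc] using this

theorem SC {R1 R2 L : Subgroup E} (h : IsSyl p R1 L) (h2 : R2 ≤ L) (hp : IsPGroup p R2) :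
    ∃ l ∈ L, ∀ x ∈ R2, l * x * l⁻¹ ∈ R1 := by
  have h1 : IsPGroup p (R2.subgroupOf L) := hp.of_injective (Subgroup.subgroupOfEquivOfLe h2).toMonoidHom
      (Subgroup.subgroupOfEquivOfLe h2).injective
  have h1' : IsPGroup p (R1.subgroupOf L) := h.2.1.of_injective (Subgroup.subgroupOfEquivOfLe h.1).toMonoidHom
      (Subgroup.subgroupOfEquivOfLe h.1).injective
  obtain ⟨Q, hQ⟩ := h1.exists_le_sylow
  obtain ⟨l, hl⟩ := MulAction.exists_smul_eq L Q (h1'.toSylow h.2.2)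
  refine ⟨l, l.2, fun x hx => ?_⟩
  have h3 : (⟨x, h2 hx⟩ : L) ∈ (Q : Subgroup L) := hQ (by rw [Subgroup.mem_subgroupOf]; exact hx)
  have h4 : l * (⟨x, h2 hx⟩ : L) * l⁻¹ ∈ ((l • Q : Sylow p L) : Subgroup L) := by
    rw [Sylow.coe_subgroup_smul, Subgroup.mem_smul_pointwise_iff_exists]
    exact ⟨_, h3, rfl⟩
  rw [hl] at h4
  exact h4

theorem FR {R L : Subgroup E} (h : IsSyl p R L) {e : E} (he : e ∈ nz L) :
    ∃ l ∈ L, l * e ∈ nz R := by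
  obtain ⟨l, hl, hl'⟩ := SC h (syl_cj h he).1 (syl_cj h he).2.1
  refine ⟨l, hl, mem_nz.2 fun x hx => ?_⟩
  have := hl' _ (conj_mem_cj (e := e) hx)
  simpa [mul_assoc] using this

theorem syl_le_normal {R L Q : Subgroup E} (h : IsSyl p R L) (hQ : Q ≤ L) (hp : IsPGroup p Q)
    (hn : L ≤ nz Q) : Q ≤ R := by
  obtain ⟨l, hl, hl'⟩ := SC h hQ hp
  intro x hx
  have := hl' _ (nz_conj' (hn hl) hx)
  simpa [mul_assoc] using this

theorem syl_ne_bot_iff {R L : Subgroup E} (h : IsSyl p R L) : p ∣ Nat.card L ↔ R ≠ ⊥ := by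
  have hc := card_syl h.1
  constructor
  · rintro hd rfl
    rw [Subgroup.card_bot, one_mul] at hc
    exact h.2.2 (hc ▸ hd)
  · intro hR
    rw [← hc]
    apply Dvd.dvd.mul_right
    obtain ⟨k, hk⟩ := IsPGroup.iff_card.1 h.2.1
    have : k ≠ 0 := by
      rintro rfl
      rw [pow_zero] at hk
      exact hR (Subgroup.card_eq_one.1 hk)
    rw [hk]; exact dvd_pow_self _ this

theorem syl_dvd {R L : Subgroup E} (h : IsSyl p R L) {k : ℕ} (hk : p ^ k ∣ Nat.card L) : p ^ k ∣ Nat.card R := by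
  have hp : p.Prime := Fact.out
  rw [← card_syl h.1] at hk
  exact (Nat.Coprime.pow_left k ((Nat.Prime.coprime_iff_not_dvd hp).2 h.2.2)).dvd_of_dvd_mul_right hk

theorem pgroup_elt {x : E} (R : Subgroup E) (h : IsPGroup p R) (hx : x ∈ R) : ∃ k, x ^ p ^ k = 1 := by
  obtain ⟨k, hk⟩ := h ⟨x, hx⟩
  exact ⟨k, congrArg Subtype.val hk⟩

theorem pgroup_of_elt {R : Subgroup E} (h : ∀ x ∈ R, ∃ k, x ^ p ^ k = 1) : IsPGroup p R := by
  intro x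
  obtain ⟨k, hk⟩ := h x x.2
  exact ⟨k, Subtype.ext hk⟩

theorem pgroup_zpowers {x : E} {k : ℕ} (h : x ^ p ^ k = 1) : IsPGroup p (Subgroup.zpowers x) := by
  apply pgroup_of_elt
  rintro _ ⟨j, rfl⟩
  refine ⟨k, ?_⟩
  simp only
  rw [← zpow_natCast, ← zpow_mul, mul_comm, zpow_mul, zpow_natCast, h, one_zpow]

theorem pelt_trivial {x : E} {H : Subgroup E} (hx : x ∈ H) (h : ¬ p ∣ Nat.card H) {k : ℕ} (hk : x ^ p ^ k = 1) :
    x = 1 := by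
  have hp : p.Prime := Fact.out
  have h1 : orderOf x ∣ Nat.card H := Subgroup.orderOf_dvd_natCard H hx
  have h2 := orderOf_dvd_of_pow_eq_one hk
  have h3 : Nat.Coprime (p ^ k) (Nat.card H) := Nat.Coprime.pow_left k ((Nat.Prime.coprime_iff_not_dvd hp).2 h)
  exact orderOf_eq_one_iff.1 (Nat.eq_one_of_dvd_coprimes h3 h2 h1)

/-- split off the `p`-part as a power -/
theorem exists_ppart (x : E) : ∃ k : ℕ, (∃ j, (x ^ k) ^ p ^ j = 1) ∧ k ≡ 1 [MOD p] := by
  have hp : p.Prime := Fact.out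
  have h0 : orderOf x ≠ 0 := (orderOf_pos x).ne'
  obtain ⟨a, b, hb, hab⟩ := Nat.exists_eq_pow_mul_and_not_dvd h0 p hp.ne_one
  have hco : Nat.Coprime b p := ((Nat.Prime.coprime_iff_not_dvd hp).2 hb).symm
  obtain ⟨c, hc⟩ := Nat.exists_mul_mod_eq_one_of_coprime hco hp.one_lt
  refine ⟨b * c, ⟨a, ?_⟩, ?_⟩
  · rw [← pow_mul, show b * c * p ^ a = (p ^ a * b) * c by ring, ← hab, pow_mul, pow_orderOf_eq_one, one_pow]
  · rw [Nat.ModEq, hc.2, Nat.mod_eq_of_lt hp.one_lt]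

end tools

section homs
variable {E S : Type*} [Group E] [Finite E] [Group S] (φ : E →* S) {p : ℕ} [Fact p.Prime]

theorem lift_pelt (H : Subgroup E) {g : S} (hg : g ^ p = 1) {x : E} (hx : x ∈ H) (hxg : φ x = g) :
    ∃ y ∈ H, φ y = g ∧ ∃ k, y ^ p ^ k = 1 := by
  obtain ⟨k, hk, hk1⟩ := exists_ppart (p := p) x
  refine ⟨x ^ k, pow_mem hx k, ?_, hk⟩
  rw [map_pow, hxg]
  have := pow_eq_pow_mod k hg
  rw [this, hk1, ← pow_eq_pow_mod 1 hg, pow_one]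

theorem lift_ord (H : Subgroup E) {g : S} (hg : g ^ p = 1) {x : E} (hx : x ∈ H) (hxg : φ x = g)
    (hH : ¬ p ∣ Nat.card (H ⊓ φ.ker : Subgroup E)) : ∃ y ∈ H, φ y = g ∧ y ^ p = 1 := by
  obtain ⟨y, hy, hyg, k, hk⟩ := lift_pelt φ H hg hx hxg
  refine ⟨y, hy, hyg, ?_⟩
  refine pelt_trivial (p := p) (H := H ⊓ φ.ker) (Subgroup.mem_inf.2 ⟨pow_mem hy p, ?_⟩) hH (k := k) ?_
  · rw [MonoidHom.mem_ker, map_pow, hyg, hg]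
  · rw [← pow_mul, mul_comm, pow_mul, hk, one_pow]

/-- preimage of the cyclic group generated by `g` -/
def Zc (g : S) : Subgroup E := (Subgroup.zpowers g).comap φ

theorem mem_Zc {g : S} {x : E} : x ∈ Zc φ g ↔ ∃ j : ℤ, g ^ j = φ x := by
  rw [Zc, Subgroup.mem_comap, Subgroup.mem_zpowers_iff]

theorem ker_le_Zc (g : S) : φ.ker ≤ Zc φ g := fun x hx => (mem_Zc φ).2 ⟨0, by rw [MonoidHom.mem_ker.1 hx]; simp⟩

theorem zpowers_syl (H : Subgroup E) {g : S} {y : E} (hy : y ∈ H) (hyg : φ y = g) (hyp : y ^ p = 1)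
    (hH : ¬ p ∣ Nat.card (H ⊓ φ.ker : Subgroup E)) : IsSyl p (Subgroup.zpowers y) (H ⊓ Zc φ g) := by
  obtain ⟨R, hR, hyR⟩ := exists_syl (p := p) (H ⊓ Zc φ g) (Subgroup.zpowers y) (by
    rw [Subgroup.zpowers_le]
    exact ⟨hy, (mem_Zc φ).2 ⟨1, by simp [hyg]⟩⟩) (pgroup_zpowers (k := 1) (by simpa using hyp))
  have : R = Subgroup.zpowers y := by
    apply le_antisymm _ hyR
    intro x hx
    obtain ⟨j, hj⟩ := (mem_Zc φ).1 (hR.1 hx).2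
    have h1 : x * y ^ (-j) ∈ R := mul_mem hx (zpow_mem (hyR (Subgroup.mem_zpowers y)) _)
    obtain ⟨k, hk⟩ := pgroup_elt R hR.2.1 h1
    have h2 := pelt_trivial (p := p) (H := H ⊓ φ.ker) (Subgroup.mem_inf.2 ⟨(hR.1 h1).1, ?_⟩) hH hk
    · rw [zpow_neg, mul_inv_eq_one] at h2
      rw [h2]; exact Subgroup.zpow_mem_zpowers y j
    · rw [MonoidHom.mem_ker, map_mul, map_zpow, hyg, ← hj]; simp
  rw [← this]; exact hR

theorem zpow_transfer {g : S} {y : E} (hyg : φ y = g) (hyp : y ^ p = 1) (hg1 : g ≠ 1) {i j : ℤ} (h : g ^ i = g ^ j) :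
    y ^ i = y ^ j := by
  have h1 : orderOf y = p := orderOf_eq_prime hyp (by rintro rfl; exact hg1 (by rw [← hyg, map_one]))
  have h2 : orderOf g = p := orderOf_eq_prime (by rw [← hyg, ← map_pow, hyp, map_one]) hg1
  rw [zpow_eq_zpow_iff_modEq, h2] at h
  rw [zpow_eq_zpow_iff_modEq, h1]; exact h

theorem PowConj (H : Subgroup E) {g : S} {y : E} (hg1 : g ≠ 1) (hy : y ∈ H) (hyg : φ y = g) (hyp : y ^ p = 1)
    (hH : ¬ p ∣ Nat.card (H ⊓ φ.ker : Subgroup E)) {h : E} (hh : h ∈ H) {i : ℤ} (hi : φ h * g * (φ h)⁻¹ = g ^ i) :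
    ∃ h' ∈ H, (∃ j : ℤ, φ h' = g ^ j * φ h) ∧ h' * y * h'⁻¹ = y ^ i := by
  have hs := zpowers_syl φ H hy hyg hyp hH
  have hxz : h * y * h⁻¹ ∈ H ⊓ Zc φ g := Subgroup.mem_inf.2 ⟨mul_mem (mul_mem hh hy) (inv_mem hh), (mem_Zc φ).2 ⟨i, by
    rw [map_mul, map_mul, map_inv, hyg, hi]⟩⟩
  obtain ⟨l, hl, hl'⟩ := SC hs (R2 := Subgroup.zpowers (h * y * h⁻¹)) (by
      rw [Subgroup.zpowers_le]; exact hxz) (pgroup_zpowers (k := 1) (by rw [pow_one, conj_pow, hyp]; simp))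
  obtain ⟨j, hj⟩ := (mem_Zc φ).1 hl.2
  refine ⟨l * h, mul_mem hl.1 hh, ⟨j, by rw [map_mul, hj]⟩, ?_⟩
  obtain ⟨m, hm⟩ := Subgroup.mem_zpowers_iff.1 (hl' _ (Subgroup.mem_zpowers _))
  have h1 : l * h * y * (l * h)⁻¹ = y ^ m := by
    rw [hm]; group
  rw [h1]
  refine zpow_transfer φ hyg hyp hg1 ?_
  have h2 := congrArg φ hm
  simp only [map_mul, map_inv, map_zpow, hyg] at h2
  rw [h2, hi, ← hj, ← zpow_neg, ← zpow_add, ← zpow_add]; congr 1; ring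
end homs
end HG

namespace HG
section tools
variable {E : Type*} [Group E] [Finite E] {p : ℕ} [Fact p.Prime]

theorem Trick (y : E) (K Q : Subgroup E) (hQK : Q ≤ K) (hyQ : y ∈ nz Q)
    (hK : ∀ κ ∈ K, ∃ q ∈ Q, ∃ c ∈ ce y, κ = q * c) :
    ∃ L ≤ Q, K ≤ nz L ∧ (L = ⊥ → ∀ κ ∈ K, y * κ * y⁻¹ = κ) := by
  refine ⟨Subgroup.closure {x | ∃ κ ∈ K, x = κ * y * κ⁻¹ * y⁻¹}, ?_, ?_, ?_⟩
  · rw [Subgroup.closure_le]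
    rintro _ ⟨κ, hκ, rfl⟩
    obtain ⟨q, hq, c, hc, rfl⟩ := hK κ hκ
    rw [mem_ce] at hc
    have : q * c * y * (q * c)⁻¹ * y⁻¹ = q * (y * q⁻¹ * y⁻¹) := by
      calc q * c * y * (q * c)⁻¹ * y⁻¹ = q * (c * y * c⁻¹) * q⁻¹ * y⁻¹ := by group
        _ = _ := by rw [hc]; group
    rw [this]
    exact mul_mem hq (nz_conj hyQ (inv_mem hq))
  · intro k hk
    rw [mem_nz]
    intro x hx
    induction hx using Subgroup.closure_induction with
    | mem x hx =>
      obtain ⟨κ, hκ, rfl⟩ := hx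
      have : k * (κ * y * κ⁻¹ * y⁻¹) * k⁻¹ = (k * κ * y * (k * κ)⁻¹ * y⁻¹) * (k * y * k⁻¹ * y⁻¹)⁻¹ := by group
      rw [this]
      exact mul_mem (Subgroup.subset_closure ⟨_, mul_mem hk hκ, rfl⟩)
        (inv_mem (Subgroup.subset_closure ⟨_, hk, rfl⟩))
    | one => simp
    | mul x z _ _ hx hz =>
      have : k * (x * z) * k⁻¹ = (k * x * k⁻¹) * (k * z * k⁻¹) := by group
      rw [this]; exact mul_mem hx hz
    | inv x _ hx =>
      have : k * x⁻¹ * k⁻¹ = (k * x * k⁻¹)⁻¹ := by group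
      rw [this]; exact inv_mem hx
  · intro h κ hκ
    rw [Subgroup.closure_eq_bot_iff] at h
    have h1 : κ * y * κ⁻¹ * y⁻¹ = 1 := h ⟨κ, hκ, rfl⟩
    have h2 : κ * y * κ⁻¹ = y := mul_inv_eq_one.1 h1
    have h3 : κ * y = y * κ := mul_inv_eq_iff_eq_mul.1 h2
    rw [← h3]; simp

/-- minimal normal subgroup -/
def MinNormal (K : Subgroup E) : Prop := (⊤ ≤ nz K) ∧ ∀ L ≤ K, ⊤ ≤ nz L → L = ⊥ ∨ L = K

theorem Min_r {K L : Subgroup E} (hK : MinNormal K) (hL : L ≤ K) (hLK : K ≤ nz L) (hp : IsPGroup p L)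
    (hne : L ≠ ⊥) : IsPGroup p K := by
  let O : Subgroup E := ⨅ R ∈ {R | IsSyl p R K}, R
  have hO : ∀ x, x ∈ O ↔ ∀ R, IsSyl p R K → x ∈ R := by
    intro x; simp only [O, Subgroup.mem_iInf, Set.mem_setOf_eq]
  obtain ⟨R, hR, -⟩ := exists_syl (p := p) K ⊥ bot_le IsPGroup.of_bot
  have hOR : O ≤ R := fun x hx => (hO x).1 hx R hR
  have hLO : L ≤ O := by
    intro x hx
    rw [hO]
    intro R hR
    exact syl_le_normal hR hL hp hLK hx
  have hON : ⊤ ≤ nz O := by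
    intro e _
    rw [mem_nz]
    intro x hx
    rw [hO] at hx ⊢
    intro R hR
    have := hx _ (syl_cj hR (inv_mem (hK.1 (Subgroup.mem_top e))))
    rw [mem_cj] at this
    simpa using this
  rcases hK.2 O (hOR.trans hR.1) hON with h | h
  · exact absurd (le_bot_iff.1 (h ▸ hLO)) hne
  · have : K ≤ R := h ▸ hOR
    exact hR.2.1.to_le this

theorem not_dvd_sup {G : Type*} [Group G] [Finite G] {A B : Subgroup G} [A.Normal] [B.Normal]
    (hA : ¬ p ∣ Nat.card A) (hB : ¬ p ∣ Nat.card B) : ¬ p ∣ Nat.card (A ⊔ B : Subgroup G) := by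
  have hp : p.Prime := Fact.out
  have h1 := card_syl (R := B) (L := A ⊔ B) le_sup_right
  rw [Subgroup.relIndex_sup_right] at h1
  rw [← h1, hp.dvd_mul]
  rintro (h | h)
  · exact hB h
  · exact hA (h.trans (Subgroup.relIndex_dvd_card B A))

theorem not_dvd_sup' {A B K : Subgroup E} (hAK : A ≤ K) (hBK : B ≤ K) (hAn : K ≤ nz A) (hBn : K ≤ nz B)
    (hA : ¬ p ∣ Nat.card A) (hB : ¬ p ∣ Nat.card B) : ¬ p ∣ Nat.card (A ⊔ B : Subgroup E) := by
  have h1 : (A.subgroupOf K).Normal := ⟨fun x hx k => by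
    rw [Subgroup.mem_subgroupOf] at hx ⊢
    exact nz_conj (hAn k.2) hx⟩
  have h2 : (B.subgroupOf K).Normal := ⟨fun x hx k => by
    rw [Subgroup.mem_subgroupOf] at hx ⊢
    exact nz_conj (hBn k.2) hx⟩
  have e : ∀ M ≤ K, Nat.card (M.subgroupOf K) = Nat.card M := fun M hM =>
    Nat.card_congr (Subgroup.subgroupOfEquivOfLe hM).toEquiv
  rw [← e _ hAK] at hA
  rw [← e _ hBK] at hB
  have := not_dvd_sup hA hB
  rwa [← Subgroup.subgroupOf_sup hAK hBK, e _ (sup_le hAK hBK)] at this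

theorem nz_sup {A B : Subgroup E} {e : E} (hA : e ∈ nz A) (hB : e ∈ nz B) : e ∈ nz (A ⊔ B) := by
  have : A ⊔ B ≤ cj e⁻¹ (A ⊔ B) := by
    rw [sup_le_iff]
    constructor
    · intro x hx
      rw [mem_cj]
      exact Subgroup.mem_sup_left (by simpa using nz_conj hA hx)
    · intro x hx
      rw [mem_cj]
      exact Subgroup.mem_sup_right (by simpa using nz_conj hB hx)
  rw [mem_nz]
  intro x hx
  have := this hx
  rw [mem_cj] at this
  simpa using this

theorem nz_cj {K L : Subgroup E} (hK : ⊤ ≤ nz K) (h : K ≤ nz L) (e : E) : K ≤ nz (cj e L) := by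
  intro k hk
  rw [mem_nz]
  intro x hx
  rw [mem_cj] at hx ⊢
  have h1 : e⁻¹ * k * e ∈ K := nz_conj' (hK (Subgroup.mem_top e)) hk
  have := nz_conj (h h1) hx
  have h2 : e⁻¹ * k * e * (e⁻¹ * x * e) * (e⁻¹ * k * e)⁻¹ = e⁻¹ * (k * x * k⁻¹) * e := by group
  rwa [h2] at this

theorem Min_p' {K L : Subgroup E} (hK : MinNormal K) (hL : L ≤ K) (hLK : K ≤ nz L) (hp : ¬ p ∣ Nat.card L)
    (hne : L ≠ ⊥) : ¬ p ∣ Nat.card K := by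
  classical
  obtain ⟨M, ⟨hM1, hM2, hM3, hM4⟩, hmax⟩ := (Set.toFinite {M : Subgroup E | M ≤ K ∧ K ≤ nz M ∧ ¬ p ∣ Nat.card M ∧ M ≠ ⊥}).exists_maximal
    ⟨L, hL, hLK, hp, hne⟩
  have hMn : ⊤ ≤ nz M := by
    intro e he
    have h1 : cj e M ≤ K := by
      intro x hx
      rw [mem_cj] at hx
      simpa [mul_assoc] using nz_conj (hK.1 he) (hM1 hx)
    have h2 := nz_cj hK.1 hM2 e
    have h3 : ¬ p ∣ Nat.card (cj e M) := by rwa [card_cj]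
    have h4 := not_dvd_sup' hM1 h1 hM2 h2 hM3 h3
    have h5 : M ⊔ cj e M ≤ M := hmax ⟨sup_le hM1 h1, fun k hk => nz_sup (hM2 hk) (h2 hk), h4,
      fun h => hM4 (le_bot_iff.1 (h ▸ le_sup_left))⟩ le_sup_left
    rw [mem_nz]
    intro x hx
    exact h5 (Subgroup.mem_sup_right (conj_mem_cj hx))
  rcases hK.2 M hM1 hMn with h | h
  · exact absurd h hM4
  · rwa [← h]

theorem BNC {P L : Subgroup E} (hP : IsSyl p P L) (h : ∀ x ∈ L, x ∈ nz P → x ∈ cz P) :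
    ∃ W ≤ L, L ≤ nz W ∧ ¬ p ∣ Nat.card W ∧ ∀ x ∈ L, ¬ p ∣ orderOf x → x ∈ W := by
  have hp : p.Prime := Fact.out
  have h1' : IsPGroup p (P.subgroupOf L) := hP.2.1.of_injective (Subgroup.subgroupOfEquivOfLe hP.1).toMonoidHom
      (Subgroup.subgroupOfEquivOfLe hP.1).injective
  let P' : Sylow p L := h1'.toSylow hP.2.2
  have hP' : ∀ x : L, x ∈ P' ↔ (x : E) ∈ P := fun x => Iff.rfl
  have hnc : Subgroup.normalizer (P' : Set L) ≤ Subgroup.centralizer (P' : Set L) := by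
    intro x hx
    have hx' := (Subgroup.mem_normalizer_iff (H := (P' : Subgroup L))).1 hx
    have h2 : (x : E) ∈ nz P := by
      rw [mem_nz]
      intro z hz
      exact (hx' ⟨z, hP.1 hz⟩).1 hz
    have h3 := mem_cz.1 (h x x.2 h2)
    rw [Subgroup.mem_centralizer_iff]
    intro z hz
    have := h3 z hz
    apply Subtype.ext
    exact (mul_inv_eq_iff_eq_mul.1 this).symm
  set T := MonoidHom.transferSylow P' hnc with hT
  refine ⟨T.ker.map L.subtype, ?_, ?_, ?_, ?_⟩
  · rintro _ ⟨x, _, rfl⟩; exact x.2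
  · intro k hk
    rw [mem_nz]
    rintro _ ⟨x, hx, rfl⟩
    refine ⟨⟨k, hk⟩ * x * ⟨k, hk⟩⁻¹, ?_, rfl⟩
    exact (MonoidHom.normal_ker T).conj_mem x hx _
  · rw [Subgroup.card_map_of_injective (Subgroup.subtype_injective _)]
    exact MonoidHom.not_dvd_card_ker_transferSylow P' hnc
  · intro x hx hxo
    refine ⟨⟨x, hx⟩, ?_, rfl⟩
    rw [SetLike.mem_coe, MonoidHom.mem_ker]
    obtain ⟨k, hk⟩ := P'.2 (T ⟨x, hx⟩)
    have h4 : orderOf (T ⟨x, hx⟩) ∣ orderOf x := by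
      have := orderOf_map_dvd T ⟨x, hx⟩
      rwa [← Subgroup.orderOf_coe ⟨x, hx⟩] at this
    have h5 := orderOf_dvd_of_pow_eq_one hk
    have h6 : Nat.Coprime (p ^ k) (orderOf x) := Nat.Coprime.pow_left k ((Nat.Prime.coprime_iff_not_dvd hp).2 hxo)
    exact orderOf_eq_one_iff.1 (Nat.eq_one_of_dvd_coprimes h6 h5 h4)

theorem rnz (A B : Subgroup E) : A.relIndex B ≠ 0 := Subgroup.index_ne_zero_of_finite

/-- subgroups of coprime index -/
theorem CI {K C R : Subgroup E} (hC : C ≤ K) (hR : R ≤ K) (h : Nat.Coprime (C.relIndex K) (R.relIndex K)) :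
    (∀ κ ∈ K, ∃ ρ ∈ R, ∃ c ∈ C, κ = ρ * c) ∧ (R ⊓ C).relIndex C = R.relIndex K := by
  have h1 := Subgroup.relIndex_mul_relIndex (C ⊓ R) C K inf_le_left hC
  have h2 := Subgroup.relIndex_mul_relIndex (C ⊓ R) R K inf_le_right hR
  have hinj : (C ⊓ R).relIndex R ≤ C.relIndex K := by
    rw [Subgroup.inf_relIndex_right]
    exact Subgroup.relIndex_le_of_le_right hR (rnz _ _)
  have hpos : 0 < C.relIndex K := Nat.pos_of_ne_zero (rnz _ _)
  have hpos' : 0 < (C ⊓ R).relIndex R := Nat.pos_of_ne_zero (rnz _ _)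
  have hdvd : C.relIndex K ∣ (C ⊓ R).relIndex R := by
    refine h.dvd_of_dvd_mul_right (n := R.relIndex K) ?_
    rw [h2, ← h1]; exact Dvd.intro_left _ rfl
  have heq : (C ⊓ R).relIndex R = C.relIndex K := le_antisymm hinj (Nat.le_of_dvd hpos' hdvd)
  constructor
  · let f : R ⧸ (C.subgroupOf R) → K ⧸ (C.subgroupOf K) := Quotient.map' (fun r => ⟨r, hR r.2⟩) (by
      intro a b hab
      rw [QuotientGroup.leftRel_apply] at hab ⊢
      exact hab)
    have hfinj : Function.Injective f := by
      intro a b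
      induction a using QuotientGroup.induction_on with | H a =>
      induction b using QuotientGroup.induction_on with | H b =>
      intro hab
      rw [QuotientGroup.eq]
      exact (QuotientGroup.eq (s := C.subgroupOf K) (a := ⟨a, hR a.2⟩) (b := ⟨b, hR b.2⟩)).1 hab
    have hcard : Nat.card (R ⧸ (C.subgroupOf R)) = Nat.card (K ⧸ (C.subgroupOf K)) := by
      rw [Subgroup.inf_relIndex_right] at heq
      exact heq
    have hbij : Function.Bijective f := (Nat.bijective_iff_injective_and_card f).2 ⟨hfinj, hcard⟩
    intro κ hκ
    obtain ⟨a, ha⟩ := hbij.2 ((⟨κ, hκ⟩ : K) : K ⧸ (C.subgroupOf K))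
    induction a using QuotientGroup.induction_on with | H a =>
    have := QuotientGroup.eq.1 ha
    rw [Subgroup.mem_subgroupOf] at this
    refine ⟨a, a.2, _, this, ?_⟩
    simp
  · rw [heq, mul_comm, ← h1] at h2
    rw [inf_comm]
    exact (Nat.eq_of_mul_eq_mul_right hpos (by linarith)).symm

end tools
end HG

namespace HG
section S
variable {E S : Type*} [Group E] [Finite E] [Group S] [Finite S]

/-- Hypotheses of Theorem S -/
structure Hyp (φ : E →* S) (g : S) (p : ℕ) : Prop where
  surj : Function.Surjective φ
  g1 : g ≠ 1
  gp : g ^ p = 1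
  p2 : p ≠ 2
  pow : ∀ i : ℕ, ¬ p ∣ i → ∃ s : S, s * g * s⁻¹ = g ^ i
  inv : ∃ s ∈ commutator S, s * g * s⁻¹ = g⁻¹
  gA : g ∈ commutator S
  odd : ∀ r : ℕ, r.Prime → r ≠ 2 → ¬ r ^ (p - 1) ∣ Nat.card φ.ker
  two : ¬ 2 ^ (2 * (p - 1)) ∣ Nat.card φ.ker
  psq : ¬ p ^ 2 ∣ Nat.card φ.ker
  pS : ¬ p ^ 2 ∣ Nat.card S
  lift : ∃ a : E, φ a = g ∧ a ^ p = 1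
  min : MinNormal φ.ker

variable {φ : E →* S} {g : S} {p : ℕ} [Fact p.Prime]

theorem pgroup_lt (H : Hyp φ g p) {r m : ℕ} [Fact r.Prime] {R K : Subgroup E} (hR : R ≤ K) (hp : IsPGroup r R)
    (h : ¬ r ^ m ∣ Nat.card K) : Nat.card R < r ^ m := by
  have hr : r.Prime := Fact.out
  obtain ⟨k, hk⟩ := IsPGroup.iff_card.1 hp
  rw [hk]
  apply Nat.pow_lt_pow_right hr.one_lt
  by_contra hcon
  push Not at hcon
  exact h (((pow_dvd_pow r hcon).trans hk.symm.dvd).trans (Subgroup.card_dvd_of_le hR))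

theorem mem_nzK (H : Hyp φ g p) (e : E) : e ∈ nz φ.ker := H.min.1 (Subgroup.mem_top e)

theorem X1 (H : Hyp φ g p) {r : ℕ} [Fact r.Prime] {R : Subgroup E} (hR : IsSyl r R φ.ker) (s : S) : ∃ e ∈ nz R, φ e = s := by
  obtain ⟨e, rfl⟩ := H.surj s
  obtain ⟨l, hl, hl'⟩ := FR hR (mem_nzK H e)
  exact ⟨_, hl', by rw [map_mul, MonoidHom.mem_ker.1 hl, one_mul]⟩

theorem X2 (H : Hyp φ g p) {r : ℕ} [Fact r.Prime] {R : Subgroup E} (hR : IsSyl r R φ.ker)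
    (hp : ¬ p ∣ Nat.card (nz R ⊓ φ.ker : Subgroup E)) : ∃ y ∈ nz R, φ y = g ∧ y ^ p = 1 := by
  obtain ⟨e, he, he'⟩ := X1 H hR g
  exact lift_ord φ (nz R) H.gp he he' hp

theorem X3 (H : Hyp φ g p) {r : ℕ} [Fact r.Prime] {R : Subgroup E} (hR : IsSyl r R φ.ker)
    (hp : ¬ p ∣ Nat.card (nz R ⊓ φ.ker : Subgroup E)) {y : E} (hy : y ∈ nz R) (hyg : φ y = g) (hyp : y ^ p = 1)
    (s : S) (i : ℤ) (hs : s * g * s⁻¹ = g ^ i) : ∃ h ∈ nz R, (∃ j : ℤ, φ h = g ^ j * s) ∧ h * y * h⁻¹ = y ^ i := by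
  obtain ⟨e, he, rfl⟩ := X1 H hR s
  exact PowConj φ (nz R) H.g1 hy hyg hyp hp he hs

theorem X3' (H : Hyp φ g p) {r : ℕ} [Fact r.Prime] {R : Subgroup E} (hR : IsSyl r R φ.ker)
    (hp : ¬ p ∣ Nat.card (nz R ⊓ φ.ker : Subgroup E)) {y : E} (hy : y ∈ nz R) (hyg : φ y = g) (hyp : y ^ p = 1)
    (i : ℕ) (hi : ¬ p ∣ i) : ∃ h ∈ nz R, h * y * h⁻¹ = y ^ i := by
  obtain ⟨s, hs⟩ := H.pow i hi
  obtain ⟨h, hh, -, hh'⟩ := X3 H hR hp hy hyg hyp s i (by rw [hs, zpow_natCast])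
  exact ⟨h, hh, by rw [hh', zpow_natCast]⟩

theorem central_of_pow (H : Hyp φ g p) {r : ℕ} [Fact r.Prime] (hrp : r ≠ p) (hr2 : r ≠ 2) {R : Subgroup E} (hR : IsSyl r R φ.ker)
    {y : E} (hy : y ∈ nz R) (hyp : y ^ p = 1) (hpow : ∀ i, ¬ p ∣ i → ∃ h ∈ nz R, h * y * h⁻¹ = y ^ i) :
    R ≤ ce y := by
  have := lemE_sub hrp R (nz R) hR.2.1 (fun e he x hx => nz_conj he hx) y hy hyp hpow
    (pgroup_lt H hR.1 hR.2.1 (H.odd r Fact.out hr2))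
  intro x hx
  rw [mem_ce, mul_inv_eq_iff_eq_mul]
  exact (this x hx).symm

theorem coprime_idx (H : Hyp φ g p) {x : E} (hodd : ∀ r : ℕ, r.Prime → r ≠ 2 → ∃ R, IsSyl r R φ.ker ∧ R ≤ ce x)
    {R : Subgroup E} (hR : IsSyl 2 R φ.ker) :
    Nat.Coprime ((φ.ker ⊓ ce x).relIndex φ.ker) (R.relIndex φ.ker) := by
  apply Nat.Coprime.symm
  apply Nat.coprime_of_dvd
  intro q hq h1 h2
  by_cases hq2 : q = 2
  · subst hq2; exact hR.2.2 h1
  · obtain ⟨R', hR', hR'x⟩ := hodd q hq hq2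
    exact hR'.2.2 (h2.trans (Subgroup.relIndex_dvd_of_le_left _ (le_inf hR'.1 hR'x)))

theorem Fin_lemma (H : Hyp φ g p) {x : E} (hx : φ x = g) {R : Subgroup E} (hR : IsSyl 2 R φ.ker) (hxR : x ∈ nz R)
    (hodd : ∀ r : ℕ, r.Prime → r ≠ 2 → ∃ R, IsSyl r R φ.ker ∧ R ≤ ce x) :
    IsPGroup 2 φ.ker ∨ ∃ x ∈ cz φ.ker, φ x ≠ 1 := by
  obtain ⟨h1, -⟩ := CI inf_le_left hR.1 (coprime_idx H hodd hR)
  obtain ⟨L, hL, hLn, hL0⟩ := Trick x φ.ker R hR.1 hxR (by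
    intro κ hκ
    obtain ⟨ρ, hρ, c, hc, rfl⟩ := h1 κ hκ
    exact ⟨ρ, hρ, c, hc.2, rfl⟩)
  by_cases h0 : L = ⊥
  · right
    exact ⟨x, mem_cz.2 (hL0 h0), by rw [hx]; exact H.g1⟩
  · left
    exact Min_r H.min (hL.trans hR.1) hLn (hR.2.1.to_le hL) h0

theorem nz_Z (H : Hyp φ g p) {h : E} {i : ℤ} (hi : φ h * g * (φ h)⁻¹ = g ^ i) : h ∈ nz (Zc φ g) := by
  rw [mem_nz]
  intro x hx
  obtain ⟨j, hj⟩ := (mem_Zc φ).1 hx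
  refine (mem_Zc φ).2 ⟨i * j, ?_⟩
  rw [map_mul, map_mul, map_inv, ← hj, ← conj_zpow, hi, zpow_mul]

theorem Z_comm (H : Hyp φ g p) {l x : E} (hl : l ∈ Zc φ g) (hx : φ x = g) : φ (l * x * l⁻¹) = g := by
  obtain ⟨j, hj⟩ := (mem_Zc φ).1 hl
  rw [map_mul, map_mul, map_inv, hx, ← hj, ← zpow_neg, ← zpow_add_one, ← zpow_add]
  simp

theorem nz_ker_inf_card (H : Hyp φ g p) {l : E} {R : Subgroup E} :
   Nat.card (nz (cj l R) ⊓ φ.ker : Subgroup E) = Nat.card (nz R ⊓ φ.ker : Subgroup E) := by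
  have : nz (cj l R) ⊓ φ.ker = cj l (nz R ⊓ φ.ker) := by
    ext x
    rw [mem_cj, Subgroup.mem_inf, Subgroup.mem_inf, mem_nz, mem_nz]
    have h2 : x ∈ φ.ker ↔ l⁻¹ * x * l ∈ φ.ker := by
      constructor
      · intro h; exact nz_conj' (mem_nzK H l) h
      · intro h; have := nz_conj (mem_nzK H l) h
        simpa [mul_assoc] using this
    rw [← h2]
    refine and_congr_left fun _ => ⟨fun h z hz => ?_, fun h z hz => ?_⟩
    · have := h _ (conj_mem_cj (e := l) hz)
      rw [mem_cj] at this
      convert this using 1; group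
    · rw [mem_cj] at hz ⊢
      have := h _ hz
      convert this using 1; group
  rw [this, card_cj]

theorem nz_cj_mem (H : Hyp φ g p) {l y : E} {R : Subgroup E} (h : y ∈ nz R) : l * y * l⁻¹ ∈ nz (cj l R) := by
  rw [mem_nz] at h ⊢
  intro x hx
  rw [mem_cj] at hx ⊢
  have := h _ hx
  convert this using 1; group

theorem ce_cj (H : Hyp φ g p) {l y : E} {R : Subgroup E} (h : R ≤ ce y) : cj l R ≤ ce (l * y * l⁻¹) := by
  intro x hx
  rw [mem_cj] at hx
  have := mem_ce.1 (h hx)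
  rw [mem_ce]
  calc x * (l * y * l⁻¹) * x⁻¹ = l * (l⁻¹ * x * l * y * (l⁻¹ * x * l)⁻¹) * l⁻¹ := by group
    _ = _ := by rw [this]

theorem coprime_case (H : Hyp φ g p) (hp : ¬ p ∣ Nat.card φ.ker) : IsPGroup 2 φ.ker ∨ ∃ x ∈ cz φ.ker, φ x ≠ 1 := by
  obtain ⟨a, ha, hap⟩ := H.lift
  have hpr : p.Prime := Fact.out
  have hp' : ∀ M : Subgroup E, ¬ p ∣ Nat.card (M ⊓ φ.ker : Subgroup E) := fun M h =>
    hp (h.trans (Subgroup.card_dvd_of_le inf_le_right))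
  have hconj : ∀ y : E, φ y = g → y ^ p = 1 → ∃ l : E, l * y * l⁻¹ = a := by
    intro y hy hyp
    obtain ⟨l, hl, hl'⟩ := SC (zpowers_syl φ ⊤ (Subgroup.mem_top a) ha hap (hp' _)) (R2 := Subgroup.zpowers y) (by
      rw [Subgroup.zpowers_le]
      exact Subgroup.mem_inf.2 ⟨Subgroup.mem_top _, (mem_Zc φ).2 ⟨1, by simp [hy]⟩⟩)
      (pgroup_zpowers (k := 1) (by simpa using hyp))
    obtain ⟨m, hm⟩ := Subgroup.mem_zpowers_iff.1 (hl' y (Subgroup.mem_zpowers y))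
    refine ⟨l, ?_⟩
    have h1 := Z_comm H (Subgroup.mem_inf.1 hl).2 hy
    rw [← hm, map_zpow, ha] at h1
    rw [← hm]
    have := zpow_transfer φ ha hap H.g1 (i := m) (j := 1) (by rw [h1, zpow_one])
    rw [this, zpow_one]
  have hodd : ∀ r : ℕ, r.Prime → r ≠ 2 → ∃ R, IsSyl r R φ.ker ∧ R ≤ ce a := by
    intro r hr hr2
    have : Fact r.Prime := ⟨hr⟩
    by_cases hrp : r = p
    · subst hrp
      exact ⟨⊥, ⟨bot_le, IsPGroup.of_bot, by rwa [Subgroup.relIndex_bot_left]⟩, bot_le⟩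
    · obtain ⟨R, hR, -⟩ := exists_syl (p := r) φ.ker ⊥ bot_le IsPGroup.of_bot
      obtain ⟨y, hy, hyg, hyp⟩ := X2 H hR (hp' _)
      have h1 := central_of_pow H hrp hr2 hR hy hyp (X3' H hR (hp' _) hy hyg hyp)
      obtain ⟨l, hl⟩ := hconj y hyg hyp
      refine ⟨cj l R, syl_cj hR (mem_nzK H l), ?_⟩
      rw [← hl]; exact ce_cj H h1
  have : Fact (Nat.Prime 2) := ⟨Nat.prime_two⟩
  obtain ⟨R, hR, -⟩ := exists_syl (p := 2) φ.ker ⊥ bot_le IsPGroup.of_bot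
  obtain ⟨y, hy, hyg, hyp⟩ := X2 H hR (hp' _)
  obtain ⟨l, hl⟩ := hconj y hyg hyp
  exact Fin_lemma H ha (syl_cj hR (mem_nzK H l)) (hl ▸ nz_cj_mem H hy) hodd
end S
end HG

namespace HG
section S
variable {E S : Type*} [Group E] [Finite E] [Group S] [Finite S]

/-- Data on a Sylow subgroup of order `p^2`. -/
structure TD (φ : E →* S) (g : S) (p : ℕ) (T P : Subgroup E) (a : E) : Prop where
  T_syl : IsSyl p T ⊤
  P_syl : IsSyl p P φ.ker
  P_le : P ≤ T
  mem_P : ∀ x ∈ T, x ∈ φ.ker → x ∈ P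
  a_mem : a ∈ T
  a_g : φ a = g
  dec : ∀ x ∈ T, ∃ u ∈ P, ∃ j : ℤ, x = u * a ^ j
  comm : ∀ x ∈ T, ∀ y ∈ T, x * y = y * x
  exp : ∀ x ∈ T, x ^ p = 1
  gen : ∀ u ∈ P, u ≠ 1 → P = Subgroup.zpowers u
  le_Z : T ≤ Zc φ g
  ne : P ≠ ⊥
  card_T : Nat.card T = p ^ 2
  card_P : Nat.card P = p

variable {φ : E →* S} {g : S} {p : ℕ} [Fact p.Prime]

theorem exists_TD (H : Hyp φ g p) (hp : p ∣ Nat.card φ.ker) : ∃ T P a, TD φ g p T P a := by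
  have hpp : p.Prime := Fact.out
  obtain ⟨a, ha, hap⟩ := H.lift
  obtain ⟨T, hT, haT⟩ := exists_syl (p := p) ⊤ (Subgroup.zpowers a) le_top (pgroup_zpowers (k := 1) (by simpa using hap))
  replace haT : a ∈ T := haT (Subgroup.mem_zpowers a)
  obtain ⟨Q, hQ, -⟩ := exists_syl (p := p) φ.ker ⊥ bot_le IsPGroup.of_bot
  obtain ⟨l, -, hl⟩ := SC hT le_top hQ.2.1
  have hQ' := syl_cj hQ (mem_nzK H l)
  set P := T ⊓ φ.ker with hP
  have hle : cj l Q ≤ P := by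
    refine le_inf ?_ hQ'.1
    intro x hx
    rw [mem_cj] at hx
    have := hl _ hx
    convert this using 1; group
  have hPp : IsPGroup p P := hT.2.1.to_le inf_le_left
  have hPs : IsSyl p P φ.ker := by
    refine ⟨inf_le_right, hPp, fun h => hQ'.2.2 (h.trans (Subgroup.relIndex_dvd_of_le_left _ hle))⟩
  have hne : P ≠ ⊥ := (syl_ne_bot_iff hPs).1 hp
  have hcP : Nat.card P = p := by
    obtain ⟨k, hk⟩ := IsPGroup.iff_card.1 hPp
    have h1 : Nat.card P < p ^ 2 := pgroup_lt H inf_le_right hPp H.psq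
    rw [hk] at h1
    have h2 := (Nat.pow_lt_pow_iff_right hpp.one_lt).1 h1
    have h3 : k ≠ 0 := by
      rintro rfl
      exact hne (Subgroup.eq_bot_of_card_eq _ (by simpa using hk))
    have : k = 1 := by omega
    simpa [this] using hk
  have hog : orderOf g = p := orderOf_eq_prime H.gp H.g1
  have hmap : T.map φ = Subgroup.zpowers g := by
    symm
    apply Subgroup.eq_of_le_of_card_ge
    · rw [Subgroup.zpowers_le]; exact ⟨a, haT, ha⟩
    · rw [Nat.card_zpowers, hog]
      obtain ⟨k, hk⟩ := IsPGroup.iff_card.1 (hT.2.1.map φ)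
      have h1 : k < 2 := by
        by_contra h
        push Not at h
        exact H.pS ((pow_dvd_pow p h).trans (hk.symm.dvd.trans (Subgroup.card_subgroup_dvd_card _)))
      rw [hk]
      calc p ^ k ≤ p ^ 1 := Nat.pow_le_pow_right hpp.pos (by omega)
        _ = p := pow_one p
  have hZ : T ≤ Zc φ g := by
    intro x hx
    rw [Zc, ← hmap]; exact ⟨x, hx, rfl⟩
  have hcT : Nat.card T = p ^ 2 := by
    have h1 := card_syl (inf_le_left : P ≤ T)
    rw [Subgroup.inf_relIndex_left, Subgroup.relIndex_ker, hmap, Nat.card_zpowers, hog] at h1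
    change Nat.card P * p = _ at h1
    rw [hcP] at h1
    rw [← h1, sq]
  have hdec : ∀ x ∈ T, ∃ u ∈ P, ∃ j : ℤ, x = u * a ^ j := by
    intro x hx
    obtain ⟨j, hj⟩ := (mem_Zc φ).1 (hZ hx)
    refine ⟨x * a ^ (-j), Subgroup.mem_inf.2 ⟨mul_mem hx (zpow_mem haT _), ?_⟩, j, by group⟩
    rw [MonoidHom.mem_ker, map_mul, map_zpow, ha, ← hj]; group
  have hcomm : ∀ x ∈ T, ∀ y ∈ T, x * y = y * x := by
    intro x hx y hy
    have := IsPGroup.isMulCommutative_of_card_eq_prime_sq hcT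
    exact congrArg Subtype.val (this.1.1 (⟨x, hx⟩ : T) ⟨y, hy⟩)
  refine ⟨T, P, a, hT, hPs, inf_le_left, fun x h1 h2 => ⟨h1, h2⟩, haT, ha, hdec, hcomm, ?_, ?_, hZ, hne, hcT, hcP⟩
  · intro x hx
    obtain ⟨u, hu, j, rfl⟩ := hdec x hx
    have h1 : u ^ p = 1 := by
      have := Subgroup.orderOf_dvd_natCard P hu
      rw [hcP] at this
      exact orderOf_dvd_iff_pow_eq_one.1 this
    have h2 : Commute u (a ^ j) := hcomm _ hu.1 _ (zpow_mem haT _)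
    rw [h2.mul_pow, h1, one_mul, ← zpow_natCast, ← zpow_mul, mul_comm, zpow_mul, zpow_natCast, hap, one_zpow]
  · intro u hu hu1
    symm
    apply Subgroup.eq_of_le_of_card_ge
    · rw [Subgroup.zpowers_le]; exact hu
    · have := Subgroup.orderOf_dvd_natCard P hu
      rw [hcP] at this
      rw [Nat.card_zpowers, hcP, ((Nat.dvd_prime hpp).1 this).resolve_left (by rwa [orderOf_eq_one_iff])]

variable {T P : Subgroup E} {a : E}

/-- elements of `T` commute with `P` etc. -/
theorem N1 (H : Hyp φ g p) (D : TD φ g p T P a) : ∀ s ∈ commutator S, ∃ e ∈ cz P, φ e = s := by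
  have hle : commutator S ≤ (cz P).map φ := by
    rw [commutator_def, Subgroup.commutator_le]
    intro s _ t _
    obtain ⟨e, he, rfl⟩ := X1 H D.P_syl s
    obtain ⟨f, hf, rfl⟩ := X1 H D.P_syl t
    refine ⟨e * f * e⁻¹ * f⁻¹, ?_, by simp [commutatorElement_def]⟩
    obtain ⟨⟨u, hu⟩, hu1'⟩ := P.ne_bot_iff_exists_ne_one.1 D.ne
    have hu1 : u ≠ 1 := fun h => hu1' (Subtype.ext h)
    have hgen := D.gen u hu hu1
    have key : ∀ e ∈ nz P, ∃ m : ℤ, ∀ x ∈ P, e * x * e⁻¹ = x ^ m := by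
      intro e he
      have := nz_conj he hu
      rw [hgen] at this
      obtain ⟨m, hm⟩ := Subgroup.mem_zpowers_iff.1 this
      refine ⟨m, fun x hx => ?_⟩
      rw [hgen] at hx
      obtain ⟨i, rfl⟩ := Subgroup.mem_zpowers_iff.1 hx
      rw [← conj_zpow, ← hm, ← zpow_mul, ← zpow_mul, mul_comm]
    obtain ⟨m, hm⟩ := key e he
    obtain ⟨k, hk⟩ := key f hf
    refine mem_cz.2 ?_
    intro x hx
    have hx' : e⁻¹ * (f⁻¹ * x * f) * e ∈ P := nz_conj' he (nz_conj' hf hx)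
    have e1 : e * f * (e⁻¹ * f⁻¹ * x * f * e) * f⁻¹ * e⁻¹ = e * f * e⁻¹ * f⁻¹ * x * (e * f * e⁻¹ * f⁻¹)⁻¹ := by
      group
    set z := e⁻¹ * f⁻¹ * x * f * e with hz
    have hzP : z ∈ P := by rw [hz]; convert hx' using 1; group
    have e2 : f * e * z * e⁻¹ * f⁻¹ = x := by rw [hz]; group
    rw [← e1]
    calc e * f * z * f⁻¹ * e⁻¹ = e * (f * z * f⁻¹) * e⁻¹ := by group
      _ = f * (e * z * e⁻¹) * f⁻¹ := by
        rw [hk z hzP, hm z hzP, hm _ (zpow_mem hzP _), hk _ (zpow_mem hzP _), ← zpow_mul, ← zpow_mul, mul_comm]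
      _ = f * e * z * e⁻¹ * f⁻¹ := by group
      _ = x := e2
  intro s hs
  exact hle hs

theorem N2 (H : Hyp φ g p) (D : TD φ g p T P a) (h : ∀ x ∈ φ.ker, x ∈ nz P → x ∈ cz P) :
    ∃ x ∈ cz φ.ker, φ x ≠ 1 := by
  obtain ⟨W, hW, hWn, hWc, hWm⟩ := BNC D.P_syl h
  have hpp : p.Prime := Fact.out
  have hdvd : p ∣ Nat.card φ.ker := (syl_ne_bot_iff D.P_syl).2 D.ne
  have hWbot : W = ⊥ := by
    by_contra hne
    exact Min_p' H.min hW hWn hWc hne hdvd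
  have hK : IsPGroup p φ.ker := by
    apply pgroup_of_elt
    intro x hx
    obtain ⟨q, m, hm, hqm⟩ := Nat.exists_eq_pow_mul_and_not_dvd (orderOf_pos x).ne' p hpp.ne_one
    refine ⟨q, ?_⟩
    have h1 : x ^ p ^ q ∈ W := by
      apply hWm _ (pow_mem hx _)
      rw [orderOf_pow, hqm]
      intro hd
      apply hm
      refine hd.trans ?_
      have : (p ^ q * m).gcd (p ^ q) = p ^ q := Nat.gcd_eq_right (Dvd.intro _ rfl)
      rw [this, Nat.mul_div_cancel_left _ (pow_pos hpp.pos q)]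
    rw [hWbot] at h1; exact h1
  have hKP : φ.ker = P := by
    apply le_antisymm _ D.P_syl.1
    exact syl_le_normal D.P_syl le_rfl hK (le_nz _)
  obtain ⟨e, he, heg⟩ := N1 H D g H.gA
  exact ⟨e, hKP ▸ he, by rw [heg]; exact H.g1⟩

theorem N3 (H : Hyp φ g p) (D : TD φ g p T P a) {κ : E} (hκ : κ ∈ φ.ker) (hn : κ ∈ nz P) :
    ∃ d ∈ φ.ker, d ∈ nz T ∧ ∀ u ∈ P, d * u * d⁻¹ = κ * u * κ⁻¹ := by
  have hTM : T ≤ cz P ⊓ Zc φ g := by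
    refine le_inf ?_ D.le_Z
    intro x hx
    rw [mem_cz]
    intro u hu
    rw [D.comm x hx u (D.P_le hu)]; group
  have hs : IsSyl p T (cz P ⊓ Zc φ g) := syl_mono D.T_syl hTM le_top
  have hκM : κ ∈ nz (cz P ⊓ Zc φ g) := by
    rw [mem_nz]
    intro x hx
    obtain ⟨h1, h2⟩ := Subgroup.mem_inf.1 hx
    refine Subgroup.mem_inf.2 ⟨?_, ?_⟩
    · rw [mem_cz] at h1 ⊢
      intro u hu
      have := h1 _ (nz_conj' hn hu)
      calc κ * x * κ⁻¹ * u * (κ * x * κ⁻¹)⁻¹ = κ * (x * (κ⁻¹ * u * κ) * x⁻¹) * κ⁻¹ := by group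
        _ = u := by rw [this]; group
    · have := ker_le_Zc φ g hκ
      exact mul_mem (mul_mem this h2) (inv_mem this)
  obtain ⟨m, hm, hmκ⟩ := FR hs hκM
  obtain ⟨hm1, hm2⟩ := Subgroup.mem_inf.1 hm
  obtain ⟨j, hj⟩ := (mem_Zc φ).1 hm2
  refine ⟨a ^ (-j) * (m * κ), ?_, mul_mem (zpow_mem (le_nz T D.a_mem) _) hmκ, ?_⟩
  · rw [MonoidHom.mem_ker, map_mul, map_mul, map_zpow, D.a_g, ← hj, MonoidHom.mem_ker.1 hκ]; group
  · intro u hu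
    have h1 : a ^ (-j) ∈ cz P := zpow_mem (Subgroup.mem_inf.1 (hTM D.a_mem)).1 _
    have h2 := mem_cz.1 (mul_mem h1 hm1) _ (nz_conj hn hu)
    rw [← h2]; group

end S
end HG

namespace HG
section S
variable {E S : Type*} [Group E] [Finite E] [Group S] [Finite S]
variable {φ : E →* S} {g : S} {p : ℕ} [Fact p.Prime]
variable {T P : Subgroup E} {a x0 : E}

theorem TD.change (D : TD φ g p T P a) {x : E} (hx : x ∈ T) (hxg : φ x = g) : TD φ g p T P x where
  T_syl := D.T_syl
  P_syl := D.P_syl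
  P_le := D.P_le
  mem_P := D.mem_P
  a_mem := hx
  a_g := hxg
  dec := by
    intro t ht
    obtain ⟨j, hj⟩ := (mem_Zc φ).1 (D.le_Z ht)
    refine ⟨t * x ^ (-j), D.mem_P _ (mul_mem ht (zpow_mem hx _)) ?_, j, by group⟩
    rw [MonoidHom.mem_ker, map_mul, map_zpow, hxg, ← hj]; group
  comm := D.comm
  exp := D.exp
  gen := D.gen
  le_Z := D.le_Z
  ne := D.ne
  card_T := D.card_T
  card_P := D.card_P

theorem TD.nzP (H : Hyp φ g p) (D : TD φ g p T P a) {h : E} (hh : h ∈ nz T) : h ∈ nz P := by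
  rw [mem_nz]
  intro u hu
  exact D.mem_P _ (nz_conj hh (D.P_le hu)) (nz_conj (mem_nzK H h) (D.P_syl.1 hu))

theorem TD.cz_of_fix (D : TD φ g p T P a) {d u : E} (hu : u ∈ P) (hu1 : u ≠ 1) (h : d * u * d⁻¹ = u) : d ∈ cz P := by
  rw [mem_cz]
  intro x hx
  rw [D.gen u hu hu1] at hx
  obtain ⟨i, rfl⟩ := Subgroup.mem_zpowers_iff.1 hx
  rw [← conj_zpow, h]

theorem TD.p_in_T (D : TD φ g p T P a) {w : E} (hw : w ∈ nz T) {k : ℕ} (hk : w ^ p ^ k = 1) : w ∈ T := by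
  obtain ⟨l, hl, hl'⟩ := SC (syl_mono D.T_syl (le_nz T) le_top) (R2 := Subgroup.zpowers w)
    (by rw [Subgroup.zpowers_le]; exact hw) (pgroup_zpowers hk)
  have := nz_conj' hl (hl' w (Subgroup.mem_zpowers w))
  convert this using 1; group

theorem TD.power (D : TD φ g p T P a) {e : E} (he : e ∈ nz P) : ∃ m : ℤ, ∀ x ∈ P, e * x * e⁻¹ = x ^ m := by
  obtain ⟨⟨u, hu⟩, hu1'⟩ := P.ne_bot_iff_exists_ne_one.1 D.ne
  have hu1 : u ≠ 1 := fun h => hu1' (Subtype.ext h)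
  have hgen := D.gen u hu hu1
  have := nz_conj he hu
  rw [hgen] at this
  obtain ⟨m, hm⟩ := Subgroup.mem_zpowers_iff.1 this
  refine ⟨m, fun x hx => ?_⟩
  rw [hgen] at hx
  obtain ⟨i, rfl⟩ := Subgroup.mem_zpowers_iff.1 hx
  rw [← conj_zpow, ← hm, ← zpow_mul, ← zpow_mul, mul_comm]

theorem N4 (H : Hyp φ g p) (D : TD φ g p T P a) {d : E} (hd : d ∈ φ.ker) (hdT : d ∈ nz T) (hdn : d ∉ cz P) :
    ∃ x ∈ T, φ x = g ∧ d * x * d⁻¹ = x := by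
  have hdP := D.nzP H hdT
  let f : P → P := fun u => ⟨d * u.1 * d⁻¹ * u.1⁻¹, mul_mem (nz_conj hdP u.2) (inv_mem u.2)⟩
  have hf : Function.Injective f := by
    rintro ⟨u, hu⟩ ⟨v, hv⟩ huv
    have h1 : d * u * d⁻¹ * u⁻¹ = d * v * d⁻¹ * v⁻¹ := congrArg Subtype.val huv
    by_contra hne
    apply hdn
    refine D.cz_of_fix (u := v⁻¹ * u) (mul_mem (inv_mem hv) hu) (fun h => hne (Subtype.ext (inv_mul_eq_one.1 h).symm)) ?_
    have c1 := D.comm _ (inv_mem (D.P_le hv)) _ (D.P_le hu)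
    calc d * (v⁻¹ * u) * d⁻¹ = (d * v * d⁻¹)⁻¹ * (d * u * d⁻¹ * u⁻¹) * u := by group
      _ = v⁻¹ * u := by rw [h1]; group
  obtain ⟨w, hw⟩ : ∃ w : E, w = a⁻¹ * (d * a * d⁻¹) := ⟨_, rfl⟩
  have hwP : w ∈ P := by
    apply D.mem_P
    · rw [hw]; exact mul_mem (inv_mem D.a_mem) (nz_conj hdT D.a_mem)
    · rw [MonoidHom.mem_ker, hw]
      simp only [map_mul, map_inv, MonoidHom.mem_ker.1 hd]; group
  obtain ⟨⟨u, hu⟩, hfu⟩ := (Finite.injective_iff_surjective.1 hf) ⟨w⁻¹, inv_mem hwP⟩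
  have hfu' : d * u * d⁻¹ * u⁻¹ = w⁻¹ := congrArg Subtype.val hfu
  refine ⟨a * u, mul_mem D.a_mem (D.P_le hu), ?_, ?_⟩
  · rw [map_mul, MonoidHom.mem_ker.1 (D.P_syl.1 hu), D.a_g, mul_one]
  · calc d * (a * u) * d⁻¹ = a * (a⁻¹ * (d * a * d⁻¹)) * (d * u * d⁻¹ * u⁻¹) * u := by group
      _ = a * u := by rw [hfu', ← hw]; group

theorem conj_pow_shift {w a u : E} (h1 : w * a * w⁻¹ = a * u) (h2 : w * u * w⁻¹ = u) (k : ℕ) :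
   w ^ k * a * (w ^ k)⁻¹ = a * u ^ k := by
  induction k with
  | zero => simp
  | succ k ih =>
    calc w ^ (k+1) * a * (w ^ (k+1))⁻¹ = w * (w ^ k * a * (w ^ k)⁻¹) * w⁻¹ := by rw [pow_succ']; group
      _ = (w * a * w⁻¹) * (w * u * w⁻¹) ^ k := by rw [ih, conj_pow]; group
      _ = _ := by rw [h1, h2, pow_succ']; group

theorem pow_modEq_one {u : E} (hu : u ^ p = 1) {k : ℕ} (hk : k ≡ 1 [MOD p]) : u ^ k = u := by
  conv_rhs => rw [← pow_one u]
  exact pow_eq_pow_iff_modEq.2 (hk.of_dvd (orderOf_dvd_of_pow_eq_one hu))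

theorem N5 (H : Hyp φ g p) (D : TD φ g p T P x0) {d : E} (hd : d ∈ φ.ker) (hdT : d ∈ nz T) (hdn : d ∉ cz P)
    (hdx : d * x0 * d⁻¹ = x0) : ∀ h ∈ nz T, ∃ i : ℤ, h * x0 * h⁻¹ = x0 ^ i := by
  intro h hh
  have hdP := D.nzP H hdT
  have hhP := D.nzP H hh
  obtain ⟨m, hm⟩ := D.power hdP
  obtain ⟨w, hw⟩ : ∃ w : E, w = d⁻¹ * (h * d * h⁻¹) := ⟨_, rfl⟩
  have hwT : w ∈ nz T := by rw [hw]; exact mul_mem (inv_mem hdT) (mul_mem (mul_mem hh hdT) (inv_mem hh))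
  have hwK : w ∈ φ.ker := by rw [hw]; exact mul_mem (inv_mem hd) (nz_conj (mem_nzK H h) hd)
  have hwP : ∀ u ∈ P, w * u * w⁻¹ = u := by
    intro u hu
    have h1 := hm _ (nz_conj' hhP hu)
    have h2 := hm u hu
    calc w * u * w⁻¹ = d⁻¹ * (h * (d * (h⁻¹ * u * h) * d⁻¹) * h⁻¹) * d := by rw [hw]; group
      _ = d⁻¹ * (u ^ m) * d := by
        rw [h1, ← conj_zpow]; congr 3; group
      _ = u := by rw [← h2]; group
  obtain ⟨u, hu⟩ : ∃ u : E, u = x0⁻¹ * (w * x0 * w⁻¹) := ⟨_, rfl⟩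
  have huP : u ∈ P := by
    apply D.mem_P
    · rw [hu]; exact mul_mem (inv_mem D.a_mem) (nz_conj hwT D.a_mem)
    · rw [MonoidHom.mem_ker, hu]
      simp only [map_mul, map_inv, MonoidHom.mem_ker.1 hwK]; group
  have hwx : w * x0 * w⁻¹ = x0 * u := by rw [hu]; group
  obtain ⟨k, ⟨j, hkj⟩, hk1⟩ := exists_ppart (p := p) w
  have hwk : w ^ k ∈ T := D.p_in_T (pow_mem hwT k) hkj
  have h3 := conj_pow_shift hwx (hwP u huP) k
  rw [D.comm _ hwk _ D.a_mem, mul_inv_cancel_right, pow_modEq_one (D.exp u (D.P_le huP)) hk1] at h3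
  have hu1 : u = 1 := by simpa using h3.symm
  rw [hu1, mul_one] at hwx
  have hwTf : ∀ t ∈ T, w * t * w⁻¹ = t := by
    intro t ht
    obtain ⟨v, hv, j, rfl⟩ := D.dec t ht
    calc w * (v * x0 ^ j) * w⁻¹ = (w * v * w⁻¹) * (w * x0 ^ j * w⁻¹) := by group
      _ = _ := by rw [hwP v hv, ← conj_zpow, hwx]
  have hfix : d * (h * x0 * h⁻¹) * d⁻¹ = h * x0 * h⁻¹ := by
    have h5 := hwTf _ (nz_conj hh D.a_mem)
    calc d * (h * x0 * h⁻¹) * d⁻¹ = d * (w * (h * x0 * h⁻¹) * w⁻¹) * d⁻¹ := by rw [h5]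
      _ = h * (d * x0 * d⁻¹) * h⁻¹ := by rw [hw]; group
      _ = _ := by rw [hdx]
  obtain ⟨v, hv, j, hj⟩ := D.dec _ (nz_conj hh D.a_mem)
  refine ⟨j, ?_⟩
  have hv1 : v = 1 := by
    by_contra hne
    refine hdn (D.cz_of_fix hv hne ?_)
    rw [hj] at hfix
    have : d * (v * x0 ^ j) * d⁻¹ = (d * v * d⁻¹) * (d * x0 * d⁻¹) ^ j := by rw [conj_zpow]; group
    rw [this, hdx] at hfix
    exact mul_right_cancel hfix
  rw [hj, hv1, one_mul]

theorem N45 (H : Hyp φ g p) (hp : p ∣ Nat.card φ.ker) : (∃ x ∈ cz φ.ker, φ x ≠ 1) ∨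
    ∃ T P x0, TD φ g p T P x0 ∧ ∀ h ∈ nz T, ∃ i : ℤ, h * x0 * h⁻¹ = x0 ^ i := by
  obtain ⟨T, P, a, D⟩ := exists_TD H hp
  by_cases hc : ∀ x ∈ φ.ker, x ∈ nz P → x ∈ cz P
  · exact Or.inl (N2 H D hc)
  right
  push Not at hc
  obtain ⟨κ, hκ, hκn, hκc⟩ := hc
  obtain ⟨d, hd, hdT, hdc⟩ := N3 H D hκ hκn
  have hdn : d ∉ cz P := by
    intro h
    apply hκc
    rw [mem_cz] at h ⊢
    intro u hu
    rw [← hdc u hu, h u hu]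
  obtain ⟨x, hx, hxg, hxd⟩ := N4 H D hd hdT hdn
  exact ⟨T, P, x, D.change hx hxg, N5 H (D.change hx hxg) hd hdT hdn hxd⟩

/-- isolation datum -/
structure TX (φ : E →* S) (g : S) (p : ℕ) (T P : Subgroup E) (x0 : E) : Prop extends TD φ g p T P x0 where
  iso : ∀ h ∈ nz T, ∃ i : ℤ, h * x0 * h⁻¹ = x0 ^ i

theorem TX.iso' (H : Hyp φ g p) (D : TX φ g p T P x0) {h : E} (hh : h ∈ nz T) {i : ℤ} (hi : φ h * g * (φ h)⁻¹ = g ^ i) :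
    h * x0 * h⁻¹ = x0 ^ i := by
  obtain ⟨j, hj⟩ := D.iso h hh
  rw [hj]
  apply zpow_transfer φ D.a_g (D.exp _ D.a_mem) H.g1
  rw [← hi, ← D.a_g, ← map_zpow, ← hj]; simp

theorem TX.T_syl_of (D : TD φ g p T P x0) {M : Subgroup E} (h : T ≤ M) : IsSyl p T M := syl_mono D.T_syl h le_top

theorem N6 (H : Hyp φ g p) (D : TX φ g p T P x0) {y : E} (hy : φ y = g) (hyp : y ^ p = 1) :
    ∃ l ∈ Zc φ g, ∃ v ∈ P, l * y * l⁻¹ = v * x0 := by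
  obtain ⟨l, hl, hl'⟩ := SC (TX.T_syl_of D.toTD D.le_Z) (R2 := Subgroup.zpowers y) (by
      rw [Subgroup.zpowers_le]
      exact (mem_Zc φ).2 ⟨1, by simp [hy]⟩)
      (pgroup_zpowers (k := 1) (by simpa using hyp))
  refine ⟨l, hl, l * y * l⁻¹ * x0⁻¹, D.mem_P _ (mul_mem (hl' y (Subgroup.mem_zpowers y)) (inv_mem D.a_mem)) ?_, by group⟩
  rw [MonoidHom.mem_ker, map_mul, Z_comm H hl hy, map_inv, D.a_g, mul_inv_cancel]

theorem Z_conj_g {l e : E} {i : ℤ} (hl : l ∈ Zc φ g) (h : φ e * g * (φ e)⁻¹ = g ^ i) : φ (l * e) * g * (φ (l * e))⁻¹ = g ^ i := by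
  obtain ⟨j, hj⟩ := (mem_Zc φ).1 hl
  calc φ (l * e) * g * (φ (l * e))⁻¹ = φ l * (φ e * g * (φ e)⁻¹) * (φ l)⁻¹ := by rw [map_mul]; group
    _ = _ := by rw [h, ← hj]; group

theorem LemY (H : Hyp φ g p) (D : TX φ g p T P x0) {r : ℕ} [Fact r.Prime] {R : Subgroup E} (hR : IsSyl r R φ.ker)
    (hd : p ∣ Nat.card (nz R ⊓ φ.ker : Subgroup E)) : ∃ R', IsSyl r R' φ.ker ∧ T ≤ nz R' ∧
      ∀ i : ℕ, ¬ p ∣ i → ∃ h ∈ nz R', h * x0 * h⁻¹ = x0 ^ i := by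
  have hog : orderOf g = p := orderOf_eq_prime H.gp H.g1
  have h1 : p ^ 2 ∣ Nat.card (nz R) := by
    have h2 := card_syl (inf_le_left : nz R ⊓ φ.ker ≤ nz R)
    rw [Subgroup.inf_relIndex_left, Subgroup.relIndex_ker] at h2
    rw [← h2, sq]
    apply mul_dvd_mul hd
    obtain ⟨e, he, heg⟩ := X1 H hR g
    rw [← hog]
    exact Subgroup.orderOf_dvd_natCard _ ⟨e, he, heg⟩
  obtain ⟨T', hT', -⟩ := exists_syl (p := p) (nz R) ⊥ bot_le IsPGroup.of_bot
  have h2 := syl_dvd hT' h1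
  obtain ⟨l, -, hl⟩ := SC D.T_syl le_top hT'.2.1
  have h3 : cj l T' = T := by
    apply Subgroup.eq_of_le_of_card_ge
    · intro x hx
      rw [mem_cj] at hx
      have := hl _ hx
      convert this using 1; group
    · rw [card_cj, D.card_T]; exact Nat.le_of_dvd Nat.card_pos h2
  have hTR : T ≤ nz (cj l R) := by
    intro x hx
    rw [← h3, mem_cj] at hx
    have := nz_cj_mem H (l := l) (hT'.1 hx)
    convert this using 1; group
  have hR' := syl_cj hR (mem_nzK H l)
  refine ⟨cj l R, hR', hTR, ?_⟩
  intro i hi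
  obtain ⟨s, hs⟩ := H.pow i hi
  obtain ⟨e, he, rfl⟩ := X1 H hR' s
  rw [← zpow_natCast] at hs
  have hen : e ∈ nz (nz (cj l R) ⊓ Zc φ g) := by
    rw [mem_nz]
    intro x hx
    obtain ⟨h1, h2⟩ := Subgroup.mem_inf.1 hx
    exact Subgroup.mem_inf.2 ⟨mul_mem (mul_mem he h1) (inv_mem he), nz_conj (nz_Z H hs) h2⟩
  obtain ⟨m, hm, hme⟩ := FR (TX.T_syl_of D.toTD (le_inf hTR D.le_Z)) hen
  obtain ⟨hm1, hm2⟩ := Subgroup.mem_inf.1 hm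
  refine ⟨m * e, mul_mem hm1 he, ?_⟩
  rw [D.iso' H hme (Z_conj_g hm2 hs), zpow_natCast]
end S
end HG

namespace HG
section S
variable {E S : Type*} [Group E] [Finite E] [Group S] [Finite S]
variable {φ : E →* S} {g : S} {p : ℕ} [Fact p.Prime]
variable {T P : Subgroup E} {a x0 : E}

theorem mul_pow_shift {W : Subgroup E} {w v : E} (hw : w ∈ W) (hv : v ∈ nz W) (k : ℕ) : (w * v) ^ k * (v ^ k)⁻¹ ∈ W := by
  induction k with
  | zero => simp
  | succ k ih =>
    have := mul_mem hw (nz_conj hv ih)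
    convert this using 1
    rw [pow_succ' (w * v), pow_succ' v]; group

theorem nz_inf {e : E} {A B : Subgroup E} (h1 : e ∈ nz A) (h2 : e ∈ nz B) : e ∈ nz (A ⊓ B) := by
  rw [mem_nz]
  intro x hx
  obtain ⟨h3, h4⟩ := Subgroup.mem_inf.1 hx
  exact Subgroup.mem_inf.2 ⟨nz_conj h1 h3, nz_conj h2 h4⟩

theorem nz_ce {f y : E} {i : ℤ} (h : f * y * f⁻¹ = y ^ i) : f ∈ nz (ce y) := by
  have h1 : f ∈ nz (Subgroup.zpowers y) := by
    rw [mem_nz]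
    rintro x hx
    obtain ⟨j, rfl⟩ := Subgroup.mem_zpowers_iff.1 hx
    rw [← conj_zpow, h, ← zpow_mul]
    exact Subgroup.zpow_mem_zpowers _ _
  rw [mem_nz]
  intro x hx
  rw [mem_ce] at hx ⊢
  obtain ⟨j, hj⟩ := Subgroup.mem_zpowers_iff.1 (nz_conj' h1 (Subgroup.mem_zpowers y))
  calc f * x * f⁻¹ * y * (f * x * f⁻¹)⁻¹ = f * (x * (f⁻¹ * y * f) * x⁻¹) * f⁻¹ := by group
    _ = y := by rw [← hj, ← conj_zpow, hx, hj]; group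

theorem ce_of_comm {x y : E} (h : x * y = y * x) : x ∈ ce y := by
  rw [mem_ce, h]; group

theorem N7 (H : Hyp φ g p) (D : TX φ g p T P x0) :
    ∀ r : ℕ, r.Prime → r ≠ 2 → ∃ R, IsSyl r R φ.ker ∧ R ≤ ce x0 := by
  intro r hr hr2
  have : Fact r.Prime := ⟨hr⟩
  have hpp : p.Prime := Fact.out
  by_cases hrp : r = p
  · subst hrp
    exact ⟨P, D.P_syl, fun x hx => ce_of_comm (D.comm _ (D.P_le hx) _ D.a_mem)⟩
  obtain ⟨R, hR, -⟩ := exists_syl (p := r) φ.ker ⊥ bot_le IsPGroup.of_bot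
  by_cases hd : p ∣ Nat.card (nz R ⊓ φ.ker : Subgroup E)
  · obtain ⟨R', hR', hT, hpow⟩ := LemY H D hR hd
    exact ⟨R', hR', central_of_pow H hrp hr2 hR' (hT D.a_mem) (D.exp _ D.a_mem) hpow⟩
  obtain ⟨y, hy, hyg, hyp⟩ := X2 H hR hd
  have hRy := central_of_pow H hrp hr2 hR hy hyp (X3' H hR hd hy hyg hyp)
  obtain ⟨l, hl, v, hv, hlv⟩ := N6 H D hyg hyp
  have hR1 := syl_cj hR (mem_nzK H l)
  have hd1 : ¬ p ∣ Nat.card (nz (cj l R) ⊓ φ.ker : Subgroup E) := by rwa [nz_ker_inf_card H]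
  have hy1 := nz_cj_mem H (l := l) hy
  have hRy1 := ce_cj H (l := l) hRy
  have hyg1 := Z_comm H hl hyg
  rw [hlv] at hy1 hRy1 hyg1
  generalize cj l R = R at *
  have hyT : v * x0 ∈ T := mul_mem (D.P_le hv) D.a_mem
  have D' := D.toTD.change hyT hyg1
  by_cases hv1 : v = 1
  · rw [hv1, one_mul] at hRy1
    exact ⟨R, hR1, hRy1⟩
  exfalso
  have hPQ : P ≤ φ.ker ⊓ ce (v * x0) := le_inf D.P_syl.1 fun u hu => ce_of_comm (D.comm _ (D.P_le hu) _ hyT)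
  have hPs := syl_mono D.P_syl hPQ inf_le_left
  obtain ⟨W, hW, hWn, hWc, hWm⟩ := BNC hPs (by
    intro x hx hxP
    obtain ⟨hxK, hxy⟩ := Subgroup.mem_inf.1 hx
    rw [mem_ce] at hxy
    have hxT : x ∈ nz T := by
      rw [mem_nz]
      intro t ht
      obtain ⟨u, hu, j, rfl⟩ := D'.dec t ht
      have : x * (u * (v * x0) ^ j) * x⁻¹ = (x * u * x⁻¹) * (x * (v * x0) * x⁻¹) ^ j := by rw [conj_zpow]; group
      rw [this, hxy]
      exact mul_mem (D.P_le (nz_conj hxP hu)) (zpow_mem hyT _)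
    have h1 := D.iso' H hxT (i := 1) (by rw [MonoidHom.mem_ker.1 hxK]; simp)
    rw [zpow_one] at h1
    apply D.cz_of_fix hv hv1
    calc x * v * x⁻¹ = (x * (v * x0) * x⁻¹) * (x * x0 * x⁻¹)⁻¹ := by group
      _ = v := by rw [hxy, h1]; group)
  have hRW : R ≤ W := by
    intro x hx
    apply hWm _ (Subgroup.mem_inf.2 ⟨hR1.1 hx, hRy1 hx⟩)
    obtain ⟨k, hk⟩ := pgroup_elt R hR1.2.1 hx
    intro hdv
    have := (hdv.trans (orderOf_dvd_of_pow_eq_one hk))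
    exact hrp ((Nat.prime_dvd_prime_iff_eq hpp hr).1 (hpp.dvd_of_dvd_pow this)).symm
  have hWK : W ≤ φ.ker := hW.trans inf_le_left
  have hvW : v ∈ nz W := hWn (hPQ hv)
  obtain ⟨w, hw, hwv⟩ := FR (syl_mono hR1 hRW hWK) hvW
  obtain ⟨k, ⟨j, hk⟩, hk1⟩ := exists_ppart (p := p) (w * v)
  have h1 : (w * v) ^ k = 1 := pelt_trivial (p := p) (H := nz R ⊓ φ.ker) (pow_mem (Subgroup.mem_inf.2 ⟨hwv, mul_mem (hWK hw) (D.P_syl.1 hv)⟩) k) hd1 hk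
  have h2 := mul_pow_shift hw hvW k
  rw [h1, one_mul, pow_modEq_one (D.exp v (D.P_le hv)) hk1] at h2
  exact hv1 (pelt_trivial (p := p) (k := 1) (inv_mem_iff.1 h2) hWc (by rw [pow_one]; exact D.exp v (D.P_le hv)))

/-- the setup of the final case -/
structure FD (φ : E →* S) (g : S) (p : ℕ) (T P : Subgroup E) (x0 v : E) (R : Subgroup E) : Prop extends TX φ g p T P x0 where
  R_syl : IsSyl 2 R φ.ker
  v_mem : v ∈ P
  v_ne : v ≠ 1
  y_mem : v * x0 ∈ nz R
  ncard : ¬ p ∣ Nat.card (nz R ⊓ φ.ker : Subgroup E)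

variable {v : E} {R : Subgroup E}

theorem FD.y_T (D : FD φ g p T P x0 v R) : v * x0 ∈ T := mul_mem (D.P_le D.v_mem) D.a_mem
theorem FD.y_g (D : FD φ g p T P x0 v R) : φ (v * x0) = g := by
  rw [map_mul, MonoidHom.mem_ker.1 (D.P_syl.1 D.v_mem), D.a_g, one_mul]
theorem FD.y_p (D : FD φ g p T P x0 v R) : (v * x0) ^ p = 1 := D.exp _ D.y_T

theorem FD.dec1 (H : Hyp φ g p) (D : FD φ g p T P x0 v R) : ∀ κ ∈ φ.ker, ∃ ρ ∈ R, ∃ c ∈ φ.ker ⊓ ce x0, κ = ρ * c :=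
  (CI inf_le_left D.R_syl.1 (coprime_idx H (N7 H D.toTX) D.R_syl)).1

theorem FD.RC_syl (H : Hyp φ g p) (D : FD φ g p T P x0 v R) : IsSyl 2 (R ⊓ (φ.ker ⊓ ce x0)) (φ.ker ⊓ ce x0) := by
  refine ⟨inf_le_right, D.R_syl.2.1.to_le inf_le_left, ?_⟩
  rw [(CI inf_le_left D.R_syl.1 (coprime_idx H (N7 H D.toTX) D.R_syl)).2]
  exact D.R_syl.2.2

/-- moving a normalizing element into the normalizer of `T` -/
theorem FD.move (H : Hyp φ g p) (D : FD φ g p T P x0 v R) {f : E} {i : ℤ} (hf : f * (v * x0) * f⁻¹ = (v * x0) ^ i)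
    (hi : φ f * g * (φ f)⁻¹ = g ^ i) : ∃ l ∈ ce (v * x0) ⊓ Zc φ g, l * f ∈ nz T ∧ (l * f) * x0 * (l * f)⁻¹ = x0 ^ i := by
  have hT : T ≤ ce (v * x0) ⊓ Zc φ g := le_inf (fun t ht => ce_of_comm (D.comm _ ht _ D.y_T)) D.le_Z
  obtain ⟨l, hl, hlf⟩ := FR (TX.T_syl_of D.toTD hT) (nz_inf (nz_ce hf) (nz_Z H hi))
  exact ⟨l, hl, hlf, D.iso' H hlf (Z_conj_g (Subgroup.mem_inf.1 hl).2 hi)⟩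

theorem case_i (H : Hyp φ g p) (D : FD φ g p T P x0 v R) (hc : ∀ x ∈ R ⊓ (φ.ker ⊓ ce x0), x ∈ ce (v * x0)) : False := by
  have hpp : p.Prime := Fact.out
  have : Fact (Nat.Prime 2) := ⟨Nat.prime_two⟩
  obtain ⟨s, hs, hsg⟩ := H.inv
  obtain ⟨f, hf, ⟨j, hj⟩, hfy⟩ := X3 H D.R_syl D.ncard D.y_mem D.y_g D.y_p s (-1) (by rw [hsg]; simp)
  have hfg : φ f * g * (φ f)⁻¹ = g ^ (-1 : ℤ) := by
    calc φ f * g * (φ f)⁻¹ = φ (f * (v * x0) * f⁻¹) := by rw [map_mul, map_mul, D.y_g, map_inv]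
      _ = _ := by rw [hfy, map_zpow, D.y_g]
  obtain ⟨l, hl, hlT, hlx⟩ := D.move H hfy hfg
  obtain ⟨hl1, hl2⟩ := Subgroup.mem_inf.1 hl
  have hy' : (l * f) * (v * x0) * (l * f)⁻¹ = (v * x0) ^ (-1 : ℤ) := by
    calc (l * f) * (v * x0) * (l * f)⁻¹ = l * (f * (v * x0) * f⁻¹) * l⁻¹ := by group
      _ = _ := by rw [hfy, ← conj_zpow, mem_ce.1 hl1]
  have hcm : v * x0 = x0 * v := D.comm _ (D.P_le D.v_mem) _ D.a_mem
  have hvi : (l * f) * v * (l * f)⁻¹ = v⁻¹ := by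
    calc (l * f) * v * (l * f)⁻¹ = ((l * f) * (v * x0) * (l * f)⁻¹) * ((l * f) * x0 * (l * f)⁻¹)⁻¹ := by group
      _ = v⁻¹ := by rw [hy', hlx, hcm]; group
  have hcom : φ (l * f) ∈ commutator S := by
    obtain ⟨j', hj'⟩ := (mem_Zc φ).1 hl2
    rw [map_mul, hj, ← hj']
    exact mul_mem (zpow_mem H.gA _) (mul_mem (zpow_mem H.gA _) hs)
  obtain ⟨e, he, heg⟩ := N1 H D.toTD _ hcom
  have hlP := D.toTD.nzP H hlT
  obtain ⟨d, hd, hdT, hdc⟩ := N3 H D.toTD (κ := (l * f) * e⁻¹) (by rw [MonoidHom.mem_ker, map_mul, map_inv, heg, mul_inv_cancel])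
    (mul_mem hlP (inv_mem (cz_le_nz P he)))
  have hdv : d * v * d⁻¹ = v⁻¹ := by
    rw [hdc v D.v_mem, ← hvi]
    have := mem_cz.1 (inv_mem he) v D.v_mem
    calc l * f * e⁻¹ * v * (l * f * e⁻¹)⁻¹ = l * f * (e⁻¹ * v * (e⁻¹)⁻¹) * (l * f)⁻¹ := by group
      _ = _ := by rw [this]
  have hdx := D.iso' H hdT (i := 1) (by rw [MonoidHom.mem_ker.1 hd]; simp)
  rw [zpow_one] at hdx
  obtain ⟨k, ⟨q, hk⟩, hk1⟩ := exists_ppart (p := 2) d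
  set C := φ.ker ⊓ ce x0 with hC
  have hdV : d ∈ C ⊓ nz P := Subgroup.mem_inf.2 ⟨Subgroup.mem_inf.2 ⟨hd, mem_ce.2 hdx⟩, D.toTD.nzP H hdT⟩
  have hRCP : R ⊓ C ≤ cz P := by
    intro x hx
    have h1 := mem_ce.1 (hc x hx)
    have h2 := mem_ce.1 (Subgroup.mem_inf.1 (Subgroup.mem_inf.1 hx).2).2
    apply D.cz_of_fix D.v_mem D.v_ne
    calc x * v * x⁻¹ = (x * (v * x0) * x⁻¹) * (x * x0 * x⁻¹)⁻¹ := by group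
      _ = v := by rw [h1, h2]; group
  have hs2 : IsSyl 2 (R ⊓ C) (C ⊓ nz P) := syl_mono (D.RC_syl H) (le_inf inf_le_right (hRCP.trans (cz_le_nz P))) inf_le_left
  obtain ⟨m, hm, hm'⟩ := SC hs2 (R2 := Subgroup.zpowers (d ^ k)) (by rw [Subgroup.zpowers_le]; exact pow_mem hdV k) (pgroup_zpowers hk)
  have h3 := mem_cz.1 (hRCP (hm' _ (Subgroup.mem_zpowers _))) _ (nz_conj (Subgroup.mem_inf.1 hm).2 D.v_mem)
  have h4 : d ^ k * v * (d ^ k)⁻¹ = v := by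
    have : m * d ^ k * m⁻¹ * (m * v * m⁻¹) * (m * d ^ k * m⁻¹)⁻¹ = m * (d ^ k * v * (d ^ k)⁻¹) * m⁻¹ := by group
    rw [this] at h3
    exact mul_left_cancel (mul_right_cancel h3)
  have h5 : ∀ q : ℕ, d ^ (2 * q) * v * (d ^ (2 * q))⁻¹ = v := by
    intro q
    induction q with
    | zero => simp
    | succ q ih =>
      calc d ^ (2 * (q+1)) * v * (d ^ (2 * (q+1)))⁻¹ = d * (d * (d ^ (2 * q) * v * (d ^ (2 * q))⁻¹) * d⁻¹) * d⁻¹ := by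
            rw [show 2 * (q + 1) = 2 * q + 1 + 1 by ring, pow_succ', pow_succ']; group
        _ = v := by rw [ih, hdv, ← conj_inv, hdv, inv_inv]
  have hk2 : ∃ q, k = 2 * q + 1 := ⟨k / 2, by have : k % 2 = 1 := hk1; omega⟩
  obtain ⟨q, rfl⟩ := hk2
  have h6 : v⁻¹ = v := by
    rw [← hdv]
    conv_rhs => rw [← h4]
    conv_lhs => rw [← h5 q]
    rw [pow_succ']; group
  have h7 : v ^ 2 = 1 := by
    rw [sq]; nth_rewrite 1 [← h6]; simp
  have h8 : orderOf v ∣ 2 := orderOf_dvd_of_pow_eq_one h7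
  have h9 : orderOf v ∣ p := orderOf_dvd_of_pow_eq_one (D.exp v (D.P_le D.v_mem))
  have h10 : orderOf v ∣ 1 := by
    have := Nat.dvd_gcd h8 h9
    rwa [(Nat.coprime_primes Nat.prime_two hpp).2 H.p2.symm] at this
  exact D.v_ne (orderOf_eq_one_iff.1 (Nat.dvd_one.1 h10))

end S
end HG

namespace HG
open scoped Pointwise
section S
variable {E S : Type*} [Group E] [Finite E] [Group S] [Finite S]
variable {φ : E →* S} {g : S} {p : ℕ} [Fact p.Prime]
variable {T P : Subgroup E} {a x0 v : E} {R : Subgroup E}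

/-- the subgroup of centralizing elements in the kernel -/
abbrev CC (φ : E →* S) (x0 : E) : Subgroup E := φ.ker ⊓ ce x0

theorem FD.y_nzC (H : Hyp φ g p) (D : FD φ g p T P x0 v R) : v * x0 ∈ nz (CC φ x0) :=
  nz_inf (mem_nzK H _) (le_nz _ (ce_of_comm (D.comm _ D.y_T _ D.a_mem)))

theorem case_ii_a (H : Hyp φ g p) (D : FD φ g p T P x0 v R) (i : ℕ) (hi : ¬ p ∣ i) :
    ∃ h ∈ nz R ⊓ nz (R ⊓ CC φ x0), h * (v * x0) * h⁻¹ = (v * x0) ^ i := by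
  obtain ⟨s, hsg⟩ := H.pow i hi
  obtain ⟨f, hf, ⟨j, hj⟩, hfy⟩ := X3 H D.R_syl D.ncard D.y_mem D.y_g D.y_p s i (by rw [hsg]; simp)
  have hfg : φ f * g * (φ f)⁻¹ = g ^ (i : ℤ) := by
    calc φ f * g * (φ f)⁻¹ = φ (f * (v * x0) * f⁻¹) := by rw [map_mul, map_mul, D.y_g, map_inv]
      _ = _ := by rw [hfy, map_zpow, D.y_g]
  obtain ⟨l, hl, hlT, hlx⟩ := D.move H hfy hfg
  obtain ⟨hl1, hl2⟩ := Subgroup.mem_inf.1 hl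
  have hlC : l * f ∈ nz (CC φ x0) := nz_inf (mem_nzK H _) (nz_ce hlx)
  obtain ⟨m, hm⟩ := (mem_Zc φ).1 hl2
  have hq : (x0 ^ (-m) * l)⁻¹ ∈ φ.ker := by
    apply inv_mem
    rw [MonoidHom.mem_ker, map_mul, map_zpow, D.a_g, ← hm]; group
  obtain ⟨ρ, hρ, c, hc, hρc⟩ := D.dec1 H _ hq
  have hx0C : x0 ∈ nz (CC φ x0) := nz_inf (mem_nzK H _) (le_nz _ (ce_of_comm rfl))
  have e1 : ρ⁻¹ * f = c * x0 ^ (-m) * (l * f) := by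
    have : c = ρ⁻¹ * (x0 ^ (-m) * l)⁻¹ := by rw [hρc]; group
    rw [this]; group
  have h1 : ρ⁻¹ * f ∈ nz (CC φ x0) := by
    rw [e1]; exact mul_mem (mul_mem (le_nz _ hc) (zpow_mem hx0C _)) hlC
  have h2 : ρ⁻¹ * f ∈ nz R := mul_mem (le_nz _ (inv_mem hρ)) hf
  have hφ : φ (ρ⁻¹ * f) = φ f := by
    rw [map_mul, map_inv, MonoidHom.mem_ker.1 (D.R_syl.1 hρ)]; simp
  obtain ⟨h', hh', -, hh''⟩ := PowConj φ (nz R ⊓ nz (R ⊓ CC φ x0)) H.g1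
    (Subgroup.mem_inf.2 ⟨D.y_mem, nz_inf D.y_mem (D.y_nzC H)⟩) D.y_g D.y_p
    (fun h => D.ncard (h.trans (Subgroup.card_dvd_of_le (inf_le_inf_right _ inf_le_left))))
    (h := ρ⁻¹ * f) (Subgroup.mem_inf.2 ⟨h2, nz_inf h2 h1⟩) (i := i) (by rw [hφ]; exact hfg)
  exact ⟨h', hh', by rw [hh'', zpow_natCast]⟩

/-- coprime action splitting -/
theorem FD.split (H : Hyp φ g p) (D : FD φ g p T P x0 v R) {A : Subgroup E} (hA : A ≤ R) (hy : v * x0 ∈ nz A) {b : E}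
    (hb : b⁻¹ * ((v * x0) * b * (v * x0)⁻¹) ∈ A) : ∃ α ∈ A, ∃ c ∈ ce (v * x0), b⁻¹ = α * c := by
  obtain ⟨y, hyy⟩ : ∃ y, y = v * x0 := ⟨_, rfl⟩
  have hyT := D.y_T; have hyg := D.y_g; have hyp := D.y_p; have hyR := D.y_mem
  rw [← hyy] at hy hb hyT hyg hyp hyR ⊢
  have hyz : Subgroup.zpowers y ≤ nz A := by rw [Subgroup.zpowers_le]; exact hy
  have hsyl := zpowers_syl φ (nz R) hyR hyg hyp D.ncard
  have hL : A ⊔ Subgroup.zpowers y ≤ nz R ⊓ Zc φ g := by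
    refine sup_le (le_inf (hA.trans (le_nz R)) ((hA.trans D.R_syl.1).trans (ker_le_Zc φ g))) hsyl.1
  have hs2 := syl_mono hsyl (le_sup_right : Subgroup.zpowers y ≤ A ⊔ Subgroup.zpowers y) hL
  have hb1 : b⁻¹ * y * b ∈ A ⊔ Subgroup.zpowers y := by
    have : b⁻¹ * y * b = (b⁻¹ * (y * b * y⁻¹)) * y := by group
    rw [this]
    exact mul_mem (Subgroup.mem_sup_left hb) (Subgroup.mem_sup_right (Subgroup.mem_zpowers y))
  obtain ⟨l, hl, hl'⟩ := SC hs2 (R2 := Subgroup.zpowers (b⁻¹ * y * b)) (by rw [Subgroup.zpowers_le]; exact hb1)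
    (pgroup_zpowers (k := 1) (by
      rw [pow_one]
      have : b⁻¹ * y * b = b⁻¹ * y * (b⁻¹)⁻¹ := by group
      rw [this, conj_pow, hyp]; group))
  obtain ⟨m, hm⟩ := Subgroup.mem_zpowers_iff.1 (hl' _ (Subgroup.mem_zpowers _))
  have h1 : φ (b⁻¹ * y * b) = g := by
    have : b⁻¹ * y * b = (b⁻¹ * (y * b * y⁻¹)) * y := by group
    rw [this, map_mul, MonoidHom.mem_ker.1 (D.R_syl.1 (hA hb)), one_mul, hyg]
  have h2 := Z_comm H (Subgroup.mem_inf.1 (hL hl)).2 h1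
  rw [← hm, map_zpow, hyg] at h2
  have h3 := zpow_transfer φ hyg hyp H.g1 (i := m) (j := 1) (by rw [h2, zpow_one])
  rw [hm, zpow_one] at h3
  have hl2 : l ∈ (A : Set E) * (Subgroup.zpowers y : Set E) := by
    rw [← Subgroup.coe_mul_of_right_le_normalizer_left A _ hyz]; exact hl
  obtain ⟨α, hα, z, hz, rfl⟩ := Set.mem_mul.1 hl2
  refine ⟨(z⁻¹ * α⁻¹ * z), nz_conj' (hyz hz) (inv_mem hα), z⁻¹ * (α * z * b⁻¹), ?_, by group⟩
  apply mul_mem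
  · obtain ⟨k, rfl⟩ := Subgroup.mem_zpowers_iff.1 hz
    exact inv_mem (zpow_mem (ce_of_comm rfl) _)
  · rw [mem_ce]
    conv_rhs => rw [← h3]
    group

theorem exists_bigger {R A : Subgroup E} {r : ℕ} [Fact r.Prime] (hR : IsPGroup r R) (h : A < R) : ∃ x ∈ nz A ⊓ R, x ∉ A := by
  have hn : Group.IsNilpotent R := hR.isNilpotent
  have h1 : A.subgroupOf R < ⊤ := by
    rw [lt_top_iff_ne_top, Ne, Subgroup.subgroupOf_eq_top]
    exact fun h' => absurd h (not_lt_of_ge h')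
  obtain ⟨x, hx, hx'⟩ := SetLike.exists_of_lt (Group.normalizerCondition_of_isNilpotent _ h1)
  refine ⟨x, Subgroup.mem_inf.2 ⟨?_, x.2⟩, fun h => hx' (Subgroup.mem_subgroupOf.2 h)⟩
  rw [mem_nz]
  intro z hz
  rw [Subgroup.mem_normalizer_iff] at hx
  exact Subgroup.mem_subgroupOf.1 ((hx ⟨z, h.le hz⟩).1 (Subgroup.mem_subgroupOf.2 hz))

theorem case_ii_c (H : Hyp φ g p) (D : FD φ g p T P x0 v R) (hc : ¬ ∀ x ∈ R ⊓ CC φ x0, x ∈ ce (v * x0)) :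
    ∀ x ∈ R, ∃ ρ ∈ R ⊓ CC φ x0, ∃ c ∈ ce (v * x0), x = ρ * c := by
  have : Fact (Nat.Prime 2) := ⟨Nat.prime_two⟩
  set G1 := nz R ⊓ nz (R ⊓ CC φ x0) with hG1
  have hyG : v * x0 ∈ G1 := Subgroup.mem_inf.2 ⟨D.y_mem, nz_inf D.y_mem (D.y_nzC H)⟩
  have hpow := case_ii_a H D
  have hbig : 2 ^ (p - 1) ≤ Nat.card (R ⊓ CC φ x0 : Subgroup E) := by
    by_contra hlt
    push Not at hlt
    apply hc
    intro x hx
    exact ce_of_comm (lemE_sub H.p2.symm (R ⊓ CC φ x0) G1 (D.R_syl.2.1.to_le inf_le_left)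
      (fun e he z hz => nz_conj (Subgroup.mem_inf.1 he).2 hz) (v * x0) hyG D.y_p hpow hlt x hx).symm
  have hRlt : Nat.card R < 2 ^ (2 * (p - 1)) := pgroup_lt H D.R_syl.1 D.R_syl.2.1 H.two
  obtain ⟨A, ⟨hA1, hA2, hA3, hA4⟩, hmax⟩ := (Set.toFinite {A : Subgroup E | R ⊓ CC φ x0 ≤ A ∧ A ≤ R ∧ G1 ≤ nz A ∧
    ∀ x ∈ A, ∃ ρ ∈ R ⊓ CC φ x0, ∃ c ∈ ce (v * x0), x = ρ * c}).exists_maximal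
    ⟨R ⊓ CC φ x0, le_rfl, inf_le_left, inf_le_right, fun x hx => ⟨x, hx, 1, one_mem _, by simp⟩⟩
  by_cases hAR : A = R
  · rw [← hAR]; rw [hAR] at hA4 ⊢; exact hA4
  exfalso
  have hlt : A < R := lt_of_le_of_ne hA2 hAR
  obtain ⟨x, hx, hxA⟩ := exists_bigger D.R_syl.2.1 hlt
  have hAB : A ≤ nz A ⊓ R := le_inf (le_nz A) hA2
  have hGB : G1 ≤ nz (nz A ⊓ R) := by
    intro e he
    exact nz_inf (le_nz _ (hA3 he)) (Subgroup.mem_inf.1 he).1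
  have hE := lemE_section H.p2.symm A (nz A ⊓ R) G1 hAB (fun b hb z hz => nz_conj (Subgroup.mem_inf.1 hb).1 hz)
    (D.R_syl.2.1.to_le inf_le_right) (fun e he z hz => nz_conj (hA3 he) hz) (fun e he z hz => nz_conj (hGB he) hz)
    (v * x0) hyG D.y_p hpow (by
      calc Nat.card (nz A ⊓ R : Subgroup E) ≤ Nat.card R := Subgroup.card_le_of_le inf_le_right
        _ < 2 ^ (2 * (p - 1)) := hRlt
        _ = 2 ^ (p - 1) * 2 ^ (p - 1) := by rw [two_mul, pow_add]
        _ ≤ _ := Nat.mul_le_mul_left _ (hbig.trans (Subgroup.card_le_of_le hA1)))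
  have hB : nz A ⊓ R ≤ A := by
    refine hmax ⟨hA1.trans hAB, inf_le_right, hGB, ?_⟩ hAB
    intro b hb
    obtain ⟨α, hα, c, hc, hbc⟩ := D.split H hA2 (hA3 hyG) (hE _ (inv_mem hb))
    obtain ⟨ρ, hρ, c2, hc2, rfl⟩ := hA4 α hα
    exact ⟨ρ, hρ, c2 * c, mul_mem hc2 hc, by rw [← mul_assoc, ← hbc, inv_inv]⟩
  exact hxA (hB hx)

theorem case_ii (H : Hyp φ g p) (D : FD φ g p T P x0 v R) (hc : ¬ ∀ x ∈ R ⊓ CC φ x0, x ∈ ce (v * x0)) :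
    ∃ x ∈ cz φ.ker, φ x ≠ 1 := by
  have hpp : p.Prime := Fact.out
  have hdec := case_ii_c H D hc
  have hxy : x0 ∈ ce (v * x0) := ce_of_comm (D.comm _ D.a_mem _ D.y_T)
  have hdvd : p ∣ Nat.card φ.ker := (syl_ne_bot_iff D.P_syl).2 D.ne
  obtain ⟨L, hL, hLn, hL0⟩ := Trick x0 φ.ker (φ.ker ⊓ ce (v * x0)) inf_le_left
    (nz_inf (mem_nzK H _) (le_nz _ hxy)) (by
    intro κ hκ
    obtain ⟨ρ, hρ, c, hc, rfl⟩ := D.dec1 H κ hκ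
    obtain ⟨ρ1, hρ1, c1, hc1, h1⟩ := hdec ρ⁻¹ (inv_mem hρ)
    obtain ⟨h2, h3⟩ := Subgroup.mem_inf.1 hρ1
    have h4 : c1 = ρ1⁻¹ * ρ⁻¹ := by rw [h1]; group
    refine ⟨c1⁻¹, Subgroup.mem_inf.2 ⟨?_, inv_mem hc1⟩, ρ1⁻¹ * c, mul_mem (inv_mem (Subgroup.mem_inf.1 h3).2) (Subgroup.mem_inf.1 hc).2, ?_⟩
    · rw [h4]; exact inv_mem (D.R_syl.1 (mul_mem (inv_mem h2) (inv_mem hρ)))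
    · rw [h4]; group)
  by_cases h0 : L = ⊥
  · exact ⟨x0, mem_cz.2 (hL0 h0), by rw [D.a_g]; exact H.g1⟩
  have hLK : L ≤ φ.ker := hL.trans inf_le_left
  by_cases hpL : p ∣ Nat.card L
  · obtain ⟨Q1, hQ1, -⟩ := exists_syl (p := p) L ⊥ bot_le IsPGroup.of_bot
    have hne := (syl_ne_bot_iff hQ1).1 hpL
    have hcard : Nat.card Q1 = Nat.card P := by
      rw [D.card_P]
      obtain ⟨k, hk⟩ := IsPGroup.iff_card.1 hQ1.2.1
      have h1 : Nat.card Q1 < p ^ 2 := pgroup_lt H (hQ1.1.trans hLK) hQ1.2.1 H.psq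
      rw [hk] at h1
      have h2 := (Nat.pow_lt_pow_iff_right hpp.one_lt).1 h1
      have h3 : k ≠ 0 := by
        rintro rfl
        exact hne (Subgroup.eq_bot_of_card_eq _ (by simpa using hk))
      have : k = 1 := by omega
      simpa [this] using hk
    have hQs := syl_of_card D.P_syl (hQ1.1.trans hLK) hQ1.2.1 hcard
    have hall : ∀ e : E, ∀ x ∈ Q1, e * x * e⁻¹ ∈ L := by
      intro e x hx
      obtain ⟨l, hl, hl'⟩ := SC hQs (syl_cj hQs (mem_nzK H e)).1 (syl_cj hQs (mem_nzK H e)).2.1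
      have := nz_conj' (hLn hl) (hQ1.1 (hl' _ (conj_mem_cj (e := e) hx)))
      convert this using 1; group
    have hcl : Subgroup.normalClosure (Q1 : Set E) ≤ L := by
      rw [Subgroup.normalClosure, Subgroup.closure_le]
      intro z hz
      obtain ⟨x, hx, hxz⟩ := Group.mem_conjugatesOfSet_iff.1 hz
      obtain ⟨e, rfl⟩ := isConj_iff.1 hxz
      exact hall e x hx
    have hKL : φ.ker ≤ L := by
      rcases H.min.2 _ (hcl.trans hLK) (fun e _ => mem_nz.2 fun x hx => Subgroup.normalClosure_normal.conj_mem x hx e) with h | h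
      · exact absurd (le_bot_iff.1 (h ▸ Subgroup.le_normalClosure : Q1 ≤ ⊥)) hne
      · rw [← h]; exact hcl
    refine ⟨v * x0, mem_cz.2 fun κ hκ => ?_, by rw [D.y_g]; exact H.g1⟩
    have := mem_ce.1 (Subgroup.mem_inf.1 (hL (hKL hκ))).2
    rw [mul_inv_eq_iff_eq_mul] at this ⊢
    exact this.symm
  · exact absurd hdvd (Min_p' H.min hLK hLn hpL h0)

theorem ThmS (H : Hyp φ g p) : IsPGroup 2 φ.ker ∨ ∃ x ∈ cz φ.ker, φ x ≠ 1 := by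
  have : Fact (Nat.Prime 2) := ⟨Nat.prime_two⟩
  by_cases hp : p ∣ Nat.card φ.ker
  swap
  · exact coprime_case H hp
  rcases N45 H hp with h | ⟨T, P, x0, D', hiso⟩
  · exact Or.inr h
  have D : TX φ g p T P x0 := { D' with iso := hiso }
  obtain ⟨R, hR, -⟩ := exists_syl (p := 2) φ.ker ⊥ bot_le IsPGroup.of_bot
  by_cases hd : p ∣ Nat.card (nz R ⊓ φ.ker : Subgroup E)
  · obtain ⟨R', hR', hT, -⟩ := LemY H D hR hd
    exact Fin_lemma H D.a_g hR' (hT D.a_mem) (N7 H D)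
  obtain ⟨y, hy, hyg, hyp⟩ := X2 H hR hd
  obtain ⟨l, hl, v, hv, hlv⟩ := N6 H D hyg hyp
  have hR1 := syl_cj hR (mem_nzK H l)
  have hd1 : ¬ p ∣ Nat.card (nz (cj l R) ⊓ φ.ker : Subgroup E) := by rwa [nz_ker_inf_card H]
  have hy1 := nz_cj_mem H (l := l) hy
  rw [hlv] at hy1
  by_cases hv1 : v = 1
  · rw [hv1, one_mul] at hy1
    exact Fin_lemma H D.a_g hR1 hy1 (N7 H D)
  have F : FD φ g p T P x0 v (cj l R) := { D with R_syl := hR1, v_mem := hv, v_ne := hv1, y_mem := hy1, ncard := hd1 }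
  by_cases hc : ∀ x ∈ cj l R ⊓ CC φ x0, x ∈ ce (v * x0)
  · exact (case_i H F hc).elim
  · exact Or.inr (case_ii H F hc)
end S
end HG

namespace HG
open Equiv Equiv.Perm

theorem NT1 (n : ℕ) (hn : 5 ≤ n) : ∃ p : ℕ, p.Prime ∧ n + 1 < 2 * p ∧ p ≤ n ∧ p ≠ 2 ∧ (p + 2 ≤ n ∨ p % 4 = 1) := by
  have key : ∀ m : ℕ, 2 ≤ m → ∃ p, p.Prime ∧ m < p ∧ p ≤ 2 * m ∧ p % 2 = 1 := by
    intro m hm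
    obtain ⟨p, hp, h1, h2⟩ := Nat.exists_prime_lt_and_le_two_mul m (by omega)
    refine ⟨p, hp, h1, h2, ?_⟩
    rcases hp.eq_two_or_odd with h | h
    · omega
    · exact h
  have h4 : n % 4 = 0 ∨ n % 4 = 1 ∨ n % 4 = 2 ∨ n % 4 = 3 := by omega
  rcases h4 with h | h | h | h
  · obtain ⟨p, hp, h1, h2, h3⟩ := key (n / 2 - 1) (by omega)
    exact ⟨p, hp, by omega, by omega, by omega, by omega⟩
  · obtain ⟨p, hp, h1, h2, h3⟩ := key ((n + 1) / 2) (by omega)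
    exact ⟨p, hp, by omega, by omega, by omega, by omega⟩
  · obtain ⟨p, hp, h1, h2, h3⟩ := key (n / 2) (by omega)
    exact ⟨p, hp, by omega, by omega, by omega, by omega⟩
  · obtain ⟨p, hp, h1, h2, h3⟩ := key ((n - 1) / 2) (by omega)
    exact ⟨p, hp, by omega, by omega, by omega, by omega⟩

theorem pow_dvd_fact {n r k : ℕ} (hr : r.Prime) (hn : n ≠ 0) (h : r ^ k ∣ n.factorial) : (r - 1) * k < n := by
  haveI := Fact.mk hr
  have h1 := sub_one_mul_padicValNat_factorial_lt_of_ne_zero r hn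
  have h2 : k ≤ padicValNat r n.factorial := (padicValNat_dvd_iff_le (Nat.factorial_ne_zero n)).1 h
  exact (Nat.mul_le_mul_left _ h2).trans_lt h1

variable {n : ℕ}

theorem exists_cyc {p : ℕ} (h2 : 2 ≤ p) (hp : p ≤ n) : ∃ g : Perm (Fin n), g.cycleType = {p} := by
  have := (Equiv.Perm.exists_with_cycleType_iff (Fin n) (m := {p})).2 ⟨by simpa using hp, by simpa using h2⟩
  exact this

theorem cyc_isCycle {p : ℕ} {g : Perm (Fin n)} (hg : g.cycleType = {p}) : g.IsCycle := by
  rw [← card_cycleType_eq_one, hg]; rfl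

theorem cyc_supp {p : ℕ} {g : Perm (Fin n)} (hg : g.cycleType = {p}) : g.support.card = p := by
  rw [← sum_cycleType, hg]; simp

theorem cyc_order {p : ℕ} {g : Perm (Fin n)} (hg : g.cycleType = {p}) : orderOf g = p := by
  rw [← lcm_cycleType, hg]; simp

theorem cyc_pow {p : ℕ} (hp : p.Prime) {g : Perm (Fin n)} (hg : g.cycleType = {p}) (i : ℕ) (hi : ¬ p ∣ i) :
    (g ^ i).cycleType = {p} := by
  have hc : (orderOf g).Coprime i := by rw [cyc_order hg]; exact (Nat.Prime.coprime_iff_not_dvd hp).2 hi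
  have h1 : (g ^ i).IsCycle := (cyc_isCycle hg).pow_iff.2 hc.symm
  rw [h1.cycleType, support_pow_coprime hc.symm, cyc_supp hg]

theorem cyc_conj {p : ℕ} {g h : Perm (Fin n)} (hg : g.cycleType = {p}) (hh : h.cycleType = {p}) :
    ∃ s, s * g * s⁻¹ = h := by
  have := isConj_of_cycleType_eq (hg.trans hh.symm)
  rwa [isConj_iff] at this

theorem comm_eq (hn : 5 ≤ n) : commutator (Perm (Fin n)) = alternatingGroup (Fin n) :=
  alternatingGroup.commutator_perm_eq (by simpa using hn)

theorem two_fixed {p : ℕ} {g : Perm (Fin n)} (hg : g.cycleType = {p}) (h : p + 2 ≤ n) :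
    ∃ a b, a ≠ b ∧ g a = a ∧ g b = b := by
  have h1 : 1 < (g.supportᶜ).card := by
    rw [Finset.card_compl, cyc_supp hg, Fintype.card_fin]; omega
  obtain ⟨a, ha, b, hb, hab⟩ := Finset.one_lt_card.1 h1
  refine ⟨a, b, hab, ?_, ?_⟩
  · simpa using ha
  · simpa using hb

theorem even_inverter (hn : 5 ≤ n) {p : ℕ} (hp : p.Prime) (h : p + 2 ≤ n ∨ p % 4 = 1) {g : Perm (Fin n)}
    (hg : g.cycleType = {p}) : ∃ s ∈ alternatingGroup (Fin n), s * g * s⁻¹ = g⁻¹ := by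
  rcases h with h | h
  · obtain ⟨s, hs⟩ := cyc_conj hg (h := g⁻¹) (by rw [cycleType_inv, hg])
    rcases Int.units_eq_one_or (sign s) with h1 | h1
    · exact ⟨s, mem_alternatingGroup.2 h1, hs⟩
    · obtain ⟨a, b, hab, ha, hb⟩ := two_fixed hg h
      refine ⟨s * swap a b, ?_, ?_⟩
      · rw [mem_alternatingGroup, Perm.sign_mul, h1, sign_swap hab]; rfl
      · have : swap a b * g * (swap a b)⁻¹ = g := by
          have h2 := Equiv.mul_swap_eq_swap_mul g a b
          rw [ha, hb] at h2
          rw [← h2]; simp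
        calc s * swap a b * g * (s * swap a b)⁻¹ = s * (swap a b * g * (swap a b)⁻¹) * s⁻¹ := by group
          _ = _ := by rw [this, hs]
  · haveI := Fact.mk hp
    obtain ⟨y, hy⟩ := (ZMod.exists_sq_eq_neg_one_iff (p := p)).2 (by omega)
    have hy1 : p ∣ y.val * y.val + 1 := by
      rw [← CharP.cast_eq_zero_iff (ZMod p) p]
      push_cast
      rw [ZMod.natCast_zmod_val, ← hy]; ring
    have hnd : ¬ p ∣ y.val := by
      intro hd
      have : p ∣ 1 := (Nat.dvd_add_right (hd.mul_right _)).1 hy1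
      exact hp.one_lt.ne' (Nat.dvd_one.1 this)
    obtain ⟨s, hs⟩ := cyc_conj hg (cyc_pow hp hg _ hnd)
    refine ⟨s * s, ?_, ?_⟩
    · rw [mem_alternatingGroup, Perm.sign_mul]; exact Int.units_mul_self _
    · have e1 : s * s * g * (s * s)⁻¹ = g ^ (y.val * y.val) := by
        calc s * s * g * (s * s)⁻¹ = s * (s * g * s⁻¹) * s⁻¹ := by group
          _ = (s * g * s⁻¹) ^ y.val := by rw [conj_pow, hs]
          _ = _ := by rw [hs, pow_mul]
      rw [e1]
      apply eq_inv_of_mul_eq_one_left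
      rw [← pow_succ, ← orderOf_dvd_iff_pow_eq_one, cyc_order hg]; exact hy1

theorem hyp_Sn (hn : 5 ≤ n) : ∃ (p : ℕ) (g : Perm (Fin n)), p.Prime ∧
    ∀ {E : Type} [Group E] [Finite E] (φ : E →* Perm (Fin n)) (σ : Perm (Fin n) →* E),
      (∀ x, φ (σ x) = x) → MinNormal φ.ker → Nat.card φ.ker ∣ n.factorial → Hyp φ g p := by
  obtain ⟨p, hp, h1, h2, h3, h4⟩ := NT1 n hn
  obtain ⟨g, hg⟩ := exists_cyc hp.two_le h2
  refine ⟨p, g, hp, ?_⟩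
  intro E _ _ φ σ hσ hmin hcard
  have hp1 := hp.two_le
  have hodd : p % 2 = 1 := by
    rcases hp.eq_two_or_odd with h | h
    · exact absurd h h3
    · exact h
  have hgp : g ^ p = 1 := by rw [← orderOf_dvd_iff_pow_eq_one, cyc_order hg]
  have hpsq : ¬ p ^ 2 ∣ n.factorial := fun hd => by
    have := pow_dvd_fact hp (by omega) hd; omega
  refine ⟨fun x => ⟨σ x, hσ x⟩, ?_, hgp, h3, ?_, ?_, ?_, ?_, ?_, ?_, ?_, ⟨σ g, hσ g, ?_⟩, hmin⟩
  · rintro rfl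
    simp at hg
  · intro i hi
    exact cyc_conj hg (cyc_pow hp hg i hi)
  · rw [comm_eq hn]
    exact even_inverter hn hp h4 hg
  · rw [comm_eq hn, mem_alternatingGroup, (cyc_isCycle hg).sign, cyc_supp hg, Odd.neg_one_pow (Nat.odd_iff.2 hodd)]
    rfl
  · intro r hr hr2 hd
    have := pow_dvd_fact hr (by omega) (hd.trans hcard)
    have h5 := hr.two_le
    have : 2 * (p - 1) ≤ (r - 1) * (p - 1) := Nat.mul_le_mul_right _ (by omega)
    omega
  · intro hd
    have := pow_dvd_fact Nat.prime_two (by omega) (hd.trans hcard)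
    omega
  · intro hd; exact hpsq (hd.trans hcard)
  · rw [Nat.card_eq_fintype_card, Fintype.card_perm, Fintype.card_fin]; exact hpsq
  · rw [← map_pow, hgp, map_one]
end HG

namespace HG
open Equiv Equiv.Perm
open scoped Pointwise
variable {n : ℕ}

/-- the 3-cycle (a b c) -/
def tc (a b c : Fin n) : Perm (Fin n) := swap a b * swap b c

theorem tc_three {a b c : Fin n} (ab : a ≠ b) (ac : a ≠ c) (bc : b ≠ c) : (tc a b c).IsThreeCycle := by
  rw [tc, swap_comm a b]
  exact isThreeCycle_swap_mul_swap_same ab.symm bc ac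

theorem tc_conj (s : Perm (Fin n)) (a b c : Fin n) : s * tc a b c * s⁻¹ = tc (s a) (s b) (s c) := by
  have h : ∀ x y, swap (s x) (s y) = s * swap x y * s⁻¹ := fun x y => by
    rw [mul_swap_eq_swap_mul]; simp
  rw [tc, tc, h, h]; group

theorem tc_a {a b c : Fin n} (ab : a ≠ b) (ac : a ≠ c) : tc a b c a = b := by
  simp [tc, swap_apply_of_ne_of_ne ab ac]
theorem tc_b {a b c : Fin n} (ac : a ≠ c) (bc : b ≠ c) : tc a b c b = c := by
  simp [tc, swap_apply_of_ne_of_ne ac.symm bc.symm]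
theorem tc_c {a b c : Fin n} : tc a b c c = a := by
  simp [tc]
theorem tc_o {a b c x : Fin n} (ha : x ≠ a) (hb : x ≠ b) (hc : x ≠ c) : tc a b c x = x := by
  simp [tc, swap_apply_of_ne_of_ne, ha, hb, hc]

theorem tc_rot {a b c : Fin n} (ab : a ≠ b) (ac : a ≠ c) (bc : b ≠ c) : tc a b c = tc b c a := by
  ext x
  by_cases h1 : x = a
  · subst h1; rw [tc_a ab ac, tc_c]
  by_cases h2 : x = b
  · subst h2; rw [tc_b ac bc, tc_a bc ab.symm]
  by_cases h3 : x = c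
  · subst h3; rw [tc_c, tc_b ab.symm ac.symm]
  rw [tc_o h1 h2 h3, tc_o h2 h3 h1]

theorem tc_inv {a b c : Fin n} (ab : a ≠ b) (ac : a ≠ c) (bc : b ≠ c) : (tc a b c)⁻¹ = tc c b a := by
  rw [tc, tc, mul_inv_rev, swap_inv, swap_inv, swap_comm b c, swap_comm a b]

theorem three_eq_tc {g : Perm (Fin n)} (hg : g.IsThreeCycle) {a : Fin n} (ha : g a ≠ a) :
    g = tc a (g a) (g (g a)) ∧ a ≠ g a ∧ a ≠ g (g a) ∧ g a ≠ g (g a) := by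
  have h := hg.nodup_iff_mem_support.2 (mem_support.2 ha)
  refine ⟨hg.eq_swap_mul_swap_iff_mem_support.2 (mem_support.2 ha), ?_⟩
  simp at h
  exact ⟨h.2, h.1.2, g.injective.ne h.2⟩

theorem exists_tc {g : Perm (Fin n)} (hg : g.IsThreeCycle) : ∃ a b c : Fin n, a ≠ b ∧ a ≠ c ∧ b ≠ c ∧ g = tc a b c := by
  have : g.support.Nonempty := by
    rw [← Finset.card_pos, hg.card_support]; norm_num
  obtain ⟨a, ha⟩ := this
  obtain ⟨h1, h2, h3, h4⟩ := three_eq_tc hg (mem_support.1 ha)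
  exact ⟨_, _, _, h2, h3, h4, h1⟩

section rel
variable (U : Subgroup (Perm (Fin n)))

/-- `a ~ b` when some 3-cycle `(a b c)` lies in `U`. -/
def R3 (a b : Fin n) : Prop := a = b ∨ (a ≠ b ∧ ∃ c, a ≠ c ∧ b ≠ c ∧ tc a b c ∈ U)

variable {U}
theorem R3.symm {a b : Fin n} (h : R3 U a b) : R3 U b a := by
  rcases h with h | ⟨hab, c, hac, hbc, h⟩
  · exact Or.inl h.symm
  · refine Or.inr ⟨hab.symm, c, hbc, hac, ?_⟩
    have := inv_mem h
    rw [tc_inv hab hac hbc, tc_rot hbc.symm hac.symm hab.symm] at this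
    exact this

theorem conj_inv_mem {x y : Perm (Fin n)} (hx : x ∈ U) (hy : y ∈ U) : x * y * x⁻¹ ∈ U :=
  mul_mem (mul_mem hx hy) (inv_mem hx)

theorem R3.trans {a b d : Fin n} (h1 : R3 U a b) (h2 : R3 U b d) : R3 U a d := by
  rcases h1 with rfl | ⟨hab, c, hac, hbc, h1⟩
  · exact h2
  rcases h2 with rfl | ⟨hbd, e, hbe, hde, h2⟩
  · exact Or.inr ⟨hab, c, hac, hbc, h1⟩
  by_cases had : a = d
  · exact Or.inl had
  refine Or.inr ⟨had, ?_⟩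
  have hinv := inv_mem h1
  have hconj := conj_inv_mem hinv h2
  rw [tc_inv hab hac hbc] at hinv hconj
  rw [tc_conj] at hconj
  have eb : tc c b a b = a := tc_b hac.symm hab.symm
  have ec : tc c b a c = b := tc_a hbc.symm hac.symm
  by_cases hdc : d = c
  · subst hdc
    refine ⟨b, hab, hbc.symm, ?_⟩
    rw [tc_rot hbc.symm hac.symm hab.symm, tc_rot hab.symm hbc hac] at hinv
    exact hinv
  have ed : tc c b a d = d := tc_o hdc hbd.symm (Ne.symm had)
  rw [eb, ed] at hconj
  by_cases hea : e = a
  · subst hea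
    refine ⟨b, hab, hbd.symm, ?_⟩
    have := inv_mem h2
    rw [tc_inv hbd hab.symm hde] at this
    exact this
  by_cases hec : e = c
  · subst hec
    rw [ec] at hconj
    exact ⟨b, hab, hbd.symm, hconj⟩
  · rw [tc_o hec (Ne.symm hbe) hea] at hconj
    exact ⟨e, Ne.symm hea, hde, hconj⟩

theorem R3.full {a b c : Fin n} (hab : a ≠ b) (hac : a ≠ c) (hbc : b ≠ c) (h1 : R3 U a b) (h2 : R3 U b c) : tc a b c ∈ U := by
  have h13 := h1.trans h2
  rcases h1 with h | ⟨_, d, had, hbd, h1⟩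
  · exact absurd h hab
  by_cases hdc : d = c
  · rwa [← hdc]
  have hda : R3 U d a := Or.inr ⟨had.symm, b, hbd.symm, hab, by
    rw [tc_rot had.symm hbd.symm hab]; exact h1⟩
  rcases hda.trans h13 with h | ⟨_, f, hdf, hcf, h3⟩
  · exact absurd h hdc
  have hc1 := conj_inv_mem h3 h1
  have hc2 := conj_inv_mem (inv_mem h3) h1
  rw [tc_inv hdc hdf hcf, tc_conj] at hc2
  rw [tc_conj, tc_a hdc hdf] at hc1
  by_cases hfa : f = a
  · subst hfa
    rw [tc_a hac had, tc_o hab.symm hbc hbd, tc_c] at hc2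
    have := inv_mem hc2
    rwa [tc_inv hbc.symm hac.symm hab.symm] at this
  by_cases hfb : f = b
  · subst hfb
    rw [tc_o hab hac had, tc_a hbc hbd, tc_c] at hc2
    have := inv_mem hc2
    rw [tc_inv hac hab hbc.symm] at this
    rwa [tc_rot hab hac hbc]
  · rwa [tc_o had hac (Ne.symm hfa), tc_o hbd hbc (Ne.symm hfb)] at hc1

theorem R3.map {a b : Fin n} (h : R3 U a b) {u : Perm (Fin n)} (hu : u ∈ U) : R3 U (u a) (u b) := by
  rcases h with h | ⟨hab, c, hac, hbc, h⟩
  · exact Or.inl (by rw [h])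
  · refine Or.inr ⟨u.injective.ne hab, u c, u.injective.ne hac, u.injective.ne hbc, ?_⟩
    rw [← tc_conj]; exact conj_inv_mem hu h

theorem R3.pow {a : Fin n} {u : Perm (Fin n)} (hu : u ∈ U) (h : R3 U a (u a)) (i : ℕ) : R3 U a ((u ^ i) a) := by
  induction i with
  | zero => exact Or.inl rfl
  | succ i ih =>
    rw [_root_.pow_succ', Perm.mul_apply]
    exact h.trans (ih.map hu)

/-- class of a point moved by a `p`-cycle -/
theorem R3.cyc {p : ℕ} (hp : p.Prime) {g : Perm (Fin n)} (hg : g.cycleType = {p}) (hU : g ∈ U) {x x' : Fin n}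
    (hx : g x ≠ x) (h : R3 U x x') (hne : x ≠ x') : ∀ y, g y ≠ y → R3 U x y := by
  have hcyc := cyc_isCycle hg
  have key : R3 U x (g x) := by
    by_cases hx' : g x' = x'
    · have := h.map hU
      rw [hx'] at this
      exact h.trans this.symm
    · obtain ⟨i, hi⟩ := hcyc.exists_pow_eq hx hx'
      have hpi : ¬ p ∣ i := by
        intro hd
        have : g ^ i = 1 := by rw [← orderOf_dvd_iff_pow_eq_one, cyc_order hg]; exact hd
        rw [this] at hi; exact hne hi
      rw [← hi] at h
      obtain ⟨j, -, hj⟩ := Nat.exists_mul_mod_eq_one_of_coprime ((Nat.Prime.coprime_iff_not_dvd hp).2 hpi).symm hp.one_lt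
      have := R3.pow (pow_mem hU i) h j
      rw [← pow_mul, ← pow_mod_orderOf, cyc_order hg, hj, pow_one] at this
      exact this
  intro y hy
  obtain ⟨i, hi⟩ := hcyc.exists_pow_eq hx hy
  rw [← hi]; exact R3.pow hU key i

end rel

theorem conj_mem_of_two_pow {U : Subgroup (Perm (Fin n))} {c : ℕ} (hU : U.index = 2 ^ c) {p : ℕ} (hp : p.Prime) (hp2 : p ≠ 2)
    (g : Perm (Fin n)) (hg : g ^ p = 1) : ∃ s, s * g * s⁻¹ ∈ U := by
  haveI := Fact.mk hp
  have hP : IsPGroup p (Subgroup.zpowers g) := IsPGroup.of_card_dvd_pow (n := 1) (by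
    rw [Nat.card_zpowers, pow_one]; exact orderOf_dvd_of_pow_eq_one hg)
  obtain ⟨q, hq⟩ := hP.nonempty_fixed_point_of_prime_not_dvd_card (Perm (Fin n) ⧸ U) (by
    rw [← Subgroup.index, hU]
    intro h
    exact hp2 ((Nat.prime_dvd_prime_iff_eq hp Nat.prime_two).1 (hp.dvd_of_dvd_pow h)))
  induction q using QuotientGroup.induction_on with
  | H s =>
    have := hq ⟨g, Subgroup.mem_zpowers g⟩
    refine ⟨s⁻¹, ?_⟩
    have h2 : ((g * s : Perm (Fin n)) : Perm (Fin n) ⧸ U) = s := this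
    have h3 := QuotientGroup.eq.1 h2.symm
    simpa [mul_assoc] using h3

theorem choose_small {n a c : ℕ} (hn : 5 ≤ n) (ha : a ≤ n) (h : n.choose a ∣ 2 ^ c) : a ≤ 1 ∨ n ≤ a + 1 := by
  by_contra! hcon
  obtain ⟨k, hk, he⟩ := (Nat.dvd_prime_pow Nat.prime_two).1 h
  have h1 : n.choose a ≤ n := by
    have := Nat.pow_factorization_choose_le (p := 2) (k := a) (show 0 < n by omega)
    rw [he, Nat.prime_two.factorization_pow] at this
    simp at this
    rw [he]; exact this
  have h2 : n < n.choose a := by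
    clear he h h1
    induction n generalizing a with
    | zero => omega
    | succ m ih =>
      obtain ⟨b, rfl⟩ : ∃ b, a = b + 1 := ⟨a - 1, by omega⟩
      rw [Nat.choose_succ_succ']
      rcases Nat.lt_or_ge m 5 with h5 | h5
      · have : m = 4 := by omega
        subst this
        have : b = 1 ∨ b = 2 := by omega
        rcases this with rfl | rfl <;> decide
      · by_cases hb : b + 1 + 1 < m
        · have := ih h5 (a := b + 1) (by omega) (by omega)
          have : 0 < m.choose b := Nat.choose_pos (by omega)
          omega
        · have hb2 : m = b + 2 := by omega
          have := ih h5 (a := b) (by omega) (by omega)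
          have : 0 < m.choose (b+1) := Nat.choose_pos (by omega)
          omega
  omega

theorem orbit_choose (U : Subgroup (Perm (Fin n))) (x : Fin n) :
    n.choose (MulAction.orbit U x).ncard ∣ U.index := by
  classical
  let s : Finset (Fin n) := (MulAction.orbit U x).toFinset
  have hs : s.card = (MulAction.orbit U x).ncard := by
    rw [Set.ncard_eq_toFinset_card']
  let S : Set.powersetCard (Fin n) (MulAction.orbit U x).ncard := ⟨s, hs⟩
  have h1 : U ≤ MulAction.stabilizer (Perm (Fin n)) S := by
    intro u hu
    rw [MulAction.mem_stabilizer_iff]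
    apply Subtype.ext
    show u • s = s
    apply Finset.eq_of_subset_of_card_le
    · intro y hy
      rw [Finset.mem_smul_finset] at hy
      obtain ⟨z, hz, rfl⟩ := hy
      simp only [s, Set.mem_toFinset] at hz ⊢
      obtain ⟨v, rfl⟩ := hz
      exact ⟨⟨u, hu⟩ * v, rfl⟩
    · rw [Finset.card_smul_finset]
  have h2 : (MulAction.stabilizer (Perm (Fin n)) S).index = n.choose (MulAction.orbit U x).ncard := by
    haveI : MulAction.IsPretransitive (Perm (Fin n)) (Set.powersetCard (Fin n) (MulAction.orbit U x).ncard) :=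
      Set.powersetCard.isPretransitive
    rw [MulAction.index_stabilizer_of_transitive]
    rw [Set.powersetCard.card]; simp
  rw [← h2]
  exact Subgroup.index_dvd_of_le h1

theorem LemP2 (hn : 5 ≤ n) {U : Subgroup (Perm (Fin n))} {c : ℕ} (hU : U.index = 2 ^ c) :
    alternatingGroup (Fin n) ≤ U ∨ (7 ≤ n ∧ ∃ i : Fin n, (∀ u ∈ U, u i = i) ∧
      ∀ a b c : Fin n, a ≠ b → a ≠ c → b ≠ c → a ≠ i → b ≠ i → c ≠ i → tc a b c ∈ U) := by
  classical
  obtain ⟨p, hp, h1, h2, h3, -⟩ := NT1 n hn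
  obtain ⟨g0, hg0⟩ := exists_cyc hp.two_le h2
  obtain ⟨sg, hsg⟩ := conj_mem_of_two_pow hU hp h3 g0 (by rw [← orderOf_dvd_iff_pow_eq_one, cyc_order hg0])
  obtain ⟨z0, hz0⟩ := exists_cyc (n := n) (p := 3) (by norm_num) (by omega)
  obtain ⟨sz, hsz⟩ := conj_mem_of_two_pow hU Nat.prime_three (by norm_num) z0 (by rw [← orderOf_dvd_iff_pow_eq_one, cyc_order hz0])
  set g := sg * g0 * sg⁻¹ with hgdef
  set z := sz * z0 * sz⁻¹ with hzdef
  have hg : g.cycleType = {p} := by rw [hgdef, cycleType_conj, hg0]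
  have hz : z.IsThreeCycle := by rw [IsThreeCycle, hzdef, cycleType_conj, hz0]
  obtain ⟨a, b, d, hab, had, hbd, hzt⟩ := exists_tc hz
  rw [hzt] at hsz
  have hRab : R3 U a b := Or.inr ⟨hab, d, had, hbd, hsz⟩
  set Ω := MulAction.orbit U a with hΩ
  have hΩn : n ≤ Ω.ncard + 1 := by
    have hch := orbit_choose U a
    rw [hU] at hch
    rcases choose_small hn (by simpa using Set.ncard_le_card Ω) hch with h | h
    · exfalso
      rw [Set.ncard_le_one] at h
      have hb : b ∈ Ω := ⟨⟨_, hsz⟩, tc_a hab had⟩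
      exact hab (h a (MulAction.mem_orbit_self a) b hb)
    · exact h
  have hΩc : (Ωᶜ).ncard ≤ 1 := by
    have := Set.ncard_add_ncard_compl Ω
    simp at this; omega
  have hΩ1 : ∀ x y, x ∉ Ω → y ∉ Ω → x = y := fun x y hx hy => (Set.ncard_le_one).1 hΩc x hx y hy
  -- a point in the orbit moved by g
  obtain ⟨x, hxΩ, hgx⟩ : ∃ x ∈ Ω, g x ≠ x := by
    have : 1 < g.support.card := by rw [cyc_supp hg]; exact hp.one_lt
    obtain ⟨x, hx, y, hy, hxy⟩ := Finset.one_lt_card.1 this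
    by_cases hxo : x ∈ Ω
    · exact ⟨x, hxo, mem_support.1 hx⟩
    · by_cases hyo : y ∈ Ω
      · exact ⟨y, hyo, mem_support.1 hy⟩
      · exact absurd (hΩ1 x y hxo hyo) hxy
  have hcl : ∀ y, g y ≠ y → R3 U x y := by
    obtain ⟨u, hu⟩ := hxΩ
    have hu' : (u : Perm (Fin n)) a = x := hu
    have := hRab.map u.2
    rw [hu'] at this
    exact R3.cyc hp hg hsg hgx this (by rw [← hu']; exact (u : Perm (Fin n)).injective.ne hab)
  have hall : ∀ y ∈ Ω, R3 U x y := by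
    intro y hy
    obtain ⟨u, hu, huy⟩ : ∃ u ∈ U, u x = y := by
      obtain ⟨v, hv⟩ := hxΩ
      obtain ⟨w, hw⟩ := hy
      refine ⟨w * (v : Perm (Fin n))⁻¹, mul_mem w.2 (inv_mem v.2), ?_⟩
      have hv' : (v : Perm (Fin n)) a = x := hv
      have hw' : (w : Perm (Fin n)) a = y := hw
      rw [← hv', ← hw']; simp
    -- supports meet
    have hmeet : (g.support ∩ g.support.map u.toEmbedding).Nonempty := by
      rw [← Finset.card_pos]
      have e1 := Finset.card_union_add_card_inter g.support (g.support.map u.toEmbedding)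
      have e2 : (g.support ∪ g.support.map u.toEmbedding).card ≤ n := by
        simpa using Finset.card_le_univ (g.support ∪ g.support.map u.toEmbedding)
      rw [Finset.card_map, cyc_supp hg] at e1
      omega
    obtain ⟨w, hw⟩ := hmeet
    rw [Finset.mem_inter, Finset.mem_map] at hw
    obtain ⟨hw1, v, hv, hvw⟩ := hw
    have e1 := hcl w (mem_support.1 hw1)
    have e2 := (hcl v (mem_support.1 hv)).map hu
    rw [huy] at e2
    have : u v = w := hvw
    rw [this] at e2
    exact e1.trans e2.symm
  have hin : ∀ a b c : Fin n, a ≠ b → a ≠ c → b ≠ c → a ∈ Ω → b ∈ Ω → c ∈ Ω → tc a b c ∈ U := by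
    intro a b c hab hac hbc ha hb hc
    exact R3.full hab hac hbc ((hall a ha).symm.trans (hall b hb)) ((hall b hb).symm.trans (hall c hc))
  by_cases hfull : ∀ x, x ∈ Ω
  · left
    rw [← closure_three_cycles_eq_alternating, Subgroup.closure_le]
    intro y hy
    obtain ⟨a, b, c, hab, hac, hbc, rfl⟩ := exists_tc hy
    exact hin a b c hab hac hbc (hfull _) (hfull _) (hfull _)
  · right
    push Not at hfull
    obtain ⟨i, hi⟩ := hfull
    have hne : ∀ y, y ≠ i → y ∈ Ω := fun y hy => by
      by_contra hc; exact hy (hΩ1 _ _ hc hi)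
    refine ⟨?_, i, ?_, ?_⟩
    · have hle : Ω.ncard < n := by
        have := Set.ncard_lt_card (s := Ω) (by intro h; rw [h] at hi; exact hi trivial)
        simpa using this
      have hch := orbit_choose U a
      rw [hU] at hch
      have e : Ω.ncard = n - 1 := by omega
      rw [← hΩ, e, Nat.choose_symm (by omega), Nat.choose_one_right] at hch
      obtain ⟨k, hk, he⟩ := (Nat.dvd_prime_pow Nat.prime_two).1 hch
      by_contra hlt
      have h56 : n = 5 ∨ n = 6 := by omega
      have : k < 3 := by
        by_contra hk3
        have : 2 ^ 3 ≤ 2 ^ k := Nat.pow_le_pow_right (by norm_num) (by omega)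
        omega
      interval_cases k <;> omega
    · intro u hu
      by_contra hc
      have := hne _ hc
      obtain ⟨v, hv⟩ := this
      apply hi
      refine ⟨(⟨u, hu⟩ : U)⁻¹ * v, ?_⟩
      show ((⟨u, hu⟩ : U)⁻¹ * v) • a = i
      have hv' : v • a = u i := hv
      rw [mul_smul, hv']
      show u⁻¹ (u i) = i
      simp
    · intro a b c hab hac hbc ha hb hc
      exact hin a b c hab hac hbc (hne _ ha) (hne _ hb) (hne _ hc)
end HG

namespace HG
open Equiv Equiv.Perm
variable {n : ℕ}

theorem fact3 (i : ℕ) (hi : 2 ≤ i) : 2 * (3 ^ i * (i + 1).factorial) < (3 * i).factorial := by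
  induction i, hi using Nat.le_induction with
  | base => decide
  | succ i hi ih =>
    have e1 : (3 * (i + 1)).factorial = (3 * i + 3) * ((3 * i + 2) * ((3 * i + 1) * (3 * i).factorial)) := by
      rw [show 3 * (i + 1) = 3 * i + 1 + 1 + 1 by ring, Nat.factorial_succ, Nat.factorial_succ, Nat.factorial_succ]
    rw [e1, Nat.factorial_succ (i + 1)]
    calc 2 * (3 ^ (i + 1) * ((i + 1 + 1) * (i + 1).factorial)) = (3 * (i + 2)) * (2 * (3 ^ i * (i + 1).factorial)) := by ring
      _ < (3 * (i + 2)) * (3 * i).factorial := by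
        apply Nat.mul_lt_mul_of_pos_left ih; omega
      _ ≤ (3 * i + 3) * (3 * i + 2) * (3 * i + 1) * (3 * i).factorial := by
        apply Nat.mul_le_mul_right
        calc 3 * (i + 2) ≤ (3 * i + 3) * (3 * i + 2) := by nlinarith
          _ ≤ (3 * i + 3) * (3 * i + 2) * (3 * i + 1) := Nat.le_mul_of_pos_right _ (by omega)
      _ = _ := by ring

theorem cent_ineq {n j : ℕ} (hn : 7 ≤ n) (hj : 2 ≤ j) (hjn : 3 * j ≤ n) :
    2 * ((n - 3 * j).factorial * 3 ^ j * j.factorial) < (n - 3).factorial * 3 := by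
  obtain ⟨m, rfl⟩ : ∃ m, n = m + 3 := ⟨n - 3, by omega⟩
  obtain ⟨i, rfl⟩ : ∃ i, j = i + 1 := ⟨j - 1, by omega⟩
  rw [show m + 3 - 3 * (i + 1) = m - 3 * i by omega, show m + 3 - 3 = m by omega]
  have key : 2 * ((m - 3 * i).factorial * (3 ^ i * (i + 1).factorial)) < m.factorial := by
    by_cases h1 : i = 1
    · subst h1
      obtain ⟨k, rfl⟩ : ∃ k, m = k + 1 + 1 + 1 := ⟨m - 3, by omega⟩
      rw [show k + 1 + 1 + 1 - 3 * 1 = k by omega, Nat.factorial_succ (k + 1 + 1), Nat.factorial_succ (k + 1), Nat.factorial_succ k]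
      have h0 := Nat.factorial_pos k
      have hk : 1 ≤ k := by omega
      have : 2 * (k.factorial * (3 ^ 1 * (1 + 1).factorial)) = 12 * k.factorial := by
        simp [Nat.factorial]; ring
      rw [this, ← mul_assoc, ← mul_assoc]
      apply Nat.mul_lt_mul_of_pos_right _ h0
      have h4 : 4 * 3 ≤ (k + 1 + 1 + 1) * (k + 1 + 1) := Nat.mul_le_mul (by omega) (by omega)
      have h5 : 4 * 3 * 2 ≤ (k + 1 + 1 + 1) * (k + 1 + 1) * (k + 1) := Nat.mul_le_mul h4 (by omega)
      omega
    · have h2 := fact3 i (by omega)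
      have h3 : (3 * i).factorial * (m - 3 * i).factorial ≤ m.factorial :=
        Nat.le_of_dvd (Nat.factorial_pos _) (Nat.factorial_mul_factorial_dvd_factorial (by omega))
      have h0 := Nat.factorial_pos (m - 3 * i)
      calc 2 * ((m - 3 * i).factorial * (3 ^ i * (i + 1).factorial)) = (2 * (3 ^ i * (i + 1).factorial)) * (m - 3 * i).factorial := by ring
        _ < (3 * i).factorial * (m - 3 * i).factorial := Nat.mul_lt_mul_of_pos_right h2 h0
        _ ≤ _ := h3
  calc _ = 2 * ((m - 3 * i).factorial * (3 ^ i * (i + 1).factorial)) * 3 := by ring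
    _ < _ := Nat.mul_lt_mul_of_pos_right key (by norm_num)

theorem cent_alt_le (x : alternatingGroup (Fin n)) :
    Nat.card (Subgroup.centralizer ({x} : Set (alternatingGroup (Fin n)))) ≤
      Nat.card (Subgroup.centralizer ({(x : Perm (Fin n))} : Set (Perm (Fin n)))) := by
  apply Nat.card_le_card_of_injective
    (fun y : Subgroup.centralizer ({x} : Set (alternatingGroup (Fin n))) => (⟨(y : alternatingGroup (Fin n)), by
      have := Subgroup.mem_centralizer_singleton_iff.1 y.2
      rw [Subgroup.mem_centralizer_singleton_iff]
      exact congrArg Subtype.val this⟩ : Subgroup.centralizer ({(x : Perm (Fin n))} : Set (Perm (Fin n)))))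
  intro y z h
  have h' := Subtype.ext_iff.1 h
  exact Subtype.ext (Subtype.ext h')

theorem cent_le_alt (x : alternatingGroup (Fin n)) :
      Nat.card (Subgroup.centralizer ({(x : Perm (Fin n))} : Set (Perm (Fin n)))) ≤
    2 * Nat.card (Subgroup.centralizer ({x} : Set (alternatingGroup (Fin n)))) := by
  set C := Subgroup.centralizer ({(x : Perm (Fin n))} : Set (Perm (Fin n))) with hC
  let f : C →* ℤˣ := sign.comp C.subtype
  have h1 : Nat.card f.ker * f.ker.index = Nat.card C := Subgroup.card_mul_index _
  have h2 : f.ker.index ≤ 2 := by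
    rw [Subgroup.index_ker]
    calc Nat.card f.range ≤ Nat.card ℤˣ := Nat.card_le_card_of_injective _ Subtype.val_injective
      _ = 2 := by simp
  have h3 : Nat.card f.ker ≤ Nat.card (Subgroup.centralizer ({x} : Set (alternatingGroup (Fin n)))) := by
    apply Nat.card_le_card_of_injective
      (fun y : f.ker => (⟨⟨(y : C), mem_alternatingGroup.2 (MonoidHom.mem_ker.1 y.2)⟩, by
        have := Subgroup.mem_centralizer_singleton_iff.1 (y : C).2
        rw [Subgroup.mem_centralizer_singleton_iff]
        exact Subtype.ext this⟩ : Subgroup.centralizer ({x} : Set (alternatingGroup (Fin n)))))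
    intro y z h
    have h' := Subtype.ext_iff.1 (Subtype.ext_iff.1 h)
    exact Subtype.ext (Subtype.ext h')
  calc Nat.card C = f.ker.index * Nat.card f.ker := by rw [← h1, mul_comm]
    _ ≤ _ := Nat.mul_le_mul h2 h3

theorem cent_iso {A : Type*} [Group A] (ψ : A ≃* A) (x : A) :
    Nat.card (Subgroup.centralizer ({x} : Set A)) = Nat.card (Subgroup.centralizer ({ψ x} : Set A)) := by
  apply Nat.card_congr
  refine ψ.toEquiv.subtypeEquiv ?_
  intro a
  rw [Subgroup.mem_centralizer_singleton_iff, Subgroup.mem_centralizer_singleton_iff]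
  show _ ↔ ψ a * ψ x = ψ x * ψ a
  rw [← map_mul, ← map_mul, ψ.injective.eq_iff]

theorem three_to_three (hn : 5 ≤ n) (hn6 : n ≠ 6) (ψ : alternatingGroup (Fin n) ≃* alternatingGroup (Fin n))
    (x : alternatingGroup (Fin n)) (hx : (x : Perm (Fin n)).IsThreeCycle) :
    (ψ x : Perm (Fin n)).IsThreeCycle := by
  set y : Perm (Fin n) := (ψ x : Perm (Fin n)) with hy
  have hx3 : x ^ 3 = 1 := by
    apply Subtype.ext
    have := pow_orderOf_eq_one (x : Perm (Fin n))
    rw [hx.orderOf] at this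
    exact this
  have hy3 : y ^ 3 = 1 := by
    rw [hy, ← Subgroup.coe_pow, ← map_pow, hx3]; simp
  haveI : Fact (Nat.Prime 3) := ⟨Nat.prime_three⟩
  have hct := cycleType_of_pow_prime_eq_one hy3
  set j := y.cycleType.card with hj
  have hsum : 3 * j ≤ n := by
    have := sum_cycleType y
    have h2 : y.support.card ≤ n := by simpa using Finset.card_le_univ y.support
    rw [← this, hct] at h2
    simp at h2; omega
  have hj0 : j ≠ 0 := by
    intro h0
    rw [hj, card_cycleType_eq_zero] at h0
    have : ψ x = 1 := Subtype.ext h0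
    rw [EmbeddingLike.map_eq_one_iff] at this
    exact hx.ne_one (by rw [this]; rfl)
  have hj1 : j = 1 := by
    by_contra hne
    have hj2 : 2 ≤ j := by omega
    have c1 : Nat.card (Subgroup.centralizer ({(x : Perm (Fin n))} : Set (Perm (Fin n)))) = (n - 3).factorial * 3 := by
      rw [nat_card_centralizer, hx.cycleType]; simp
    have c2 : Nat.card (Subgroup.centralizer ({y} : Set (Perm (Fin n)))) = (n - 3 * j).factorial * 3 ^ j * j.factorial := by
      rw [nat_card_centralizer, hct]
      simp [Multiset.toFinset_replicate, hj0, mul_comm 3 j]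
    have := cent_ineq (n := n) (by omega) hj2 hsum
    have e1 := cent_le_alt x
    have e2 := cent_alt_le (ψ x)
    rw [cent_iso ψ x] at e1
    rw [← hy, c2] at e2
    rw [c1] at e1
    omega
  rw [hj1] at hct
  exact hct

theorem tc_sq {a b c d : Fin n} (ab : a ≠ b) (ac : a ≠ c) (ad : a ≠ d) (bc : b ≠ c) (bd : b ≠ d) (cd : c ≠ d) :
    (tc a b c * tc a b d) * (tc a b c * tc a b d) = 1 ∧ tc a b c * tc a b d ≠ 1 := by
  constructor
  · ext x
    congr 1
    simp only [Perm.mul_apply, Perm.one_apply]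
    by_cases h1 : x = a
    · subst h1; rw [tc_a ab ad, tc_b ac bc, tc_o ac.symm bc.symm cd, tc_c]
    by_cases h2 : x = b
    · subst h2; rw [tc_b ad bd, tc_o ad.symm bd.symm cd.symm, tc_c, tc_a ab ac]
    by_cases h3 : x = c
    · subst h3; rw [tc_o h1 h2 cd, tc_c, tc_a ab ad, tc_b ac bc]
    by_cases h4 : x = d
    · subst h4; rw [tc_c, tc_a ab ac, tc_b ad bd, tc_o h1 h2 h3]
    rw [tc_o h1 h2 h4, tc_o h1 h2 h3, tc_o h1 h2 h4, tc_o h1 h2 h3]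
  · intro h
    have := congrArg (fun f : Perm (Fin n) => f a) h
    simp only [Perm.mul_apply, Perm.one_apply] at this
    rw [tc_a ab ad, tc_b ac bc] at this
    exact ac this.symm

theorem pair_form {y y' : Perm (Fin n)} (hy : y.IsThreeCycle) (hy' : y'.IsThreeCycle)
    (hsq : (y * y') * (y * y') = 1) (hne : y * y' ≠ 1) :
    ∃ a b c d, a ≠ b ∧ a ≠ c ∧ b ≠ c ∧ a ≠ d ∧ b ≠ d ∧ c ≠ d ∧ y = tc a b c ∧ y' = tc a b d := by
  have hF : ∀ u, y' (y (y' (y u))) = u := by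
    intro u
    have : (y' * y) * (y' * y) = 1 := by
      calc (y' * y) * (y' * y) = y⁻¹ * ((y * y') * (y * y')) * y := by group
        _ = 1 := by rw [hsq]; group
    exact congrArg (fun f : Perm (Fin n) => f u) this
  have step : ∀ u, y u ≠ u → y' u = u → y' (y u) ≠ y u := by
    intro u hu h1 h2
    have := hF u
    rw [h2] at this
    have h3 := (three_eq_tc hy hu).2.2.1
    apply h3
    apply y'.injective
    rw [this, h1]
  obtain ⟨a, ha, ha1, ha2⟩ : ∃ a, y a ≠ a ∧ y' a ≠ a ∧ y' (y a) ≠ y a := by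
    obtain ⟨a, b, c, hab, hac, hbc, rfl⟩ := exists_tc hy
    by_cases h1 : y' a = a
    · refine ⟨b, ?_, ?_, ?_⟩
      · rw [tc_b hac hbc]; exact hbc.symm
      · have := step a (by rw [tc_a hab hac]; exact hab.symm) h1
        rwa [tc_a hab hac] at this
      · intro h2
        rw [tc_b hac hbc] at h2
        have := step c (by rw [tc_c]; exact hac) h2
        rw [tc_c] at this
        exact this h1
    by_cases h2 : y' b = b
    · refine ⟨c, ?_, ?_, ?_⟩
      · rw [tc_c]; exact hac
      · have := step b (by rw [tc_b hac hbc]; exact hbc.symm) h2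
        rwa [tc_b hac hbc] at this
      · rw [tc_c]; exact h1
    · exact ⟨a, by rw [tc_a hab hac]; exact hab.symm, h1, by rw [tc_a hab hac]; exact h2⟩
  obtain ⟨e1, hab, hac, hbc⟩ := three_eq_tc hy ha
  obtain ⟨e2, had, haf, hdf⟩ := three_eq_tc hy' ha1
  set b := y a
  set c := y b
  set d := y' a
  set f := y' d
  by_cases hdb : d = b
  · rw [hdb] at e2 hdf
    refine ⟨a, b, c, f, hab, hac, hbc, haf, hdf, ?_, e1, e2⟩
    intro hcf
    have hyy : y = y' := by rw [e1, e2, hcf]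
    rw [← hyy] at hsq
    have h3 := pow_orderOf_eq_one y
    rw [hy.orderOf] at h3
    apply hy.ne_one
    calc y = (y * y) * (y * y) * (y ^ 3)⁻¹ := by group
      _ = 1 := by rw [hsq, h3]; simp
  · exfalso
    have hfb : f = b := by
      by_contra hfb
      apply ha2
      rw [e2, tc_o hab.symm (Ne.symm hdb) (Ne.symm hfb)]
    rw [hfb] at e2
    by_cases hdc : d = c
    · apply hne
      rw [hdc] at e2
      rw [e1, e2, tc_rot hac hab hbc.symm, ← tc_inv hab hac hbc]
      simp
    · have := hF c
      rw [e1, tc_c, e2, tc_a had hab, tc_o had.symm hdb hdc, tc_b hab hdb] at this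
      exact hbc this

theorem AutAn (hn : 5 ≤ n) (hn6 : n ≠ 6) (ψ : alternatingGroup (Fin n) ≃* alternatingGroup (Fin n)) :
    ∃ σ : Perm (Fin n), ∀ g : alternatingGroup (Fin n), (ψ g : Perm (Fin n)) = σ * g * σ⁻¹ := by
  classical
  let i0 : Fin n := ⟨0, by omega⟩
  let i1 : Fin n := ⟨1, by omega⟩
  let i2 : Fin n := ⟨2, by omega⟩
  let i3 : Fin n := ⟨3, by omega⟩
  have h01 : i0 ≠ i1 := by simp [i0, i1]
  have h02 : i0 ≠ i2 := by simp [i0, i2]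
  have h03 : i0 ≠ i3 := by simp [i0, i3]
  have h12 : i1 ≠ i2 := by simp [i1, i2]
  have h13 : i1 ≠ i3 := by simp [i1, i3]
  have h23 : i2 ≠ i3 := by simp [i2, i3]
  have hx3 : ∀ k, i0 ≠ k → i1 ≠ k → (tc i0 i1 k).IsThreeCycle := fun k h0 h1 => tc_three h01 h0 h1
  have hxA : ∀ k, ∃ x : alternatingGroup (Fin n), i1 ≠ k → (x : Perm (Fin n)) = tc i0 i1 k := fun k => by
    by_cases h : i1 = k
    · exact ⟨1, fun h' => absurd h h'⟩
    · exact ⟨⟨tc i0 i1 k, mem_alternatingGroup.2 (by rw [tc, Perm.sign_mul, sign_swap h01, sign_swap h]; rfl)⟩, fun _ => rfl⟩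
  choose x hx using hxA
  let y : Fin n → Perm (Fin n) := fun k => (ψ (x k) : Perm (Fin n))
  have hy3 : ∀ k, i0 ≠ k → i1 ≠ k → (y k).IsThreeCycle := fun k h0 h1 => three_to_three hn hn6 ψ _ (by rw [hx k h1]; exact hx3 k h0 h1)
  have hpair : ∀ k l, i0 ≠ k → i1 ≠ k → i0 ≠ l → i1 ≠ l → k ≠ l →
    ∃ a b c d, a ≠ b ∧ a ≠ c ∧ b ≠ c ∧ a ≠ d ∧ b ≠ d ∧ c ≠ d ∧ y k = tc a b c ∧ y l = tc a b d := by
    intro k l hk0 hk1 hl0 hl1 hkl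
    obtain ⟨q1, q2⟩ := tc_sq h01 hk0 hl0 hk1 hl1 hkl
    apply pair_form (hy3 k hk0 hk1) (hy3 l hl0 hl1)
    · show ((ψ _ : Perm (Fin n)) * (ψ _ : Perm (Fin n))) * ((ψ _ : Perm (Fin n)) * (ψ _ : Perm (Fin n))) = 1
      rw [← Subgroup.coe_mul, ← Subgroup.coe_mul, ← map_mul, ← map_mul]
      rw [← hx k hk1, ← hx l hl1] at q1
      rw [show (x k * x l) * (x k * x l) = 1 from Subtype.ext q1]
      simp
    · show ((ψ _ : Perm (Fin n)) * (ψ _ : Perm (Fin n))) ≠ 1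
      rw [← Subgroup.coe_mul, ← map_mul]
      intro h
      have h' : ψ (x k * x l) = 1 := Subtype.ext h
      rw [EmbeddingLike.map_eq_one_iff] at h'
      rw [← hx k hk1, ← hx l hl1] at q2
      exact q2 (congrArg Subtype.val h')
  have hadj : ∀ k l, i0 ≠ k → i1 ≠ k → i0 ≠ l → i1 ≠ l → k ≠ l → ∃ u, y k u ≠ u ∧ y l u = y k u := by
    intro k l hk0 hk1 hl0 hl1 hkl
    obtain ⟨a, b, c, d, hab, hac, hbc, had, hbd, hcd, e1, e2⟩ := hpair k l hk0 hk1 hl0 hl1 hkl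
    exact ⟨a, by rw [e1, tc_a hab hac]; exact hab.symm, by rw [e1, e2, tc_a hab hac, tc_a hab had]⟩
  obtain ⟨a, b, c, d, hab, hac, hbc, had, hbd, hcd, e2, e3⟩ := hpair i2 i3 h02 h12 h03 h13 h23
  have hyab : ∀ k, i0 ≠ k → i1 ≠ k → y k a = b := by
    intro k hk0 hk1
    by_cases hk2 : k = i2
    · rw [hk2, e2, tc_a hab hac]
    by_cases hk3 : k = i3
    · rw [hk3, e3, tc_a hab had]
    obtain ⟨u, hu1, hu2⟩ := hadj i2 k h02 h12 hk0 hk1 (Ne.symm hk2)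
    obtain ⟨v, hv1, hv2⟩ := hadj i3 k h03 h13 hk0 hk1 (Ne.symm hk3)
    have hcard : ¬ (y k a ≠ a ∧ y k b ≠ b ∧ y k c ≠ c ∧ y k d ≠ d) := by
      rintro ⟨q1, q2, q3, q4⟩
      have hsub : ({a, b, c, d} : Finset (Fin n)) ⊆ (y k).support := by
        intro w hw
        simp only [Finset.mem_insert, Finset.mem_singleton] at hw
        rw [mem_support]
        rcases hw with rfl | rfl | rfl | rfl <;> assumption
      have := Finset.card_le_card hsub
      rw [(hy3 k hk0 hk1).card_support] at this
      have h4 : ({a, b, c, d} : Finset (Fin n)).card = 4 := by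
        rw [Finset.card_eq_succ]
        refine ⟨a, {b, c, d}, by simp [hab, hac, had], rfl, ?_⟩
        rw [Finset.card_eq_three]
        exact ⟨b, c, d, hbc, hbd, hcd, rfl⟩
      omega
    have mv : ∀ {s t}, y k s = t → s ≠ t → y k s ≠ s ∧ y k t ≠ t := by
      intro s t h hst
      refine ⟨by rw [h]; exact hst.symm, fun h' => hst ?_⟩
      exact (y k).injective (h.trans h'.symm)
    have hu : u = a ∨ u = b ∨ u = c := by
      by_contra hcon
      push Not at hcon
      exact hu1 (by rw [e2, tc_o hcon.1 hcon.2.1 hcon.2.2])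
    have hv : v = a ∨ v = b ∨ v = d := by
      by_contra hcon
      push Not at hcon
      exact hv1 (by rw [e3, tc_o hcon.1 hcon.2.1 hcon.2.2])
    rcases hu with rfl | rfl | rfl
    · rw [hu2, e2, tc_a hab hac]
    · rw [e2, tc_b hac hbc] at hu2
      rcases hv with rfl | rfl | rfl
      · rw [hv2, e3, tc_a hab had]
      · rw [e3, tc_b had hbd, hu2] at hv2
        exact absurd hv2 hcd
      · rw [e3, tc_c] at hv2
        exact absurd ⟨(mv hv2 had.symm).2, (mv hu2 hbc).1, (mv hu2 hbc).2, (mv hv2 had.symm).1⟩ hcard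
    · rw [e2, tc_c] at hu2
      rcases hv with rfl | rfl | rfl
      · rw [hv2, e3, tc_a hab had]
      · rw [e3, tc_b had hbd] at hv2
        exact absurd ⟨(mv hu2 hac.symm).2, (mv hv2 hbd).1, (mv hu2 hac.symm).1, (mv hv2 hbd).2⟩ hcard
      · rw [e3, tc_c] at hv2
        exact absurd ((y k).injective (hu2.trans hv2.symm)) hcd
  have hform : ∀ k, i0 ≠ k → i1 ≠ k → y k = tc a b (y k b) ∧ a ≠ y k b ∧ b ≠ y k b := by
    intro k hk0 hk1
    have hm : y k a ≠ a := by rw [hyab k hk0 hk1]; exact hab.symm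
    have := three_eq_tc (hy3 k hk0 hk1) hm
    rw [hyab k hk0 hk1] at this
    exact ⟨this.1, this.2.2.1, this.2.2.2⟩
  let f : Fin n → Fin n := fun k => if k = i0 then a else if k = i1 then b else y k b
  have f0 : f i0 = a := by simp [f]
  have f1 : f i1 = b := by simp [f, h01.symm]
  have fk : ∀ k, i0 ≠ k → i1 ≠ k → f k = y k b := fun k h0 h1 => by simp [f, h0.symm, h1.symm]
  have hinj : Function.Injective f := by
    intro k l hkl
    by_cases k0 : i0 = k
    · by_cases l0 : i0 = l
      · exact k0.symm.trans l0
      by_cases l1 : i1 = l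
      · rw [← k0, ← l1, f0, f1] at hkl; exact absurd hkl hab
      · rw [← k0, f0, fk l l0 l1] at hkl; exact absurd hkl (hform l l0 l1).2.1
    by_cases k1 : i1 = k
    · by_cases l0 : i0 = l
      · rw [← l0, ← k1, f0, f1] at hkl; exact absurd hkl.symm hab
      by_cases l1 : i1 = l
      · exact k1.symm.trans l1
      · rw [← k1, f1, fk l l0 l1] at hkl; exact absurd hkl (hform l l0 l1).2.2
    · by_cases l0 : i0 = l
      · rw [← l0, f0, fk k k0 k1] at hkl; exact absurd hkl.symm (hform k k0 k1).2.1
      by_cases l1 : i1 = l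
      · rw [← l1, f1, fk k k0 k1] at hkl; exact absurd hkl.symm (hform k k0 k1).2.2
      · rw [fk k k0 k1, fk l l0 l1] at hkl
        have e : y k = y l := by rw [(hform k k0 k1).1, (hform l l0 l1).1, hkl]
        have e' := congrArg Subtype.val (ψ.injective (Subtype.ext e))
        have : tc i0 i1 k i1 = tc i0 i1 l i1 := by
          rw [← hx k k1, ← hx l l1, e']
        rwa [tc_b k0 k1, tc_b l0 l1] at this
  let σ : Perm (Fin n) := Equiv.ofBijective f (Finite.injective_iff_bijective.1 hinj)
  refine ⟨σ, ?_⟩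
  let ψ1 : alternatingGroup (Fin n) →* Perm (Fin n) := (alternatingGroup (Fin n)).subtype.comp ψ.toMonoidHom
  let ψ2 : alternatingGroup (Fin n) →* Perm (Fin n) := (MulAut.conj σ).toMonoidHom.comp (alternatingGroup (Fin n)).subtype
  let V : Subgroup (Perm (Fin n)) := (MonoidHom.eqLocus ψ1 ψ2).map (alternatingGroup (Fin n)).subtype
  have hV : ∀ k, i0 ≠ k → i1 ≠ k → tc i0 i1 k ∈ V := by
    intro k h0 h1
    refine ⟨x k, ?_, hx k h1⟩
    show y k = σ * (x k : Perm (Fin n)) * σ⁻¹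
    rw [hx k h1, tc_conj]
    show y k = tc (f i0) (f i1) (f k)
    rw [f0, f1, fk k h0 h1]; exact (hform k h0 h1).1
  have hR : ∀ k, R3 V i0 k := by
    have r1 : R3 V i0 i1 := Or.inr ⟨h01, i2, h02, h12, hV i2 h02 h12⟩
    intro k
    by_cases h0 : i0 = k
    · exact Or.inl h0
    by_cases h1 : i1 = k
    · rw [← h1]; exact r1
    · refine r1.trans (Or.inr ⟨h1, i0, h01.symm, Ne.symm h0, ?_⟩)
      rw [← tc_rot h01 h0 h1]; exact hV k h0 h1
  have hle : alternatingGroup (Fin n) ≤ V := by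
    rw [← closure_three_cycles_eq_alternating, Subgroup.closure_le]
    intro y hy
    obtain ⟨a, b, c, hab, hac, hbc, rfl⟩ := exists_tc hy
    exact R3.full hab hac hbc ((hR a).symm.trans (hR b)) ((hR b).symm.trans (hR c))
  intro g
  obtain ⟨g', hg', he⟩ := hle g.2
  have : g' = g := Subtype.ext he
  rw [this] at hg'
  exact hg'
end HG

namespace HG
open Equiv Equiv.Perm
variable {n : ℕ}

section semi
variable {K S : Type*} [Group K] [Group S] (β : S →* MulAut K)

theorem semi_min [Finite K] [Finite S] (hs : ∀ L : Subgroup K, L.Normal → (∀ g, ∀ x ∈ L, β g x ∈ L) → L = ⊥ ∨ L = ⊤)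
    [Finite (K ⋊[β] S)] :
    MinNormal (SemidirectProduct.rightHom : K ⋊[β] S →* S).ker := by
  have hr : (SemidirectProduct.inl : K →* K ⋊[β] S).range = (SemidirectProduct.rightHom : K ⋊[β] S →* S).ker :=
    SemidirectProduct.range_inl_eq_ker_rightHom
  refine ⟨fun e _ => mem_nz.2 fun x hx => ?_, ?_⟩
  · rw [MonoidHom.mem_ker] at hx ⊢
    rw [map_mul, map_mul, hx, mul_one, ← map_mul, mul_inv_cancel, map_one]
  · intro L hL hn
    have hn' : ∀ e : K ⋊[β] S, ∀ x ∈ L, e * x * e⁻¹ ∈ L := fun e => mem_nz.1 (hn trivial)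
    have hN : (L.comap (SemidirectProduct.inl : K →* K ⋊[β] S)).Normal := by
      constructor
      intro x hx e
      have := hn' (SemidirectProduct.inl e) _ hx
      rw [Subgroup.mem_comap, map_mul, map_mul, map_inv]
      exact this
    have hI : ∀ g, ∀ x ∈ L.comap (SemidirectProduct.inl : K →* K ⋊[β] S), β g x ∈ L.comap (SemidirectProduct.inl : K →* K ⋊[β] S) := by
      intro g x hx
      have := hn' (SemidirectProduct.inr g) _ hx
      rw [Subgroup.mem_comap, SemidirectProduct.inl_aut, map_inv]
      exact this
    rcases hs _ hN hI with h | h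
    · left
      rw [eq_bot_iff]
      intro x hx
      have := hL hx
      rw [← hr] at this
      obtain ⟨k, rfl⟩ := this
      have : k ∈ L.comap SemidirectProduct.inl := hx
      rw [h] at this
      rw [Subgroup.mem_bot] at this ⊢
      rw [this, map_one]
    · right
      apply le_antisymm hL
      rw [← hr]
      rintro _ ⟨k, rfl⟩
      have : k ∈ (⊤ : Subgroup K) := trivial
      rw [← h] at this
      exact this

theorem semi_ker_card : Nat.card (SemidirectProduct.rightHom : K ⋊[β] S →* S).ker = Nat.card K := by
  rw [← SemidirectProduct.range_inl_eq_ker_rightHom]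
  exact (Nat.card_congr (MonoidHom.ofInjective SemidirectProduct.inl_injective).toEquiv).symm

theorem semi_cz {k : K} {g : S}
    (h : (⟨k, g⟩ : K ⋊[β] S) ∈ cz (SemidirectProduct.rightHom : K ⋊[β] S →* S).ker) (x : K) :
    β g x = k⁻¹ * x * k := by
  have h1 := mem_cz.1 h (SemidirectProduct.inl x) (by rw [MonoidHom.mem_ker]; simp)
  have h2 := mul_inv_eq_iff_eq_mul.1 h1
  have h3 := congrArg SemidirectProduct.left h2
  simp at h3
  rw [mul_assoc, ← h3]; group
end semi

/-- data used throughout the simple quotient analysis -/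
structure TDat (n : ℕ) (K : Type) [Group K] (β : Perm (Fin n) →* MulAut K) (G0 : Subgroup (Perm (Fin n))) (π : Perm (Fin n) → K) : Prop where
  simple : ∀ L : Subgroup K, L.Normal → (∀ g, ∀ x ∈ L, β g x ∈ L) → L = ⊥ ∨ L = ⊤
  alt : alternatingGroup (Fin n) ≤ G0
  coc : ∀ g ∈ G0, ∀ h ∈ G0, π (g * h) = π g * β g (π h)
  surj : ∀ k, ∃ g ∈ G0, π g = k
  dvd : Nat.card K ∣ n.factorial
  nt : ¬ ∀ g ∈ alternatingGroup (Fin n), π g = 1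

variable {K : Type} [Group K] {β : Perm (Fin n) →* MulAut K} {G0 : Subgroup (Perm (Fin n))} {π : Perm (Fin n) → K}

theorem TDat.one (H : TDat n K β G0 π) : π 1 = 1 := by
  have := H.coc 1 (one_mem _) 1 (one_mem _)
  simpa using this

/-- stabilizer of 1 -/
def TDat.U (H : TDat n K β G0 π) : Subgroup (Perm (Fin n)) where
  carrier := {g | g ∈ G0 ∧ π g = 1}
  one_mem' := ⟨one_mem _, H.one⟩
  mul_mem' := by
    rintro g h ⟨hg, hg'⟩ ⟨hh, hh'⟩
    exact ⟨mul_mem hg hh, by rw [H.coc g hg h hh, hg', hh', map_one, one_mul]⟩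
  inv_mem' := by
    rintro g ⟨hg, hg'⟩
    refine ⟨inv_mem hg, ?_⟩
    have := H.coc g hg g⁻¹ (inv_mem hg)
    rw [mul_inv_cancel, H.one, hg', one_mul] at this
    exact ((MulEquiv.map_eq_one_iff (β g)).1 this.symm)

theorem alt_index (hn : 5 ≤ n) : (alternatingGroup (Fin n)).index = 2 := by
  haveI : Nontrivial (Fin n) := Fin.nontrivial_iff_two_le.2 (by omega)
  exact alternatingGroup.index_eq_two

theorem TDat.U_index (hn : 5 ≤ n) (H : TDat n K β G0 π) : ∃ i, i ∣ 2 ∧ H.U.index = Nat.card K * i := by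
  let act : MulAction G0 K :=
    { smul := fun g k => π g * β g k
      one_smul := fun k => by
        show π ((1 : G0) : Perm (Fin n)) * β ((1 : G0) : Perm (Fin n)) k = k
        rw [Subgroup.coe_one, H.one, map_one, one_mul]; rfl
      mul_smul := fun g h k => by
        show π ((g * h : G0) : Perm (Fin n)) * β ((g * h : G0) : Perm (Fin n)) k = π g * β g (π h * β h k)
        rw [Subgroup.coe_mul, H.coc _ g.2 _ h.2, map_mul, map_mul, MulAut.mul_apply, mul_assoc] }
  have hsm : ∀ (g : G0) (k : K), g • k = π g * β g k := fun _ _ => rfl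
  have htr : MulAction.IsPretransitive G0 K := by
    have h1 : ∀ k : K, ∃ g : G0, g • (1 : K) = k := fun k => by
      obtain ⟨g, hg, hk⟩ := H.surj k
      exact ⟨⟨g, hg⟩, by rw [hsm, map_one, mul_one]; exact hk⟩
    constructor
    intro x y
    obtain ⟨g, rfl⟩ := h1 x
    obtain ⟨h, rfl⟩ := h1 y
    exact ⟨h * g⁻¹, by rw [smul_smul]; simp⟩
  have h1 : (MulAction.stabilizer G0 (1 : K)).index = Nat.card K := MulAction.index_stabilizer_of_transitive _ _
  have h2 : (MulAction.stabilizer G0 (1 : K)).map G0.subtype = H.U := by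
    ext g
    constructor
    · rintro ⟨h, hh, rfl⟩
      refine ⟨h.2, ?_⟩
      have : h • (1 : K) = 1 := hh
      rwa [hsm, map_one, mul_one] at this
    · rintro ⟨hg, hg'⟩
      refine ⟨⟨g, hg⟩, ?_, rfl⟩
      show (⟨g, hg⟩ : G0) • (1 : K) = 1
      rw [hsm, map_one, mul_one]; exact hg'
  refine ⟨G0.index, ?_, ?_⟩
  · rw [← alt_index hn]; exact Subgroup.index_dvd_of_le H.alt
  · rw [← h2, Subgroup.index_map_subtype, h1]

theorem union_subgroups {K : Type*} [Group K] (A B : Subgroup K) (h : ∀ k, k ∈ A ∨ k ∈ B) : A = ⊤ ∨ B = ⊤ := by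
  by_contra! hc
  obtain ⟨h1, h2⟩ := hc
  have : ∃ a, a ∉ A := by
    by_contra! hh; exact h1 (eq_top_iff.2 fun x _ => hh x)
  obtain ⟨a, ha⟩ := this
  have : ∃ b, b ∉ B := by
    by_contra! hh; exact h2 (eq_top_iff.2 fun x _ => hh x)
  obtain ⟨b, hb⟩ := this
  have haB := (h a).resolve_left ha
  have hbA := (h b).resolve_right hb
  rcases h (a * b) with hab | hab
  · exact ha ((Subgroup.mul_mem_cancel_right _ hbA).1 hab)
  · exact hb ((Subgroup.mul_mem_cancel_left _ haB).1 hab)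

theorem TDat.not_two (hn : 5 ≤ n) (H : TDat n K β G0 π) {c : ℕ} (hK : Nat.card K = 2 ^ c) : False := by
  obtain ⟨i, hi, hU⟩ := H.U_index hn
  obtain ⟨c', hc'⟩ : ∃ c', H.U.index = 2 ^ c' := by
    have : i = 1 ∨ i = 2 := (Nat.dvd_prime Nat.prime_two).1 hi
    rcases this with rfl | rfl
    · exact ⟨c, by rw [hU, hK, mul_one]⟩
    · exact ⟨c + 1, by rw [hU, hK, pow_succ]⟩
  rcases LemP2 hn hc' with hA | ⟨hn7, i, hfix, htc⟩
  · exact H.nt fun g hg => (hA hg).2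
  let s : Perm (Fin n) := swap ⟨0, by omega⟩ i
  have hs0 : ∀ (j : ℕ) (hj : j < n), j ≠ 0 → s ⟨j, hj⟩ ≠ i := by
    intro j hj h0 he
    have : s ⟨0, by omega⟩ = i := swap_apply_left _ _
    have := s.injective (he.trans this.symm)
    simp at this; exact h0 this
  have hsne : ∀ (j l : ℕ) (hj : j < n) (hl : l < n), j ≠ l → s ⟨j, hj⟩ ≠ s ⟨l, hl⟩ := by
    intro j l hj hl h he
    have := s.injective he
    simp at this; exact h this
  set a1 := s ⟨1, by omega⟩
  set a2 := s ⟨2, by omega⟩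
  set a3 := s ⟨3, by omega⟩
  set a4 := s ⟨4, by omega⟩
  set a5 := s ⟨5, by omega⟩
  set a6 := s ⟨6, by omega⟩
  have main : ∀ a b c : Fin n, a ≠ b → a ≠ c → b ≠ c → ∀ g ∈ G0, g i ≠ a → g i ≠ b → g i ≠ c → a ≠ i → b ≠ i → c ≠ i →
      β (tc a b c) (π g) = π g := by
    intro a b c hab hac hbc g hg ha hb hc hai hbi hci
    have hz := htc a b c hab hac hbc hai hbi hci
    have hz2 : g⁻¹ * tc a b c * g ∈ H.U := by
      have e : g⁻¹ * tc a b c * g = g⁻¹ * tc a b c * (g⁻¹)⁻¹ := by rw [inv_inv]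
      rw [e, tc_conj]
      refine htc _ _ _ (g⁻¹.injective.ne hab) (g⁻¹.injective.ne hac) (g⁻¹.injective.ne hbc) ?_ ?_ ?_
      · intro h; apply ha; rw [← h]; simp
      · intro h; apply hb; rw [← h]; simp
      · intro h; apply hc; rw [← h]; simp
    have e1 := H.coc g hg _ hz2.1
    rw [hz2.2, map_one, mul_one, show g * (g⁻¹ * tc a b c * g) = tc a b c * g by group,
      H.coc _ hz.1 g hg, hz.2, one_mul] at e1
    exact e1
  have fin : ∀ a b c : Fin n, a ≠ b → a ≠ c → b ≠ c → a ≠ i → b ≠ i → c ≠ i → (∀ k, β (tc a b c) k = k) → False := by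
    intro a b c hab hac hbc hai hbi hci hk
    have hz := htc a b c hab hac hbc hai hbi hci
    set g := tc a i b with hg
    have hgA : g ∈ G0 := H.alt (by
      rw [mem_alternatingGroup, hg]; exact (tc_three hai hab hbi.symm).sign)
    have hmem : g * tc a b c * g⁻¹ ∈ H.U := by
      refine ⟨mul_mem (mul_mem hgA hz.1) (inv_mem hgA), ?_⟩
      rw [H.coc _ (mul_mem hgA hz.1) _ (inv_mem hgA), H.coc _ hgA _ hz.1, hz.2, map_one, mul_one, map_mul, MulAut.mul_apply, hk,
        ← H.coc _ hgA _ (inv_mem hgA), mul_inv_cancel, H.one]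
    have := hfix _ hmem
    rw [tc_conj, hg, tc_a hai hab, tc_c, tc_o hac.symm hci hbc.symm, tc_a hai.symm hci.symm] at this
    exact hai this
  have e12 : a1 ≠ a2 := hsne _ _ _ _ (by norm_num)
  have e13 : a1 ≠ a3 := hsne _ _ _ _ (by norm_num)
  have e23 : a2 ≠ a3 := hsne _ _ _ _ (by norm_num)
  have e45 : a4 ≠ a5 := hsne _ _ _ _ (by norm_num)
  have e46 : a4 ≠ a6 := hsne _ _ _ _ (by norm_num)
  have e56 : a5 ≠ a6 := hsne _ _ _ _ (by norm_num)
  have f1 : a1 ≠ i := hs0 _ _ (by norm_num)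
  have f2 : a2 ≠ i := hs0 _ _ (by norm_num)
  have f3 : a3 ≠ i := hs0 _ _ (by norm_num)
  have f4 : a4 ≠ i := hs0 _ _ (by norm_num)
  have f5 : a5 ≠ i := hs0 _ _ (by norm_num)
  have f6 : a6 ≠ i := hs0 _ _ (by norm_num)
  let F : Perm (Fin n) → Subgroup K := fun z => MonoidHom.eqLocus (β z).toMonoidHom (MonoidHom.id K)
  have hun : ∀ k, k ∈ F (tc a1 a2 a3) ∨ k ∈ F (tc a4 a5 a6) := by
    intro k
    obtain ⟨g, hg, rfl⟩ := H.surj k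
    by_cases h : g i = a1 ∨ g i = a2 ∨ g i = a3
    · right
      have : g i ≠ a4 ∧ g i ≠ a5 ∧ g i ≠ a6 := by
        rcases h with h | h | h <;> rw [h] <;>
          exact ⟨hsne _ _ _ _ (by norm_num), hsne _ _ _ _ (by norm_num), hsne _ _ _ _ (by norm_num)⟩
      exact main a4 a5 a6 e45 e46 e56 g hg this.1 this.2.1 this.2.2 f4 f5 f6
    · left
      push Not at h
      exact main a1 a2 a3 e12 e13 e23 g hg h.1 h.2.1 h.2.2 f1 f2 f3
  rcases union_subgroups _ _ hun with h | h
  · refine fin a1 a2 a3 e12 e13 e23 f1 f2 f3 fun k => ?_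
    have : k ∈ F (tc a1 a2 a3) := by rw [h]; trivial
    exact this
  · refine fin a4 a5 a6 e45 e46 e56 f4 f5 f6 fun k => ?_
    have : k ∈ F (tc a4 a5 a6) := by rw [h]; trivial
    exact this

theorem TDat.inner [Finite K] (hn : 5 ≤ n) (H : TDat n K β G0 π) (g : Perm (Fin n)) (hg : g ∈ alternatingGroup (Fin n)) :
    ∃ t : K, ∀ x, β g x = t * x * t⁻¹ := by
  obtain ⟨p, g0, hp, hyp⟩ := hyp_Sn hn
  haveI := Fact.mk hp
  haveI : Finite (K ⋊[β] Perm (Fin n)) := Finite.of_equiv _ SemidirectProduct.equivProd.symm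
  set φ : K ⋊[β] Perm (Fin n) →* Perm (Fin n) := SemidirectProduct.rightHom with hφ
  have hsurj : Function.Surjective φ := SemidirectProduct.rightHom_surjective
  have hy := hyp φ SemidirectProduct.inr (fun x => by rw [hφ]; simp) (semi_min β H.simple) (by rw [semi_ker_card]; exact H.dvd)
  rcases ThmS hy with h2 | ⟨x, hx, hx1⟩
  · exfalso
    haveI : Fact (Nat.Prime 2) := ⟨Nat.prime_two⟩
    obtain ⟨c, hc⟩ := IsPGroup.iff_card.1 h2
    rw [semi_ker_card] at hc
    exact H.not_two hn hc
  · have hnz : ∀ e, ∀ y ∈ cz φ.ker, e * y * e⁻¹ ∈ cz φ.ker := by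
      intro e y hy
      refine mem_cz.2 fun z hz => ?_
      have hz' : e⁻¹ * z * e ∈ φ.ker := by
        rw [MonoidHom.mem_ker] at hz ⊢
        rw [map_mul, map_mul, hz, mul_one, ← map_mul, inv_mul_cancel, map_one]
      have := mem_cz.1 hy _ hz'
      calc e * y * e⁻¹ * z * (e * y * e⁻¹)⁻¹ = e * (y * (e⁻¹ * z * e) * y⁻¹) * e⁻¹ := by group
        _ = z := by rw [this]; group
    have hN : ((cz φ.ker).map φ).Normal := by
      constructor
      rintro _ ⟨y, hy, rfl⟩ e
      obtain ⟨e, rfl⟩ := hsurj e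
      exact ⟨e * y * e⁻¹, hnz e y hy, by simp⟩
    have hle : alternatingGroup (Fin n) ≤ (cz φ.ker).map φ := by
      apply alternatingGroup_le_of_normal (by simpa using hn)
      rw [Subgroup.nontrivial_iff_exists_ne_one]
      exact ⟨φ x, ⟨x, hx, rfl⟩, hx1⟩
    obtain ⟨y, hy, hyg⟩ := hle hg
    obtain ⟨k, g'⟩ := y
    have : g' = g := hyg
    subst this
    refine ⟨k⁻¹, fun x => ?_⟩
    rw [semi_cz β hy x, inv_inv]

theorem alt_hom_comm (hn : 5 ≤ n) {K : Type*} [Group K] (hK : ∀ x y : K, x * y = y * x) (f : alternatingGroup (Fin n) →* K) (g) : f g = 1 := by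
  have h1 : (⊤ : Subgroup (alternatingGroup (Fin n))) ≤ f.ker := by
    rw [← commutator_alternatingGroup_eq_top (by simpa using hn), commutator_def, Subgroup.commutator_le]
    intro x _ y _
    rw [MonoidHom.mem_ker, commutatorElement_def, map_mul, map_mul, map_mul, hK (f x) (f y)]
    simp
  exact h1 trivial

theorem ThmT [Finite K] (hn : 5 ≤ n) (H : TDat n K β G0 π) : ∃ θ η : alternatingGroup (Fin n) →* K,
    (∀ g : alternatingGroup (Fin n), ∀ x, β g x = θ g * x * (θ g)⁻¹) ∧
    (∀ g : alternatingGroup (Fin n), π g = η g * (θ g)⁻¹) := by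
  have hin := H.inner hn
  rcases H.simple (Subgroup.center K) inferInstance (by
    intro g x hx
    rw [Subgroup.mem_center_iff] at hx ⊢
    intro y
    have := hx ((β g).symm y)
    have := congrArg (β g) this
    simpa using this) with hc | hc
  · choose t ht using fun g : alternatingGroup (Fin n) => hin g g.2
    have huniq : ∀ s s' : K, (∀ x, s * x * s⁻¹ = s' * x * s'⁻¹) → s = s' := by
      intro s s' h
      have : s'⁻¹ * s ∈ Subgroup.center K := by
        rw [Subgroup.mem_center_iff]
        intro y
        calc y * (s'⁻¹ * s) = s'⁻¹ * (s' * y * s'⁻¹) * s := by group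
          _ = s'⁻¹ * (s * y * s⁻¹) * s := by rw [h]
          _ = _ := by group
      rw [hc, Subgroup.mem_bot] at this
      exact (inv_mul_eq_one.1 this).symm
    let θ : alternatingGroup (Fin n) →* K := MonoidHom.mk' t (by
      intro g h
      apply huniq
      intro x
      rw [← ht, Subgroup.coe_mul, map_mul, MulAut.mul_apply, ht, ht]; group)
    have hθ : ∀ g : alternatingGroup (Fin n), ∀ x, β g x = θ g * x * (θ g)⁻¹ := ht
    let η : alternatingGroup (Fin n) →* K := MonoidHom.mk' (fun g => π g * θ g) (by
      intro g h
      rw [Subgroup.coe_mul, H.coc _ (H.alt g.2) _ (H.alt h.2), hθ, map_mul]; group)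
    refine ⟨θ, η, hθ, fun g => ?_⟩
    show π g = π g * θ g * (θ g)⁻¹
    group
  · exfalso
    have hcomm : ∀ x y : K, x * y = y * x := by
      intro x y
      have : y ∈ Subgroup.center K := by rw [hc]; trivial
      exact Subgroup.mem_center_iff.1 this x
    have hb : ∀ g ∈ alternatingGroup (Fin n), ∀ x, β g x = x := by
      intro g hg x
      obtain ⟨t, ht⟩ := hin g hg
      rw [ht, hcomm t x]; group
    let f : alternatingGroup (Fin n) →* K := MonoidHom.mk' (fun g => π g) (by
      intro g h
      rw [Subgroup.coe_mul, H.coc _ (H.alt g.2) _ (H.alt h.2), hb _ g.2])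
    exact H.nt fun g hg => alt_hom_comm hn hcomm f ⟨g, hg⟩
end HG

namespace HG
open Equiv Equiv.Perm
variable {n : ℕ}

/-- regular cocycle datum -/
structure Dat (n : ℕ) (P : Type) [Group P] (β : Perm (Fin n) →* MulAut P) (G0 : Subgroup (Perm (Fin n))) (π : Perm (Fin n) → P) : Prop where
  alt : alternatingGroup (Fin n) ≤ G0
  coc : ∀ g ∈ G0, ∀ h ∈ G0, π (g * h) = π g * β g (π h)
  inj : ∀ g ∈ G0, ∀ h ∈ G0, π g = π h → g = h
  surj : ∀ k, ∃ g ∈ G0, π g = k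

section
variable {P : Type} [Group P] {β : Perm (Fin n) →* MulAut P} {G0 : Subgroup (Perm (Fin n))} {π : Perm (Fin n) → P}

theorem Dat.card (H : Dat n P β G0 π) : Nat.card G0 = Nat.card P := by
  apply Nat.card_congr
  refine Equiv.ofBijective (fun g : G0 => π g) ⟨fun g h e => Subtype.ext (H.inj _ g.2 _ h.2 e), fun k => ?_⟩
  obtain ⟨g, hg, e⟩ := H.surj k
  exact ⟨⟨g, hg⟩, e⟩

theorem Dat.finite (H : Dat n P β G0 π) : Finite P := by
  have : 0 < Nat.card P := by rw [← H.card]; exact Nat.card_pos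
  exact (Nat.card_pos_iff.1 this).2

theorem card_perm_fin : Nat.card (Perm (Fin n)) = n.factorial := by
  rw [Nat.card_perm]; simp

theorem alt_card (hn : 5 ≤ n) : 2 * Nat.card (alternatingGroup (Fin n)) = n.factorial := by
  have := Subgroup.index_mul_card (alternatingGroup (Fin n))
  rw [alt_index hn, card_perm_fin] at this
  exact this

theorem exists_max [Finite P] [Nontrivial P] (β : Perm (Fin n) →* MulAut P) : ∃ M : Subgroup P, M.Normal ∧ (∀ g, ∀ x ∈ M, β g x ∈ M) ∧ M ≠ ⊤ ∧
    ∀ L : Subgroup P, L.Normal → (∀ g, ∀ x ∈ L, β g x ∈ L) → M ≤ L → L = M ∨ L = ⊤ := by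
  let s : Set (Subgroup P) := {M | M.Normal ∧ (∀ g, ∀ x ∈ M, β g x ∈ M) ∧ M ≠ ⊤}
  have hs : s.Nonempty := ⟨⊥, inferInstance, by intro g x hx; rw [Subgroup.mem_bot] at hx ⊢; rw [hx, map_one], bot_ne_top⟩
  obtain ⟨M, hM⟩ := (Set.toFinite s).exists_maximal hs
  refine ⟨M, hM.1.1, hM.1.2.1, hM.1.2.2, fun L h1 h2 h3 => ?_⟩
  by_contra! hc
  exact hc.1 (le_antisymm (hM.2 ⟨h1, h2, hc.2⟩ h3) h3)

theorem quot_aut (M : Subgroup P) [M.Normal] (hM : ∀ g, ∀ x ∈ M, β g x ∈ M) :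
    ∃ β' : Perm (Fin n) →* MulAut (P ⧸ M), ∀ g x, β' g (QuotientGroup.mk' M x) = QuotientGroup.mk' M (β g x) := by
  have hmap : ∀ g, M.map (β g).toMonoidHom = M := by
    intro g
    apply le_antisymm
    · rintro _ ⟨x, hx, rfl⟩; exact hM g x hx
    · intro x hx
      refine ⟨β g⁻¹ x, hM _ _ hx, ?_⟩
      show (β g * β g⁻¹) x = x
      rw [← map_mul, mul_inv_cancel, map_one]; rfl
  refine ⟨MonoidHom.mk' (fun g => QuotientGroup.congr M M (β g) (hmap g)) ?_, fun g x => rfl⟩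
  intro g h
  ext x
  obtain ⟨x, rfl⟩ := QuotientGroup.mk'_surjective M x
  show QuotientGroup.mk' M (β (g * h) x) = QuotientGroup.mk' M (β g (β h x))
  rw [map_mul]; rfl

theorem Dat.quot (hn : 5 ≤ n) (H : Dat n P β G0 π) : ∃ M : Subgroup P, M.Normal ∧ (∀ g, ∀ x ∈ M, β g x ∈ M) ∧ M ≠ ⊤ ∧
    ((∀ g ∈ alternatingGroup (Fin n), π g ∈ M) ∨
      ∃ (_ : M.Normal) (θ η : alternatingGroup (Fin n) →* P ⧸ M),
        (∀ g : alternatingGroup (Fin n), ∀ x, QuotientGroup.mk' M (β g x) = θ g * QuotientGroup.mk' M x * (θ g)⁻¹) ∧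
        (∀ g : alternatingGroup (Fin n), QuotientGroup.mk' M (π g) = η g * (θ g)⁻¹)) := by
  haveI := H.finite
  haveI : Nontrivial P := by
    rw [← Finite.one_lt_card_iff_nontrivial, ← H.card]
    have h1 := Nat.le_of_dvd Nat.card_pos (Subgroup.card_dvd_of_le H.alt)
    have h2 := alt_card hn
    have h3 : Nat.factorial 5 ≤ n.factorial := Nat.factorial_le hn
    have : Nat.factorial 5 = 120 := by decide
    omega
  obtain ⟨M, hMn, hMi, hMt, hmax⟩ := exists_max β
  refine ⟨M, hMn, hMi, hMt, ?_⟩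
  by_cases hnt : ∀ g ∈ alternatingGroup (Fin n), π g ∈ M
  · exact Or.inl hnt
  right
  obtain ⟨β', hβ'⟩ := quot_aut M hMi
  have T : TDat n (P ⧸ M) β' G0 (fun g => QuotientGroup.mk' M (π g)) := by
    constructor
    · intro L hL hi
      have h1 : (L.comap (QuotientGroup.mk' M)).Normal := inferInstance
      have h2 : ∀ g, ∀ x ∈ L.comap (QuotientGroup.mk' M), β g x ∈ L.comap (QuotientGroup.mk' M) := by
        intro g x hx
        rw [Subgroup.mem_comap] at hx ⊢
        rw [← hβ']; exact hi g _ hx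
      have h3 : M ≤ L.comap (QuotientGroup.mk' M) := by
        intro x hx
        rw [Subgroup.mem_comap, (QuotientGroup.eq_one_iff x).2 hx |> (fun h => (h : QuotientGroup.mk' M x = 1))]
        exact one_mem _
      rcases hmax _ h1 h2 h3 with h | h
      · left
        rw [eq_bot_iff]
        intro x hx
        obtain ⟨x, rfl⟩ := QuotientGroup.mk'_surjective M x
        have : x ∈ L.comap (QuotientGroup.mk' M) := hx
        rw [h] at this
        exact (QuotientGroup.eq_one_iff x).2 this
      · right
        rw [eq_top_iff]
        intro x _
        obtain ⟨x, rfl⟩ := QuotientGroup.mk'_surjective M x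
        have : x ∈ (⊤ : Subgroup P) := trivial
        rw [← h] at this
        exact this
    · exact H.alt
    · intro g hg h hh
      show QuotientGroup.mk' M (π (g * h)) = _
      rw [H.coc g hg h hh, map_mul, hβ']
    · intro k
      obtain ⟨x, rfl⟩ := QuotientGroup.mk'_surjective M k
      obtain ⟨g, hg, rfl⟩ := H.surj x
      exact ⟨g, hg, rfl⟩
    · refine (Subgroup.card_quotient_dvd_card M).trans ?_
      rw [← H.card, ← card_perm_fin]
      exact Subgroup.card_subgroup_dvd_card G0
    · intro h
      exact hnt fun g hg => (QuotientGroup.eq_one_iff _).1 (h g hg)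
  obtain ⟨θ, η, h1, h2⟩ := ThmT hn T
  exact ⟨hMn, θ, η, fun g x => by rw [← hβ', h1], h2⟩
end

theorem alt_hom (hn : 5 ≤ n) {K : Type*} [Group K] (f : alternatingGroup (Fin n) →* K) : (∀ g, f g = 1) ∨ Function.Injective f := by
  haveI : IsSimpleGroup (alternatingGroup (Fin n)) := alternatingGroup.isSimpleGroup (by simpa using hn)
  rcases (inferInstance : f.ker.Normal).eq_bot_or_eq_top with h | h
  · right; exact (MonoidHom.ker_eq_bot_iff f).1 h
  · left; intro g
    have : g ∈ (⊤ : Subgroup (alternatingGroup (Fin n))) := trivial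
    rw [← h] at this; exact this

theorem fixpt (hn : 5 ≤ n) (hn6 : n ≠ 6) {K : Type*} [Group K] [Finite K] (θ η : alternatingGroup (Fin n) →* K) (hθ : Function.Injective θ)
    (hη : Function.Injective η) (hc : Nat.card K ≤ Nat.card (alternatingGroup (Fin n))) :
    ∃ k : K, ∃ g : alternatingGroup (Fin n), g ≠ 1 ∧ g * g ≠ 1 ∧ η g * k = k * θ g := by
  have hc1 : Nat.card K = Nat.card (alternatingGroup (Fin n)) := le_antisymm hc (Nat.card_le_card_of_injective θ hθ)
  have bθ : Function.Bijective θ := (Nat.bijective_iff_injective_and_card θ).2 ⟨hθ, hc1.symm⟩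
  have bη : Function.Bijective η := (Nat.bijective_iff_injective_and_card η).2 ⟨hη, hc1.symm⟩
  let eθ := MulEquiv.ofBijective θ bθ
  let eη := MulEquiv.ofBijective η bη
  obtain ⟨σ, hσ⟩ := AutAn hn hn6 (eη.trans eθ.symm)
  have h1 : ∀ g, η g = θ ((eη.trans eθ.symm) g) := fun g => (eθ.apply_symm_apply (eη g)).symm
  let z : Fin n := ⟨0, by omega⟩
  let o : Fin n := ⟨1, by omega⟩
  let a : Fin n := ⟨2, by omega⟩
  let b : Fin n := ⟨3, by omega⟩
  let c : Fin n := ⟨4, by omega⟩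
  have hab : a ≠ b := by simp [a, b]
  have hac : a ≠ c := by simp [a, c]
  have hbc : b ≠ c := by simp [b, c]
  have h3 := tc_three hab hac hbc
  have ho : orderOf (tc a b c) = 3 := h3.orderOf
  let g : alternatingGroup (Fin n) := ⟨tc a b c, mem_alternatingGroup.2 h3.sign⟩
  have hg1 : g ≠ 1 := by
    intro h
    have : tc a b c = 1 := Subtype.ext_iff.1 h
    rw [this, orderOf_one] at ho; omega
  have hg2 : g * g ≠ 1 := by
    intro h
    have h : tc a b c * tc a b c = 1 := Subtype.ext_iff.1 h
    rw [← pow_two] at h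
    have := orderOf_dvd_of_pow_eq_one h
    rw [ho] at this; omega
  have hcomm : swap z o * tc a b c = tc a b c * swap z o := by
    have := tc_conj (swap z o) a b c
    rw [swap_apply_of_ne_of_ne (by simp [a, z]) (by simp [a, o]), swap_apply_of_ne_of_ne (by simp [b, z]) (by simp [b, o]), swap_apply_of_ne_of_ne (by simp [c, z]) (by simp [c, o])] at this
    exact mul_inv_eq_iff_eq_mul.1 this
  have key : ∀ τ : Perm (Fin n), τ * tc a b c = tc a b c * τ → ∀ hk : σ * τ ∈ alternatingGroup (Fin n), η g * θ ⟨σ * τ, hk⟩ = θ ⟨σ * τ, hk⟩ * θ g := by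
    intro τ hτ hk
    rw [h1, ← map_mul, ← map_mul]
    congr 1
    apply Subtype.ext
    rw [Subgroup.coe_mul, Subgroup.coe_mul, hσ]
    show σ * tc a b c * σ⁻¹ * (σ * τ) = σ * τ * tc a b c
    rw [mul_assoc σ τ, hτ]; group
  rcases Int.units_eq_one_or (sign σ) with hs | hs
  · exact ⟨_, g, hg1, hg2, key 1 (by simp) (by rw [mul_one]; exact hs)⟩
  · refine ⟨_, g, hg1, hg2, key (swap z o) hcomm ?_⟩
    rw [mem_alternatingGroup, Perm.sign_mul, hs, sign_swap (by simp [z, o])]; rfl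

theorem alt_center (hn : 5 ≤ n) {K : Type*} [Group K] (θ : alternatingGroup (Fin n) →* K) (hθ : Function.Bijective θ) : Subgroup.center K = ⊥ := by
  rw [eq_bot_iff]
  intro x hx
  obtain ⟨g, rfl⟩ := hθ.2 x
  have : g ∈ Subgroup.center (alternatingGroup (Fin n)) := by
    rw [Subgroup.mem_center_iff]
    intro h
    apply hθ.1
    rw [map_mul, map_mul]
    exact Subgroup.mem_center_iff.1 hx _
  rw [alternatingGroup.center_eq_bot (by simp; omega), Subgroup.mem_bot] at this
  rw [this, map_one, Subgroup.mem_bot]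

section
variable {P : Type} [Group P] {β : Perm (Fin n) →* MulAut P} {π : Perm (Fin n) → P}

theorem Dat.caseI (hn : 5 ≤ n) (hn6 : n ≠ 6) (H : Dat n P β (alternatingGroup (Fin n)) π) : Subgroup.center P = ⊥ ∧
    ((∀ g ∈ alternatingGroup (Fin n), ∀ x, β g x = x) ∨ (∀ g ∈ alternatingGroup (Fin n), ∀ x, β g x = (π g)⁻¹ * x * π g)) := by
  haveI := H.finite
  obtain ⟨M, hMn, hMi, hMt, h | ⟨_, θ, η, hθ, hη⟩⟩ := H.quot hn
  · exfalso
    apply hMt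
    rw [eq_top_iff]
    intro x _
    obtain ⟨g, hg, rfl⟩ := H.surj x
    exact h g hg
  have hcard : Nat.card (P ⧸ M) * Nat.card M = Nat.card (alternatingGroup (Fin n)) := by
    rw [← Subgroup.card_eq_card_quotient_mul_card_subgroup, H.card]
  have hMpos : 0 < Nat.card M := Nat.card_pos
  have hinj : Function.Injective θ ∨ Function.Injective η := by
    by_contra! hc
    have h1 := (alt_hom hn θ).resolve_right hc.1
    have h2 := (alt_hom hn η).resolve_right hc.2
    apply hMt
    rw [eq_top_iff]
    intro x _
    obtain ⟨g, hg, rfl⟩ := H.surj x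
    have := hη ⟨g, hg⟩
    rw [h1, h2, inv_one, mul_one] at this
    exact (QuotientGroup.eq_one_iff _).1 this
  have hle : Nat.card (alternatingGroup (Fin n)) ≤ Nat.card (P ⧸ M) := by
    rcases hinj with h | h
    · exact Nat.card_le_card_of_injective _ h
    · exact Nat.card_le_card_of_injective _ h
  have hKpos : 0 < Nat.card (P ⧸ M) := Nat.card_pos
  have hM1 : Nat.card M = 1 := by nlinarith
  have hMb : M = ⊥ := Subgroup.card_eq_one.1 hM1
  rw [hM1, mul_one] at hcard
  have mkinj : Function.Injective (QuotientGroup.mk' M) := by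
    rw [← MonoidHom.ker_eq_bot_iff, QuotientGroup.ker_mk', hMb]
  have hcen : Subgroup.center (P ⧸ M) = ⊥ := by
    rcases hinj with h | h
    · exact alt_center hn θ ((Nat.bijective_iff_injective_and_card _).2 ⟨h, hcard.symm⟩)
    · exact alt_center hn η ((Nat.bijective_iff_injective_and_card _).2 ⟨h, hcard.symm⟩)
  refine ⟨?_, ?_⟩
  · rw [eq_bot_iff]
    intro x hx
    have : QuotientGroup.mk' M x ∈ Subgroup.center (P ⧸ M) := by
      rw [Subgroup.mem_center_iff]
      intro y
      obtain ⟨y, rfl⟩ := QuotientGroup.mk'_surjective M y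
      rw [← map_mul, ← map_mul, Subgroup.mem_center_iff.1 hx]
    rw [hcen, Subgroup.mem_bot] at this
    rw [Subgroup.mem_bot]
    exact mkinj (this.trans (map_one _).symm)
  · rcases alt_hom hn θ with h1 | h1
    · left
      intro g hg x
      apply mkinj
      rw [hθ ⟨g, hg⟩, h1]; group
    · rcases alt_hom hn η with h2 | h2
      · right
        intro g hg x
        apply mkinj
        rw [hθ ⟨g, hg⟩, map_mul, map_mul, map_inv, hη ⟨g, hg⟩, h2]; group
      · exfalso
        obtain ⟨k, g, hg1, _, hk⟩ := fixpt hn hn6 θ η h1 h2 hcard.le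
        obtain ⟨k, rfl⟩ := QuotientGroup.mk'_surjective M k
        obtain ⟨h, hh, rfl⟩ := H.surj k
        have : π (g * h) = π h := by
          apply mkinj
          rw [H.coc _ g.2 _ hh, map_mul, hθ, hη]
          calc _ = (η g * QuotientGroup.mk' M (π h)) * (θ g)⁻¹ := by group
            _ = _ := by rw [hk]; group
        have := H.inj _ (mul_mem g.2 hh) _ hh this
        apply hg1
        apply Subtype.ext
        simpa using this

theorem ext_triv {N : Type*} [Group N] (H0 : Subgroup N) (hi : H0.index = 2) (hc : ∀ x ∈ H0, (∀ y ∈ H0, y * x = x * y) → x = 1) (α : MulAut N)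
    (hα : ∀ x ∈ H0, α x = x) (y : N) : α y = y := by
  haveI := Subgroup.normal_of_index_eq_two hi
  by_cases hy : y ∈ H0
  · exact hα y hy
  have hαy : α y ∉ H0 := by
    intro h
    have : α (α y) = α y := hα _ h
    exact hy (by rw [← α.injective this]; exact h)
  have hz : y⁻¹ * α y ∈ H0 := by
    rw [Subgroup.mul_mem_iff_of_index_two hi, inv_mem_iff]
    exact iff_of_false hy hαy
  have := hc _ hz (by
    intro x hx
    have h1 : α (y * x * y⁻¹) = y * x * y⁻¹ := hα _ (Subgroup.Normal.conj_mem inferInstance x hx y)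
    rw [map_mul, map_mul, map_inv, hα x hx] at h1
    calc x * (y⁻¹ * α y) = y⁻¹ * (y * x * y⁻¹) * α y := by group
      _ = _ := by rw [← h1]; group)
  exact (inv_mul_eq_one.1 this).symm

theorem perf_triv {N : Type*} [Group N] (hN : commutator N = ⊤) (M : Subgroup N) (hM : ∀ m ∈ M, ∀ x, x * m = m * x) (α : MulAut N)
    (hα : ∀ x, x⁻¹ * α x ∈ M) (y : N) : α y = y := by
  have : commutator N ≤ MonoidHom.eqLocus α.toMonoidHom (MonoidHom.id N) := by
    rw [commutator_def, Subgroup.commutator_le]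
    intro x _ y _
    show α _ = _
    obtain ⟨m, hm, hx⟩ : ∃ m ∈ M, α x = x * m := ⟨_, hα x, by group⟩
    obtain ⟨m', hm', hy⟩ : ∃ m ∈ M, α y = y * m := ⟨_, hα y, by group⟩
    rw [commutatorElement_def, map_mul, map_mul, map_mul, map_inv, map_inv, hx, hy]
    have c1 := hM m hm
    have c2 := hM m' hm'
    calc x * m * (y * m') * (x * m)⁻¹ * (y * m')⁻¹ = x * (m * (y * m')) * m⁻¹ * x⁻¹ * m'⁻¹ * y⁻¹ := by group
      _ = x * y * (m' * x⁻¹) * m'⁻¹ * y⁻¹ := by rw [← c1]; group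
      _ = x * y * x⁻¹ * y⁻¹ := by rw [← c2]; group
  rw [hN] at this
  exact this (Subgroup.mem_top y)
end
end HG

namespace HG
open Equiv Equiv.Perm
variable {n : ℕ}

section
variable {N : Type} [Group N] {β : Perm (Fin n) →* MulAut N} {π : Perm (Fin n) → N}

theorem sub_aut (H0 : Subgroup N) (hi : ∀ g, ∀ x ∈ H0, β g x ∈ H0) :
    ∃ β' : Perm (Fin n) →* MulAut H0, ∀ g x, ((β' g x : H0) : N) = β g x := by
  refine ⟨MonoidHom.mk' (fun g =>
    { toFun := fun x => ⟨β g x, hi g x x.2⟩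
      invFun := fun x => ⟨β g⁻¹ x, hi g⁻¹ x x.2⟩
      left_inv := fun x => Subtype.ext (by
        show (β g⁻¹ * β g) (x : N) = x
        rw [← map_mul, inv_mul_cancel, map_one]; rfl)
      right_inv := fun x => Subtype.ext (by
        show (β g * β g⁻¹) (x : N) = x
        rw [← map_mul, mul_inv_cancel, map_one]; rfl)
      map_mul' := fun x y => Subtype.ext (by
        show β g ((x * y : H0) : N) = β g x * β g y
        rw [Subgroup.coe_mul, map_mul]) }) ?_, fun g x => rfl⟩
  intro g h
  ext x
  show β (g * h) (x : N) = β g (β h x)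
  rw [map_mul]; rfl

/-- Case I in N -/
theorem caseI' (hn : 5 ≤ n) (hn6 : n ≠ 6) (H : Dat n N β ⊤ π) (H0 : Subgroup N) (hi : H0.index = 2) (hinv : ∀ g, ∀ x ∈ H0, β g x ∈ H0) :
    (∀ g ∈ alternatingGroup (Fin n), ∀ x, β g x = x) ∨ (∀ g ∈ alternatingGroup (Fin n), ∀ x, β g x = (π g)⁻¹ * x * π g) := by
  classical
  haveI := H.finite
  haveI : Nontrivial (Fin n) := Fin.nontrivial_iff_two_le.2 (by omega)
  have coc : ∀ g h, π (g * h) = π g * β g (π h) := fun g h => H.coc g trivial h trivial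
  have one : π 1 = 1 := by have := coc 1 1; simpa using this
  obtain ⟨β', hβ'⟩ := sub_aut H0 hinv
  let G0 : Subgroup (Perm (Fin n)) :=
    { carrier := {g | π g ∈ H0}
      one_mem' := by show π 1 ∈ H0; rw [one]; exact one_mem _
      mul_mem' := by
        intro g h hg hh
        show π (g * h) ∈ H0
        rw [coc]; exact mul_mem hg (hinv _ _ hh)
      inv_mem' := by
        intro g hg
        show π g⁻¹ ∈ H0
        have := coc g⁻¹ g
        rw [inv_mul_cancel, one] at this
        rw [eq_inv_of_mul_eq_one_left this.symm]
        exact inv_mem (hinv _ _ hg) }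
  have hmem : ∀ g, g ∈ G0 ↔ π g ∈ H0 := fun g => Iff.rfl
  have hG0c : Nat.card G0 = Nat.card H0 := by
    apply Nat.card_congr
    refine Equiv.ofBijective (fun g : G0 => (⟨π g, g.2⟩ : H0)) ⟨fun g h e => Subtype.ext (H.inj _ trivial _ trivial (Subtype.ext_iff.1 e)), fun k => ?_⟩
    obtain ⟨g, hg, e⟩ := H.surj k
    exact ⟨⟨g, (hmem g).2 (e ▸ k.2)⟩, Subtype.ext e⟩
  have hG0i : G0.index = 2 := by
    have h1 := Subgroup.index_mul_card G0
    have h2 := Subgroup.index_mul_card H0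
    have h3 := H.card
    rw [Subgroup.card_top] at h3
    have h4 : 0 < Nat.card H0 := Nat.card_pos
    rw [hi, ← h3, ← h1, hG0c] at h2
    exact (Nat.eq_of_mul_eq_mul_right h4 h2).symm
  have hG0 : G0 = alternatingGroup (Fin n) := eq_alternatingGroup_of_index_eq_two hG0i
  have hA : ∀ g, g ∈ alternatingGroup (Fin n) ↔ π g ∈ H0 := fun g => by rw [← hG0]; exact hmem g
  let π' : Perm (Fin n) → H0 := fun g => if h : π g ∈ H0 then ⟨π g, h⟩ else 1
  have hπ' : ∀ g ∈ alternatingGroup (Fin n), ((π' g : H0) : N) = π g := by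
    intro g hg
    simp only [π', dif_pos ((hA g).1 hg)]
  have D : Dat n H0 β' (alternatingGroup (Fin n)) π' := by
    constructor
    · exact le_rfl
    · intro g hg h hh
      apply Subtype.ext
      rw [hπ' _ (mul_mem hg hh), Subgroup.coe_mul, hβ', hπ' _ hg, hπ' _ hh, coc]
    · intro g hg h hh e
      have := Subtype.ext_iff.1 e
      rw [hπ' _ hg, hπ' _ hh] at this
      exact H.inj _ trivial _ trivial this
    · intro k
      obtain ⟨g, _, e⟩ := H.surj k
      have hg : g ∈ alternatingGroup (Fin n) := (hA g).2 (e ▸ k.2)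
      exact ⟨g, hg, Subtype.ext (by rw [hπ' _ hg, e])⟩
  obtain ⟨hc, h⟩ := D.caseI hn hn6
  have hc' : ∀ x ∈ H0, (∀ y ∈ H0, y * x = x * y) → x = 1 := by
    intro x hx hy
    have : (⟨x, hx⟩ : H0) ∈ Subgroup.center H0 := Subgroup.mem_center_iff.2 fun y => Subtype.ext (hy y y.2)
    rw [hc, Subgroup.mem_bot] at this
    exact Subtype.ext_iff.1 this
  rcases h with h | h
  · left
    intro g hg
    apply ext_triv H0 hi hc'
    intro x hx
    have := Subtype.ext_iff.1 (h g hg ⟨x, hx⟩)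
    rwa [hβ'] at this
  · right
    intro g hg x
    have key : ∀ y, (MulAut.conj (π g) * β g) y = y := by
      apply ext_triv H0 hi hc'
      intro x hx
      have := Subtype.ext_iff.1 (h g hg ⟨x, hx⟩)
      rw [hβ', Subgroup.coe_mul, Subgroup.coe_mul, Subgroup.coe_inv, hπ' _ hg] at this
      rw [MulAut.mul_apply, this, MulAut.conj_apply]; group
    have := key x
    rw [MulAut.mul_apply, MulAut.conj_apply] at this
    calc β g x = (π g)⁻¹ * (π g * β g x * (π g)⁻¹) * π g := by group
      _ = _ := by rw [this]

theorem comm_char (g) (x : N) (hx : x ∈ commutator N) : β g x ∈ commutator N := by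
  have : (commutator N).Characteristic := inferInstance
  have h := this.fixed (β g)
  have : x ∈ (commutator N).comap (β g).toMonoidHom := by rw [h]; exact hx
  exact this

theorem comm_le_of_index_two {H0 : Subgroup N} (hi : H0.index = 2) : commutator N ≤ H0 := by
  haveI := Subgroup.normal_of_index_eq_two hi
  rw [commutator_def, Subgroup.commutator_le]
  intro x _ y _
  rw [commutatorElement_def, Subgroup.mul_mem_iff_of_index_two hi, Subgroup.mul_mem_iff_of_index_two hi, Subgroup.mul_mem_iff_of_index_two hi, inv_mem_iff, inv_mem_iff]
  tauto

theorem range_le_comm (hn : 5 ≤ n) {K : Type*} [Group K] (χ : alternatingGroup (Fin n) →* K) : χ.range ≤ commutator K := by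
  have h1 : (⊤ : Subgroup (alternatingGroup (Fin n))) ≤ (commutator K).comap χ := by
    rw [← commutator_alternatingGroup_eq_top (by simpa using hn), commutator_def, Subgroup.commutator_le]
    intro x _ y _
    rw [Subgroup.mem_comap, commutatorElement_def, map_mul, map_mul, map_mul, map_inv, map_inv, ← commutatorElement_def, commutator_def]
    exact Subgroup.commutator_mem_commutator trivial trivial
  rintro _ ⟨x, rfl⟩
  exact h1 (Subgroup.mem_top x)

/-- Case II -/
theorem caseII (hn : 5 ≤ n) (hn6 : n ≠ 6) (H : Dat n N β ⊤ π)
    (hno : ∀ H0 : Subgroup N, H0.index = 2 → (∀ g, ∀ x ∈ H0, β g x ∈ H0) → False) :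
    (∀ g ∈ alternatingGroup (Fin n), ∀ x, β g x = x) ∨ (∀ g ∈ alternatingGroup (Fin n), ∀ x, β g x = (π g)⁻¹ * x * π g) := by
  haveI := H.finite
  have coc : ∀ g h, π (g * h) = π g * β g (π h) := fun g h => H.coc g trivial h trivial
  have hcN : Nat.card N = 2 * Nat.card (alternatingGroup (Fin n)) := by
    rw [alt_card hn, ← H.card, Subgroup.card_top, card_perm_fin]
  have hApos : 0 < Nat.card (alternatingGroup (Fin n)) := Nat.card_pos
  obtain ⟨M, hMn, hMi, hMt, h⟩ := H.quot hn
  have hcard : Nat.card (N ⧸ M) * Nat.card M = 2 * Nat.card (alternatingGroup (Fin n)) := by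
    rw [← Subgroup.card_eq_card_quotient_mul_card_subgroup, hcN]
  have hMpos : 0 < Nat.card M := Nat.card_pos
  have hKpos : 0 < Nat.card (N ⧸ M) := Nat.card_pos
  have hn1 : ¬ ∀ g ∈ alternatingGroup (Fin n), π g ∈ M := by
    intro h
    have h1 : Nat.card (alternatingGroup (Fin n)) ≤ Nat.card M :=
      Nat.card_le_card_of_injective (fun g : alternatingGroup (Fin n) => (⟨π g, h g g.2⟩ : M))
        fun g h e => Subtype.ext (H.inj _ trivial _ trivial (Subtype.ext_iff.1 e))
    have h2 : Nat.card (N ⧸ M) ≤ 2 := by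
      by_contra! hc
      nlinarith
    have h3 : Nat.card (N ⧸ M) ≠ 1 := by
      intro h; exact hMt (Subgroup.index_eq_one.1 h)
    refine hno M ?_ hMi
    show Nat.card (N ⧸ M) = 2
    omega
  rcases h with h | ⟨_, θ, η, hθ, hη⟩
  · exact absurd h hn1
  obtain ⟨χ, hχ⟩ : ∃ χ : alternatingGroup (Fin n) →* N ⧸ M, Function.Injective χ := by
    by_contra! hc
    have h1 := (alt_hom hn θ).resolve_right (hc _)
    have h2 := (alt_hom hn η).resolve_right (hc _)
    apply hn1
    intro g hg
    have := hη ⟨g, hg⟩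
    rw [h1, h2, inv_one, mul_one] at this
    exact (QuotientGroup.eq_one_iff _).1 this
  have hle : Nat.card (alternatingGroup (Fin n)) ≤ Nat.card (N ⧸ M) := Nat.card_le_card_of_injective _ hχ
  have hM2 : Nat.card M ≤ 2 := by
    by_contra! hc
    nlinarith
  have hM2' : Nat.card M = 2 := by
    by_contra hne
    have hM1 : Nat.card M = 1 := by omega
    rw [hM1, mul_one] at hcard
    have hMb : M = ⊥ := Subgroup.card_eq_one.1 hM1
    have mkinj : Function.Injective (QuotientGroup.mk' M) := by
      rw [← MonoidHom.ker_eq_bot_iff, QuotientGroup.ker_mk', hMb]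
    let e : N ≃* N ⧸ M := MulEquiv.ofBijective (QuotientGroup.mk' M) ⟨mkinj, QuotientGroup.mk'_surjective M⟩
    let χ' : alternatingGroup (Fin n) →* N := e.symm.toMonoidHom.comp χ
    have hχ' : Function.Injective χ' := e.symm.injective.comp hχ
    have hr : Nat.card χ'.range = Nat.card (alternatingGroup (Fin n)) := (Nat.card_congr (MonoidHom.ofInjective hχ').toEquiv).symm
    have hi : χ'.range.index = 2 := by
      have := Subgroup.index_mul_card χ'.range
      rw [hr, hcN] at this
      exact Nat.eq_of_mul_eq_mul_right hApos this
    have he : χ'.range = commutator N := le_antisymm (range_le_comm hn χ') (comm_le_of_index_two hi)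
    refine hno _ hi ?_
    rw [he]
    exact comm_char
  have hKA : Nat.card (N ⧸ M) = Nat.card (alternatingGroup (Fin n)) := by
    rw [hM2'] at hcard; omega
  have hMc : ∀ m ∈ M, ∀ x, x * m = m * x := by
    intro m hm x
    by_cases h1 : m = 1
    · rw [h1]; simp
    have h2 : ∀ z ∈ M, z ≠ 1 → z = m := by
      intro z hz hz1
      obtain ⟨a, b, hab, huniv⟩ := Nat.card_eq_two_iff.1 hM2'
      have q : ∀ w : M, w = a ∨ w = b := fun w => by
        have : w ∈ (Set.univ : Set M) := trivial
        rw [← huniv] at this; exact this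
      have q1 := q ⟨z, hz⟩
      have q2 := q ⟨m, hm⟩
      have q3 := q 1
      have r1 : (⟨z, hz⟩ : M) ≠ 1 := fun h => hz1 (Subtype.ext_iff.1 h)
      have r2 : (⟨m, hm⟩ : M) ≠ 1 := fun h => h1 (Subtype.ext_iff.1 h)
      have : (⟨z, hz⟩ : M) = ⟨m, hm⟩ := by
        rcases q1 with q1 | q1 <;> rcases q2 with q2 | q2 <;> rcases q3 with q3 | q3 <;> simp_all
      exact Subtype.ext_iff.1 this
    have := h2 (x * m * x⁻¹) (hMn.conj_mem m hm x) (by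
      intro h; apply h1; exact conj_eq_one_iff.1 h)
    exact mul_inv_eq_iff_eq_mul.1 this
  have bχ : Function.Bijective χ := (Nat.bijective_iff_injective_and_card _).2 ⟨hχ, hKA.symm⟩
  have hperf : commutator N = ⊤ := by
    by_contra hne
    have h1 : (commutator N).index ≠ 1 := fun h => hne (Subgroup.index_eq_one.1 h)
    have hK : commutator (N ⧸ M) = ⊤ := by
      rw [eq_top_iff, ← MonoidHom.range_eq_top.2 bχ.2]
      exact range_le_comm hn χ
    have hmap : (commutator N).map (QuotientGroup.mk' M) = ⊤ := by
      rw [commutator_def, Subgroup.map_commutator, ← MonoidHom.range_eq_map, MonoidHom.range_eq_top.2 (QuotientGroup.mk'_surjective M)]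
      exact hK
    have h2 : Nat.card (alternatingGroup (Fin n)) ∣ Nat.card (commutator N) := by
      rw [← hKA, ← Subgroup.card_top (G := N ⧸ M), ← hmap]
      exact Subgroup.card_map_dvd _ _
    have h3 := Subgroup.index_mul_card (commutator N)
    obtain ⟨c, hc⟩ := h2
    rw [hcN, hc] at h3
    have h4 : (commutator N).index * c = 2 := by
      apply Nat.eq_of_mul_eq_mul_right hApos
      rw [← h3]; ring
    have h5 : (commutator N).index ∣ 2 := ⟨c, h4.symm⟩
    have := (Nat.dvd_prime Nat.prime_two).1 h5
    exact hno _ (by omega) comm_char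
  rcases alt_hom hn θ with h1 | h1
  · left
    intro g hg
    apply perf_triv hperf M hMc
    intro x
    have := hθ ⟨g, hg⟩ x
    rw [h1, one_mul, inv_one, mul_one] at this
    exact QuotientGroup.eq.1 this.symm
  · rcases alt_hom hn η with h2 | h2
    · right
      intro g hg x
      have key : ∀ y, (MulAut.conj (π g) * β g) y = y := by
        apply perf_triv hperf M hMc
        intro x
        have e1 := hθ ⟨g, hg⟩ x
        have e2 := hη ⟨g, hg⟩
        rw [h2, one_mul] at e2
        have : QuotientGroup.mk' M ((MulAut.conj (π g) * β g) x) = QuotientGroup.mk' M x := by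
          rw [MulAut.mul_apply, MulAut.conj_apply, map_mul, map_mul, map_inv, e1, e2]; group
        exact QuotientGroup.eq.1 this.symm
      have := key x
      rw [MulAut.mul_apply, MulAut.conj_apply] at this
      calc β g x = (π g)⁻¹ * (π g * β g x * (π g)⁻¹) * π g := by group
        _ = _ := by rw [this]
    · exfalso
      obtain ⟨k, g, hg1, hg2, hk⟩ := fixpt hn hn6 θ η h1 h2 hKA.le
      obtain ⟨k, rfl⟩ := QuotientGroup.mk'_surjective M k
      have step : ∀ h, QuotientGroup.mk' M (π h) = QuotientGroup.mk' M k → QuotientGroup.mk' M (π (g * h)) = QuotientGroup.mk' M k := by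
        intro h hh
        rw [coc, map_mul, hθ, hη, hh]
        calc _ = (η g * QuotientGroup.mk' M k) * (θ g)⁻¹ := by group
            _ = _ := by rw [hk]; group
      obtain ⟨h, -, hh⟩ := H.surj k
      have m0 : QuotientGroup.mk' M (π h) = QuotientGroup.mk' M k := by rw [hh]
      have m1 := step _ m0
      have m2 := step _ m1
      have w1 : k⁻¹ * π (g * h) ∈ M := QuotientGroup.eq.1 m1.symm
      have w2 : k⁻¹ * π (g * (g * h)) ∈ M := QuotientGroup.eq.1 m2.symm
      have inj : ∀ a b, π a = π b → a = b := fun a b e => H.inj a trivial b trivial e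
      have n1 : k⁻¹ * π (g * h) ≠ 1 := by
        intro e
        have := inj _ _ ((inv_mul_eq_one.1 e).symm.trans hh.symm)
        apply hg1; apply Subtype.ext; simpa using this
      have n2 : k⁻¹ * π (g * (g * h)) ≠ 1 := by
        intro e
        have := inj _ _ ((inv_mul_eq_one.1 e).symm.trans hh.symm)
        rw [← mul_assoc] at this
        apply hg2; apply Subtype.ext; simpa using this
      have n3 : k⁻¹ * π (g * h) ≠ k⁻¹ * π (g * (g * h)) := by
        intro e
        have := inj _ _ (mul_left_cancel e)
        apply hg1; apply Subtype.ext
        simpa using this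
      obtain ⟨a, b, hab, huniv⟩ := Nat.card_eq_two_iff.1 hM2'
      have q : ∀ w : M, w = a ∨ w = b := fun w => by
        have : w ∈ (Set.univ : Set M) := trivial
        rw [← huniv] at this; exact this
      have q1 := q ⟨_, w1⟩
      have q2 := q ⟨_, w2⟩
      have q3 := q 1
      have r1 : (⟨_, w1⟩ : M) ≠ 1 := fun h => n1 (Subtype.ext_iff.1 h)
      have r2 : (⟨_, w2⟩ : M) ≠ 1 := fun h => n2 (Subtype.ext_iff.1 h)
      have r3 : (⟨_, w1⟩ : M) ≠ ⟨_, w2⟩ := fun h => n3 (Subtype.ext_iff.1 h)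
      generalize (⟨_, w1⟩ : M) = X at *
      generalize (⟨_, w2⟩ : M) = Y at *
      rcases q1 with q1 | q1 <;> rcases q2 with q2 | q2 <;> rcases q3 with q3 | q3 <;>
        first | exact r3 (q1.trans q2.symm) | exact r1 (q1.trans q3.symm) | exact r2 (q2.trans q3.symm)

theorem ThmA (hn : 5 ≤ n) (hn6 : n ≠ 6) (H : Dat n N β ⊤ π) :
    (∀ g ∈ alternatingGroup (Fin n), ∀ x, β g x = x) ∨ (∀ g ∈ alternatingGroup (Fin n), ∀ x, β g x = (π g)⁻¹ * x * π g) := by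
  by_cases h : ∃ H0 : Subgroup N, H0.index = 2 ∧ (∀ g, ∀ x ∈ H0, β g x ∈ H0)
  · obtain ⟨H0, h1, h2⟩ := h
    exact caseI' hn hn6 H H0 h1 h2
  · exact caseII hn hn6 H fun H0 h1 h2 => h ⟨H0, h1, h2⟩
end
end HG

namespace HG
open Equiv Equiv.Perm
variable {n : ℕ}

theorem ia {X : Type*} (f : Perm X) (x : X) : f⁻¹ (f x) = x := by simp
theorem ai {X : Type*} (f : Perm X) (x : X) : f (f⁻¹ x) = x := by simp

section gen
variable {G : Type} [Group G] {H : Subgroup (Perm G)}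

theorem reg_uniq (hr : IsRegularSubgroup H) {a b : Perm G} (ha : a ∈ H) (hb : b ∈ H) (h : a 1 = b 1) : a = b := by
  have := hr.1 (a₁ := ⟨a, ha⟩) (a₂ := ⟨b, hb⟩) h
  exact Subtype.ext_iff.1 this

theorem reg_ex (hr : IsRegularSubgroup H) (x : G) : ∃ a ∈ H, a 1 = x := by
  obtain ⟨a, h⟩ := hr.2 x
  exact ⟨a, a.2, h⟩

theorem comm_reg_one (hr : IsRegularSubgroup H) (c : Perm G) (hc : ∀ a ∈ H, a * c = c * a) (h1 : c 1 = 1) : c = 1 := by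
  ext x
  obtain ⟨a, ha, rfl⟩ := reg_ex hr x
  have := congrArg (fun f : Perm G => f 1) (hc a ha)
  simp only [Perm.mul_apply, h1] at this
  rw [← this]; rfl

theorem mem_cent {c : Perm G} : c ∈ Subgroup.centralizer (H : Set (Perm G)) ↔ ∀ a ∈ H, a * c = c * a :=
  Subgroup.mem_centralizer_iff

theorem cent_reg (hr : IsRegularSubgroup H) : IsRegularSubgroup (Subgroup.centralizer (H : Set (Perm G))) := by
  choose η hη hη1 using reg_ex hr
  have hmul : ∀ x y, η (η x y) = η x * η y := fun x y =>
    reg_uniq hr (hη _) (mul_mem (hη _) (hη _)) (by rw [hη1, Perm.mul_apply, hη1])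
  constructor
  · intro a b h
    have h : (a : Perm G) 1 = (b : Perm G) 1 := h
    have hab : (b : Perm G)⁻¹ * a ∈ Subgroup.centralizer (H : Set (Perm G)) := mul_mem (inv_mem b.2) a.2
    have := comm_reg_one hr _ (mem_cent.1 hab) (by rw [Perm.mul_apply, h]; simp)
    exact Subtype.ext (inv_mul_eq_one.1 this).symm
  · intro x
    have hinv : ∀ y, η (y) * η x = η (η y x) := fun y => (hmul y x).symm
    let r : Perm G :=
      { toFun := fun y => η y x
        invFun := fun y => η y ((η x)⁻¹ 1)
        left_inv := fun y => by
          show η (η y x) ((η x)⁻¹ 1) = y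
          rw [hmul, Perm.mul_apply, ai, hη1]
        right_inv := fun y => by
          show η (η y ((η x)⁻¹ 1)) x = y
          have e : η ((η x)⁻¹ 1) = (η x)⁻¹ := reg_uniq hr (hη _) (inv_mem (hη _)) (hη1 _)
          rw [hmul, e, Perm.mul_apply]
          have e2 : (η x)⁻¹ x = 1 := by
            conv_lhs => rw [show (η x)⁻¹ x = (η x)⁻¹ (η x 1) by rw [hη1]]
            exact ia _ _
          rw [e2, hη1] }
    refine ⟨⟨r, mem_cent.2 fun a ha => ?_⟩, ?_⟩
    · ext y
      show a (η y x) = η (a y) x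
      have : η (a y) = a * η y := reg_uniq hr (hη _) (mul_mem ha (hη _)) (by rw [hη1, Perm.mul_apply, hη1])
      rw [this]; rfl
    · show η 1 x = x
      have : η 1 = 1 := reg_uniq hr (hη _) (one_mem _) (hη1 _)
      rw [this]; rfl

theorem reg_le_eq {H' : Subgroup (Perm G)} (hr : IsRegularSubgroup H) (hr' : IsRegularSubgroup H') (h : H ≤ H') : H = H' := by
  apply le_antisymm h
  intro a ha
  obtain ⟨b, hb, hb1⟩ := reg_ex hr (a 1)
  rw [reg_uniq hr' ha (h hb) hb1.symm]; exact hb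

theorem cent_cent (hr : IsRegularSubgroup H) :
    Subgroup.centralizer ((Subgroup.centralizer (H : Set (Perm G)) : Subgroup (Perm G)) : Set (Perm G)) = H := by
  symm
  apply reg_le_eq hr (cent_reg (cent_reg hr))
  intro a ha
  exact mem_cent.2 fun c hc => (mem_cent.1 hc a ha).symm

theorem cent_norm (hl : IsNormalizedByLeft H) : IsNormalizedByLeft (Subgroup.centralizer (H : Set (Perm G))) := by
  intro g c hc
  refine mem_cent.2 fun a ha => ?_
  have h1 := hl g⁻¹ a ha
  have e : Equiv.mulLeft g⁻¹ = (Equiv.mulLeft g)⁻¹ := by ext x; rfl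
  rw [e, inv_inv] at h1
  have h2 := mem_cent.1 hc _ h1
  set l := Equiv.mulLeft g
  calc a * (l * c * l⁻¹) = l * ((l⁻¹ * a * l) * c) * l⁻¹ := by group
    _ = _ := by rw [h2]; group

theorem reg_dichotomy (n : ℕ) (hn : 5 ≤ n) (hn6 : n ≠ 6) (H : Subgroup (Perm (Perm (Fin n)))) (hr : IsRegularSubgroup H)
    (hl : IsNormalizedByLeft H) :
    (∀ g ∈ alternatingGroup (Fin n), Equiv.mulLeft g ∈ Subgroup.centralizer (H : Set (Perm (Perm (Fin n))))) ∨
    (∀ g ∈ alternatingGroup (Fin n), Equiv.mulLeft g ∈ H) := by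
  choose η hη hη1 using reg_ex hr
  have hL : ∀ g h : Perm (Fin n), Equiv.mulLeft (g * h) = Equiv.mulLeft g * Equiv.mulLeft h := fun g h => by ext; simp
  have hLi : ∀ g : Perm (Fin n), Equiv.mulLeft g⁻¹ = (Equiv.mulLeft g)⁻¹ := fun g => by ext; rfl
  let L : Perm (Fin n) →* Perm (Perm (Fin n)) := MonoidHom.mk' Equiv.mulLeft hL
  have hLa : ∀ g, L g = Equiv.mulLeft g := fun g => rfl
  let β : Perm (Fin n) →* MulAut H := MonoidHom.mk' (fun g =>
    { toFun := fun x => ⟨L g * x * (L g)⁻¹, hl g x x.2⟩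
      invFun := fun x => ⟨L g⁻¹ * x * (L g⁻¹)⁻¹, hl g⁻¹ x x.2⟩
      left_inv := fun x => Subtype.ext (by
        show L g⁻¹ * (L g * x * (L g)⁻¹) * (L g⁻¹)⁻¹ = x
        rw [map_inv]; group)
      right_inv := fun x => Subtype.ext (by
        show L g * (L g⁻¹ * x * (L g⁻¹)⁻¹) * (L g)⁻¹ = x
        rw [map_inv]; group)
      map_mul' := fun x y => Subtype.ext (by
        show L g * (x * y) * (L g)⁻¹ = L g * x * (L g)⁻¹ * (L g * y * (L g)⁻¹)
        group) }) (by
      intro g h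
      ext1 x
      apply Subtype.ext
      show L (g * h) * x * (L (g * h))⁻¹ = L g * (L h * x * (L h)⁻¹) * (L g)⁻¹
      rw [map_mul]; group)
  have hβ : ∀ g (x : H), ((β g x : H) : Perm (Perm (Fin n))) = Equiv.mulLeft g * x * (Equiv.mulLeft g)⁻¹ := fun g x => rfl
  let π : Perm (Fin n) → H := fun g => ⟨(η g)⁻¹, inv_mem (hη g)⟩
  have hπ : ∀ g, ((π g : H) : Perm (Perm (Fin n))) = (η g)⁻¹ := fun _ => rfl
  have D : Dat n H β ⊤ π := by
    constructor
    · exact le_top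
    · intro g _ h _
      apply Subtype.ext
      rw [Subgroup.coe_mul, hβ, hπ, hπ, hπ]
      have : η (g * h) = (Equiv.mulLeft g * η h * (Equiv.mulLeft g)⁻¹) * η g := by
        apply reg_uniq hr (hη _) (mul_mem (hl _ _ (hη _)) (hη _))
        rw [hη1, Perm.mul_apply, hη1, Perm.mul_apply, Perm.mul_apply]
        have : (Equiv.mulLeft g)⁻¹ g = 1 := by rw [← hLi]; simp
        rw [this, hη1]; rfl
      rw [this]; group
    · intro g _ h _ e
      have := Subtype.ext_iff.1 e
      rw [hπ, hπ, inv_inj] at this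
      rw [← hη1 g, this, hη1]
    · intro k
      refine ⟨(k : Perm (Perm (Fin n)))⁻¹ 1, trivial, Subtype.ext ?_⟩
      rw [hπ, inv_eq_iff_eq_inv]
      exact reg_uniq hr (hη _) (inv_mem k.2) (hη1 _)
  rcases ThmA hn hn6 D with h | h
  · left
    intro g hg
    refine mem_cent.2 fun a ha => ?_
    have := Subtype.ext_iff.1 (h g hg ⟨a, ha⟩)
    rw [hβ] at this
    exact (mul_inv_eq_iff_eq_mul.1 this).symm
  · right
    intro g hg
    have : (η g)⁻¹ * Equiv.mulLeft g = 1 := by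
      apply comm_reg_one hr
      · intro a ha
        have := Subtype.ext_iff.1 (h g hg ⟨a, ha⟩)
        rw [hβ, Subgroup.coe_mul, Subgroup.coe_mul, Subgroup.coe_inv, hπ, inv_inv] at this
        have := mul_inv_eq_iff_eq_mul.1 this
        rw [mul_assoc, this]
        show _ = (η g)⁻¹ * (η g * a * (η g)⁻¹ * _)
        group
      · rw [Perm.mul_apply]
        show (η g)⁻¹ (g * 1) = 1
        rw [mul_one]
        nth_rewrite 2 [← hη1 g]
        rw [ia]
    rw [← inv_mul_eq_one.1 this]; exact hη g
end gen
end HG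

namespace HG
open Equiv Equiv.Perm

theorem card_invol (n : ℕ) : Nat.card {s : Perm (Fin n) // s * s = 1} =
    ∑ k ∈ Finset.range (n / 2 + 1), n.factorial / ((n - 2 * k).factorial * 2 ^ k * k.factorial) := by
  classical
  haveI : Fact (Nat.Prime 2) := ⟨Nat.prime_two⟩
  have hsum : ∀ s : Perm (Fin n), s.cycleType.sum ≤ n := fun s => by
    rw [sum_cycleType]; simpa using Finset.card_le_univ s.support
  rw [Nat.card_eq_fintype_card, Fintype.card_subtype]
  rw [Finset.card_eq_sum_card_fiberwise (f := fun s => Multiset.card s.cycleType) (t := Finset.range (n / 2 + 1))]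
  · apply Finset.sum_congr rfl
    intro k hk
    rw [Finset.mem_range] at hk
    have h2 := card_of_cycleType (Fin n) (Multiset.replicate k 2)
    have e : (Finset.univ.filter fun s : Perm (Fin n) => s * s = 1).filter (fun s => Multiset.card s.cycleType = k) =
        Finset.univ.filter fun s : Perm (Fin n) => s.cycleType = Multiset.replicate k 2 := by
      ext s
      simp only [Finset.mem_filter, Finset.mem_univ, true_and]
      constructor
      · rintro ⟨h, hc⟩
        rw [Multiset.eq_replicate]
        refine ⟨hc, fun b hb => ?_⟩
        have := dvd_of_mem_cycleType hb
        have h3 := orderOf_dvd_of_pow_eq_one ((pow_two s).trans h)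
        have h4 := two_le_of_mem_cycleType hb
        have := Nat.le_of_dvd (by norm_num) (this.trans h3)
        omega
      · intro h
        refine ⟨?_, by rw [h]; simp⟩
        rw [← pow_two, ← orderOf_dvd_iff_pow_eq_one, ← lcm_cycleType, h]
        apply Multiset.lcm_dvd.2
        intro b hb
        rw [Multiset.eq_of_mem_replicate hb]
    rw [e, h2, if_pos]
    · simp only [Fintype.card_fin, Multiset.sum_replicate, smul_eq_mul, Multiset.prod_replicate]
      rw [mul_comm k 2]
      congr 2
      rcases Nat.eq_zero_or_pos k with rfl | h
      · simp
      · rw [Multiset.toFinset_replicate, if_neg (by omega)]; simp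
    · refine ⟨?_, fun a ha => ?_⟩
      · simp; omega
      · rw [Multiset.eq_of_mem_replicate ha]
  · intro s hs
    simp only [Finset.coe_range, Set.mem_Iio]
    have h1 := hsum s
    have h2 : Multiset.card s.cycleType • 2 ≤ s.cycleType.sum := Multiset.card_nsmul_le_sum fun x hx => two_le_of_mem_cycleType hx
    rw [smul_eq_mul] at h2
    omega
end HG

namespace HG
open Equiv Equiv.Perm
variable {n : ℕ}

theorem cent_alt (hn : 5 ≤ n) (z : Perm (Fin n)) (h : ∀ b ∈ alternatingGroup (Fin n), z * b = b * z) : z = 1 := by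
  ext1 a
  by_contra hne
  have hne : z a ≠ a := hne
  obtain ⟨b, hb⟩ : ∃ b, b ∉ ({a, z a} : Finset (Fin n)) := by
    by_contra! hc
    have : (Finset.univ : Finset (Fin n)).card ≤ _ := Finset.card_le_card fun x _ => hc x
    have h2 := Finset.card_le_two (a := a) (b := z a)
    simp at this; omega
  obtain ⟨c, hc⟩ : ∃ c, c ∉ ({a, z a, b} : Finset (Fin n)) := by
    by_contra! hc
    have : (Finset.univ : Finset (Fin n)).card ≤ _ := Finset.card_le_card fun x _ => hc x
    have h2 := Finset.card_le_three (a := a) (b := z a) (c := b)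
    simp at this; omega
  simp only [Finset.mem_insert, Finset.mem_singleton, not_or] at hb hc
  have h3 := tc_three (Ne.symm hb.1) (Ne.symm hc.1) (Ne.symm hc.2.2)
  have := congrArg (fun f : Perm (Fin n) => f a) (h (tc a b c) (mem_alternatingGroup.2 h3.sign))
  simp only [Perm.mul_apply] at this
  rw [tc_a (Ne.symm hb.1) (Ne.symm hc.1), tc_o hne (Ne.symm hb.2) (Ne.symm hc.2.1)] at this
  exact hb.1 (z.injective this)

/-- twisting element -/
def w (s x : Perm (Fin n)) : Perm (Fin n) := if sign x = 1 then 1 else s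

theorem w_congr (s : Perm (Fin n)) {x y : Perm (Fin n)} (h : sign x = sign y) : w s x = w s y := by
  unfold w; rw [h]

theorem w_mul {s : Perm (Fin n)} (hs : s * s = 1) (x y : Perm (Fin n)) : w s (x * y) = w s x * w s y := by
  unfold w
  rw [Perm.sign_mul]
  rcases Int.units_eq_one_or (sign x) with h1 | h1 <;> rcases Int.units_eq_one_or (sign y) with h2 | h2 <;> simp [h1, h2, hs]

theorem w_inv {s : Perm (Fin n)} (hs : s * s = 1) (x : Perm (Fin n)) : w s x⁻¹ = (w s x)⁻¹ := by
  have := w_mul hs x⁻¹ x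
  rw [inv_mul_cancel] at this
  have h1 : w s 1 = 1 := by simp [w]
  rw [h1] at this
  exact eq_inv_of_mul_eq_one_left this.symm

theorem w_even (s : Perm (Fin n)) {x : Perm (Fin n)} (h : sign x = 1) : w s x = 1 := by unfold w; rw [if_pos h]
theorem w_odd (s : Perm (Fin n)) {x : Perm (Fin n)} (h : sign x = -1) : w s x = s := by unfold w; rw [h, if_neg (by decide)]

/-- the subgroups -/
def Hs (s : {s : Perm (Fin n) // s * s = 1}) : Subgroup (Perm (Perm (Fin n))) where
  carrier := {f | ∃ x, ∀ b, f b = x * w s x * b * (w s x)⁻¹}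
  one_mem' := ⟨1, fun b => by rw [w_even _ (by simp)]; simp⟩
  mul_mem' := by
    rintro f g ⟨x, hx⟩ ⟨y, hy⟩
    refine ⟨x * (w s x * y * (w s x)⁻¹), fun b => ?_⟩
    have : w s (x * (w s x * y * (w s x)⁻¹)) = w s x * w s y := by
      rw [← w_mul s.2]; apply w_congr
      simp only [Perm.sign_mul, Perm.sign_inv]
      rw [mul_comm (sign (w s x)) (sign y), mul_assoc (sign y), Int.units_mul_self, mul_one]
    rw [this, Perm.mul_apply, hx, hy]; group
  inv_mem' := by
    rintro f ⟨x, hx⟩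
    refine ⟨(w s x)⁻¹ * x⁻¹ * w s x, fun b => ?_⟩
    have : w s ((w s x)⁻¹ * x⁻¹ * w s x) = (w s x)⁻¹ := by
      refine (w_congr _ ?_).trans (w_inv s.2 x)
      simp only [Perm.sign_mul, Perm.sign_inv]
      rw [mul_comm (sign (w s x)) (sign x), mul_assoc (sign x), Int.units_mul_self, mul_one]
    rw [this]
    apply f.injective
    rw [ai, hx]; group

theorem mem_Hs {s : {s : Perm (Fin n) // s * s = 1}} {f} : f ∈ Hs s ↔ ∃ x, ∀ b, f b = x * w s x * b * (w s x)⁻¹ := Iff.rfl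

theorem Hs_reg (s : {s : Perm (Fin n) // s * s = 1}) : IsRegularSubgroup (Hs s) := by
  constructor
  · rintro ⟨f, x, hx⟩ ⟨g, y, hy⟩ h
    have h : f 1 = g 1 := h
    rw [hx, hy] at h
    have h : x = y := by simpa using h
    subst h
    apply Subtype.ext
    ext1 b
    rw [hx, hy]
  · intro x
    refine ⟨⟨Equiv.mulLeft x * (MulAut.conj (w s x)).toEquiv, x, fun b => ?_⟩, ?_⟩
    · show x * (w s x * b * (w s x)⁻¹) = _
      group
    · show x * (w s x * 1 * (w s x)⁻¹) = _
      group

theorem Hs_norm (s : {s : Perm (Fin n) // s * s = 1}) : IsNormalizedByLeft (Hs s) := by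
  rintro g f ⟨x, hx⟩
  refine ⟨g * x * w s x * g⁻¹ * (w s x)⁻¹, fun b => ?_⟩
  have : w s (g * x * w s x * g⁻¹ * (w s x)⁻¹) = w s x := by
    apply w_congr
    simp only [Perm.sign_mul, Perm.sign_inv]
    rcases Int.units_eq_one_or (sign x) with h1 | h1 <;> rcases Int.units_eq_one_or (sign g) with h2 | h2 <;>
      rcases Int.units_eq_one_or (sign (w s x)) with h3 | h3 <;> rw [h1, h2, h3] <;> rfl
  rw [this]
  have e : (Equiv.mulLeft g)⁻¹ b = g⁻¹ * b := rfl
  rw [Perm.mul_apply, Perm.mul_apply, e, hx]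
  show g * _ = _
  group

theorem alt_mem_Hs (s : {s : Perm (Fin n) // s * s = 1}) (g) (hg : g ∈ alternatingGroup (Fin n)) : Equiv.mulLeft g ∈ Hs s :=
  ⟨g, fun b => by rw [w_even _ (mem_alternatingGroup.1 hg)]; simp⟩

theorem Hs_inj (hn : 5 ≤ n) : Function.Injective (Hs (n := n)) := by
  intro s s' h
  let t : Perm (Fin n) := swap ⟨0, by omega⟩ ⟨1, by omega⟩
  have ht : sign t = -1 := sign_swap (by simp)
  let f : Perm (Perm (Fin n)) := Equiv.mulLeft t * (MulAut.conj (s : Perm (Fin n))).toEquiv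
  have hf : ∀ b, f b = t * (s * b * (s : Perm (Fin n))⁻¹) := fun b => rfl
  have hm : f ∈ Hs s := ⟨t, fun b => by rw [w_odd _ ht, hf]; group⟩
  rw [h] at hm
  obtain ⟨x, hx⟩ := hm
  have h1 := hx 1
  rw [hf] at h1
  have h1 : t = x := by simpa using h1
  subst h1
  apply Subtype.ext
  have := cent_alt hn ((s' : Perm (Fin n))⁻¹ * s) (by
    intro b _
    have h2 := hx b
    rw [hf, w_odd _ ht] at h2
    have h3 : (s : Perm (Fin n)) * b * (s : Perm (Fin n))⁻¹ = s' * b * (s' : Perm (Fin n))⁻¹ := by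
      apply mul_left_cancel (a := t); rw [h2]; group
    calc (s' : Perm (Fin n))⁻¹ * s * b = (s' : Perm (Fin n))⁻¹ * (s * b * (s : Perm (Fin n))⁻¹) * s := by group
      _ = _ := by rw [h3]; group)
  exact (inv_mul_eq_one.1 this).symm

theorem classify (hn : 5 ≤ n) (hn6 : n ≠ 6) (H : Subgroup (Perm (Perm (Fin n)))) (hr : IsRegularSubgroup H)
    (hl : IsNormalizedByLeft H) (hA : ∀ g ∈ alternatingGroup (Fin n), Equiv.mulLeft g ∈ H) : ∃ s, Hs s = H := by
  choose η hη hη1 using reg_ex hr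
  let t : Perm (Fin n) := swap ⟨0, by omega⟩ ⟨1, by omega⟩
  have ht : sign t = -1 := sign_swap (by simp)
  have htt : t * t = 1 := swap_mul_self _ _
  have hti : t⁻¹ = t := by rw [inv_eq_iff_mul_eq_one]; exact htt
  have uq : ∀ f ∈ H, f = η (f 1) := fun f hf => reg_uniq hr hf (hη _) (hη1 _).symm
  have hev : ∀ a, sign a = 1 → η a = Equiv.mulLeft a := by
    intro a ha
    have := uq _ (hA a ha)
    rw [this]; simp
  let φ : Perm (Perm (Fin n)) := (Equiv.mulLeft t)⁻¹ * η t
  have hφ : ∀ b, η t b = t * φ b := by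
    intro b
    show _ = t * (t⁻¹ * η t b)
    group
  have hφ1 : φ 1 = 1 := by
    have := hφ 1
    rw [hη1] at this
    exact (mul_eq_left.1 this.symm)
  have hod : ∀ x, sign x = -1 → ∀ b, η x b = x * φ b := by
    intro x hx b
    have h1 : sign (x * t⁻¹) = 1 := by rw [Perm.sign_mul, Perm.sign_inv, hx, ht]; rfl
    have h2 : η x = Equiv.mulLeft (x * t⁻¹) * η t := by
      have := uq _ (mul_mem (hA _ h1) (hη t))
      rw [this, Perm.mul_apply, hη1]; simp
    rw [h2, Perm.mul_apply, hφ]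
    show x * t⁻¹ * (t * φ b) = _
    group
  have nott : ∀ y, sign y = 1 → η t ≠ Equiv.mulLeft y := by
    intro y hy h
    have := congrArg (fun f : Perm (Perm (Fin n)) => f 1) h
    simp only [hη1] at this
    have this : t = y := by simpa using this
    rw [this, hy] at ht
    exact absurd ht (by decide)
  have hL : ∀ g h : Perm (Fin n), Equiv.mulLeft (g * h) = Equiv.mulLeft g * Equiv.mulLeft h := fun g h => by ext; simp
  have hLi : ∀ g : Perm (Fin n), Equiv.mulLeft g⁻¹ = (Equiv.mulLeft g)⁻¹ := fun g => by ext; rfl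
  have par1 : ∀ b, sign b = 1 → sign (φ b) = 1 := by
    intro b hb
    by_contra hc
    have hc := (Int.units_eq_one_or _).resolve_left hc
    have h1 : sign (t * φ b) = 1 := by rw [Perm.sign_mul, ht, hc]; rfl
    have h2 := uq _ (mul_mem (hη t) (hA b hb))
    have h3 : (η t * Equiv.mulLeft b) 1 = t * φ b := by
      rw [← hφ]; simp
    rw [h3, hev _ h1] at h2
    refine nott (t * φ b * b⁻¹) ?_ ?_
    · rw [Perm.sign_mul, Perm.sign_inv, h1, hb]; rfl
    · rw [hL, ← h2, hLi]; group
  have par2 : ∀ b, sign b = -1 → sign (φ b) = -1 := by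
    intro b hb
    by_contra hc
    have hc := (Int.units_eq_one_or _).resolve_right hc
    have h1 : sign (t * φ b * t⁻¹) = 1 := by rw [Perm.sign_mul, Perm.sign_mul, Perm.sign_inv, ht, hc]; rfl
    have h0 : sign (b * t⁻¹) = 1 := by rw [Perm.sign_mul, Perm.sign_inv, hb, ht]; rfl
    have h2 : η t * Equiv.mulLeft (b * t⁻¹) * η t = Equiv.mulLeft (t * φ b * t⁻¹) * η t := by
      apply reg_uniq hr (mul_mem (mul_mem (hη t) (hA _ h0)) (hη t)) (mul_mem (hA _ h1) (hη t))
      rw [Perm.mul_apply, Perm.mul_apply, Perm.mul_apply, hη1]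
      show η t (b * t⁻¹ * t) = t * φ b * t⁻¹ * t
      rw [inv_mul_cancel_right, inv_mul_cancel_right, hφ]
    have h3 := mul_right_cancel h2
    refine nott (t * φ b * t⁻¹ * (b * t⁻¹)⁻¹) ?_ ?_
    · rw [Perm.sign_mul, Perm.sign_inv, h1, h0]; rfl
    · rw [hL, ← h3, hLi]; group
  have hmul : ∀ b, sign b = 1 → ∀ c, φ (b * c) = φ b * φ c := by
    intro b hb c
    have h1 : φ * Equiv.mulLeft b * φ⁻¹ ∈ H := by
      have := hl t⁻¹ _ (mul_mem (mul_mem (hη t) (hA b hb)) (inv_mem (hη t)))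
      rw [hLi] at this
      have e : φ * Equiv.mulLeft b * φ⁻¹ = (Equiv.mulLeft t)⁻¹ * (η t * Equiv.mulLeft b * (η t)⁻¹) * ((Equiv.mulLeft t)⁻¹)⁻¹ := by
        show (Equiv.mulLeft t)⁻¹ * η t * _ * ((Equiv.mulLeft t)⁻¹ * η t)⁻¹ = _
        group
      rw [e]; exact this
    have h2 := uq _ h1
    have e1 : φ⁻¹ 1 = 1 := by
      conv_lhs => rw [show φ⁻¹ 1 = φ⁻¹ (φ 1) by rw [hφ1]]
      exact ia _ _
    have h3 : (φ * Equiv.mulLeft b * φ⁻¹) 1 = φ b := by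
      rw [Perm.mul_apply, Perm.mul_apply, e1]
      show φ (b * 1) = _
      rw [mul_one]
    rw [h3, hev _ (par1 b hb)] at h2
    have h4 := mul_inv_eq_iff_eq_mul.1 h2
    have := congrArg (fun f : Perm (Perm (Fin n)) => f c) h4
    exact this
  let ψ : alternatingGroup (Fin n) →* alternatingGroup (Fin n) :=
    MonoidHom.mk' (fun b => ⟨φ b, mem_alternatingGroup.2 (par1 b (mem_alternatingGroup.1 b.2))⟩)
      (fun b c => Subtype.ext (hmul b (mem_alternatingGroup.1 b.2) c))
  have hψ : Function.Injective ψ := fun b c h => Subtype.ext (φ.injective (Subtype.ext_iff.1 h))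
  obtain ⟨s, hs⟩ := AutAn hn hn6 (MulEquiv.ofBijective ψ (Finite.injective_iff_bijective.1 hψ))
  have hse : ∀ b, sign b = 1 → φ b = s * b * s⁻¹ := fun b hb => hs ⟨b, mem_alternatingGroup.2 hb⟩
  obtain ⟨c, hc⟩ : ∃ c, φ t = s * t * c := ⟨t⁻¹ * s⁻¹ * φ t, by group⟩
  have hso : ∀ x, sign x = -1 → φ x = s * x * c := by
    intro x hx
    have h1 : sign (x * t⁻¹) = 1 := by rw [Perm.sign_mul, Perm.sign_inv, hx, ht]; rfl
    have := hmul _ h1 t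
    rw [inv_mul_cancel_right, hse _ h1, hc] at this
    rw [this]; group
  have hcs : c = s := by
    have h1 : sign (t * φ t) = 1 := by rw [Perm.sign_mul, par2 t ht, ht]; rfl
    have h2 : η t * η t = Equiv.mulLeft (t * φ t) := by
      rw [← hev _ h1, uq _ (mul_mem (hη t) (hη t)), Perm.mul_apply, hη1, hφ]
    have := cent_alt hn (c⁻¹ * s) (by
      intro b hb
      have hb := mem_alternatingGroup.1 hb
      have h3 := congrArg (fun f : Perm (Perm (Fin n)) => f b) h2
      simp only [Perm.mul_apply] at h3
      rw [hφ, hφ] at h3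
      have h3 : t * φ (t * φ b) = t * φ t * b := h3
      have h4 : sign (t * φ b) = -1 := by rw [Perm.sign_mul, par1 b hb, ht]; rfl
      rw [hso _ h4, hse b hb, hc] at h3
      have h5 : s * b * s⁻¹ * c = c * b := by
        apply mul_left_cancel (a := t * s * t)
        calc _ = t * (s * (t * (s * b * s⁻¹)) * c) := by group
          _ = _ := by rw [h3]; group
      calc c⁻¹ * s * b = c⁻¹ * (s * b * s⁻¹ * c) * c⁻¹ * s := by group
        _ = _ := by rw [h5]; group)
    exact (inv_mul_eq_one.1 this)
  rw [hcs] at hso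
  have hss : s * s = 1 := by
    apply cent_alt hn
    intro b hb
    have hb := mem_alternatingGroup.1 hb
    have h1 := hl t _ (hη t)
    have h2 := uq _ h1
    have e : ∀ b, (Equiv.mulLeft t * η t * (Equiv.mulLeft t)⁻¹) b = φ (t * b) := by
      intro b
      show t * η t (t⁻¹ * b) = _
      rw [hφ, hti, ← mul_assoc, htt, one_mul]
    rw [e, mul_one] at h2
    have h3 := DFunLike.congr_fun h2 b
    have h4 : sign (t * b) = -1 := by rw [Perm.sign_mul, hb, ht]; rfl
    rw [e, hod _ (par2 t ht), hso _ h4, hse _ hb, hso _ ht] at h3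
    have h5 : b * s = s * s * b * s⁻¹ := by
      apply mul_left_cancel (a := s * t)
      calc _ = s * (t * b) * s := by group
        _ = _ := by rw [h3]; group
    calc s * s * b = s * s * b * s⁻¹ * s := by group
      _ = _ := by rw [← h5]; group
  refine ⟨⟨s, hss⟩, reg_le_eq (Hs_reg _) hr ?_⟩
  rintro f ⟨x, hx⟩
  have : f = η x := by
    ext1 b
    rw [hx]
    rcases Int.units_eq_one_or (sign x) with h1 | h1
    · rw [w_even _ h1, hev _ h1]; simp
    · rw [w_odd _ h1, hod _ h1]
      show x * s * b * s⁻¹ = _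
      rcases Int.units_eq_one_or (sign b) with h2 | h2
      · rw [hse _ h2]; group
      · have : s⁻¹ = s := by rw [inv_eq_iff_mul_eq_one]; exact hss
        rw [hso _ h2, this]; group
  rw [this]; exact hη x

theorem main (n : ℕ) (hn : 5 ≤ n) (hn6 : n ≠ 6) :
    Nat.card {H : Subgroup (Equiv.Perm (Equiv.Perm (Fin n))) //
        IsRegularSubgroup H ∧ IsNormalizedByLeft H} =
      2 * ∑ k ∈ Finset.range (n / 2 + 1),
        n.factorial / ((n - 2 * k).factorial * 2 ^ k * k.factorial) := by
  rw [← card_invol n]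
  let I := {s : Perm (Fin n) // s * s = 1}
  let F : I ⊕ I → {H : Subgroup (Equiv.Perm (Equiv.Perm (Fin n))) // IsRegularSubgroup H ∧ IsNormalizedByLeft H} :=
    Sum.elim (fun s => ⟨Hs s, Hs_reg s, Hs_norm s⟩)
      (fun s => ⟨Subgroup.centralizer (Hs s : Set (Perm (Perm (Fin n)))), cent_reg (Hs_reg s), cent_norm (Hs_norm s)⟩)
  have hdis : ∀ s s' : I, Hs s ≠ Subgroup.centralizer (Hs s' : Set (Perm (Perm (Fin n)))) := by
    intro s s' h
    have key : ∀ a ∈ alternatingGroup (Fin n), a = 1 := by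
      intro a ha
      apply cent_alt hn
      intro b hb
      have h1 := alt_mem_Hs s a ha
      rw [h] at h1
      have h2 := mem_cent.1 h1 _ (alt_mem_Hs s' b hb)
      have := congrArg (fun f : Perm (Perm (Fin n)) => f 1) h2
      simp only [Perm.mul_apply] at this
      have this : b * (a * 1) = a * (b * 1) := this
      rw [mul_one, mul_one] at this
      exact this.symm
    have h3 := alt_card hn
    have h4 : Nat.card (alternatingGroup (Fin n)) ≤ 1 := by
      haveI : Subsingleton (alternatingGroup (Fin n)) := ⟨fun a b => Subtype.ext ((key a a.2).trans (key b b.2).symm)⟩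
      exact Finite.card_le_one_iff_subsingleton.2 inferInstance
    have h5 : Nat.factorial 5 ≤ n.factorial := Nat.factorial_le hn
    have : Nat.factorial 5 = 120 := by decide
    omega
  have hF : Function.Bijective F := by
    constructor
    · rintro (s | s) (s' | s') h
      · exact congrArg _ (Hs_inj hn (Subtype.ext_iff.1 h))
      · exact absurd (Subtype.ext_iff.1 h) (hdis s s')
      · exact absurd (Subtype.ext_iff.1 h).symm (hdis s' s)
      · have h1 : Subgroup.centralizer (Hs s : Set (Perm (Perm (Fin n)))) = Subgroup.centralizer (Hs s' : Set (Perm (Perm (Fin n)))) := Subtype.ext_iff.1 h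
        have h2 := cent_cent (Hs_reg s)
        rw [h1, cent_cent (Hs_reg s')] at h2
        exact congrArg _ (Hs_inj hn h2.symm)
    · rintro ⟨H, hr, hl⟩
      rcases reg_dichotomy n hn hn6 H hr hl with h | h
      · obtain ⟨s, hs⟩ := classify hn hn6 _ (cent_reg hr) (cent_norm hl) h
        refine ⟨Sum.inr s, Subtype.ext ?_⟩
        show Subgroup.centralizer (Hs s : Set (Perm (Perm (Fin n)))) = H
        rw [hs, cent_cent hr]
      · obtain ⟨s, hs⟩ := classify hn hn6 H hr hl h
        exact ⟨Sum.inl s, Subtype.ext hs⟩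
  rw [← Nat.card_congr (Equiv.ofBijective F hF), Nat.card_sum, two_mul]
end HG

theorem stmt_3 (n : ℕ) (hn : 5 ≤ n) (hn6 : n ≠ 6) :
    Nat.card {H : Subgroup (Equiv.Perm (Equiv.Perm (Fin n))) //
        IsRegularSubgroup H ∧ IsNormalizedByLeft H} =
      2 * ∑ k ∈ Finset.range (n / 2 + 1),
        n.factorial / ((n - 2 * k).factorial * 2 ^ k * k.factorial) := by
  exact HG.main n hn hn6
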